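/- arXiv:2412.07058 — 4 statements merged into one kernel-verified Lean document; each statement's English description precedes it below -/
import Mathlib

section
/- Let (d_n) be a sequence of integers with d_n ≥ 3 and d_n/√n → 0, and restrict to even n with d_n < n (so the set of simple d_n-regular graphs on {1,…,n} is nonempty). Let E_{G,θ} denote the average over a uniformly random simple d_n-regular graph G on {1,…,n} and the uniform average (2π)^{-n} ∫_{[0,2π]^n} dθ over angles. Then limsup_{n→∞} E_{G,θ}[m₂(G,θ)] / 2^{d_n²} ≤ 3. -/
open scoped BigOperators
open MeasureTheory

noncomputable section

/-- The amplitude `2^{-n} Σ_z (−1)^{Σ_{i<j} m_{ij} z_i z_j + Σ_i x_i z_i}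
Π_j exp(−i θ_j (−1)^{z_j})` of measuring the graph state of the multigraph with edge
multiplicities `m` in the X-Y plane product basis with angles `θ`, at outcome `x`. -/
def gsAmp (n : ℕ) (m : Fin n → Fin n → ℕ) (θ : Fin n → ℝ) (x : Fin n → Bool) : ℂ :=
  (1 / 2 ^ n : ℂ) * ∑ z : Fin n → Bool,
    (-1 : ℂ) ^ ((∑ i : Fin n, ∑ j : Fin n, if i < j ∧ z i ∧ z j then m i j else 0) +
        ∑ i : Fin n, (if x i ∧ z i then 1 else 0)) *
      ∏ j : Fin n, Complex.exp (-Complex.I * (θ j : ℂ) * (-1 : ℂ) ^ (if z j then 1 else 0))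

/-- The output probability `p_{G,θ}(x)`. -/
def gsProb (n : ℕ) (m : Fin n → Fin n → ℕ) (θ : Fin n → ℝ) (x : Fin n → Bool) : ℝ :=
  Complex.normSq (gsAmp n m θ x)

/-- The normalized second moment `m₂(G,θ) = 2^n Σ_x p_{G,θ}(x)²`. -/
def secondMoment (n : ℕ) (m : Fin n → Fin n → ℕ) (θ : Fin n → ℝ) : ℝ :=
  2 ^ n * ∑ x : Fin n → Bool, (gsProb n m θ x) ^ 2

/-- The uniform average `(2π)^{-n} ∫_{[0,2π]^n} m₂(G,θ) dθ` over measurement angles. -/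
def avgSecondMoment (n : ℕ) (m : Fin n → Fin n → ℕ) : ℝ :=
  ((2 * Real.pi) ^ n)⁻¹ *
    ∫ θ in Set.univ.pi (fun _ : Fin n => Set.Icc (0 : ℝ) (2 * Real.pi)), secondMoment n m θ

open Classical in
/-- The (finite) set of simple `d`-regular graphs on `{1,…,n}`. -/
def regularGraphs (n d : ℕ) : Finset (SimpleGraph (Fin n)) :=
  Finset.univ.filter fun G => ∀ v, (Finset.univ.filter fun w => G.Adj v w).card = d

open Classical in
/-- `E_{G,θ}[m₂(G,θ)]` for a uniformly random simple `d`-regular graph on `{1,…,n}`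
and uniformly random angles. -/
def regularAvgM2 (n d : ℕ) : ℝ :=
  (∑ G ∈ regularGraphs n d, avgSecondMoment n (fun i j => if G.Adj i j then 1 else 0)) /
    ((regularGraphs n d).card : ℝ)

/-- The perfect matchings of the finite set `S`, as involutions with support `S`. -/
def perfectMatchings {α : Type*} [Fintype α] [DecidableEq α] (S : Finset α) :
    Finset (Equiv.Perm α) :=
  Finset.univ.filter fun σ => σ * σ = 1 ∧ σ.support = S

section Matchings

variable {α : Type*} [Fintype α] [DecidableEq α]

lemma mem_perfectMatchings {S : Finset α} {σ : Equiv.Perm α} :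
    σ ∈ perfectMatchings S ↔ (∀ p, σ (σ p) = p) ∧ ∀ p, σ p ≠ p ↔ p ∈ S := by
  simp [perfectMatchings, Equiv.ext_iff, Finset.ext_iff]

lemma mul_swap_mem_perfectMatchings {S : Finset α} {σ : Equiv.Perm α} {x y : α}
    (hσ : σ ∈ perfectMatchings S) (hxy : x ≠ y) (h : σ x = y) :
    σ * Equiv.swap x y ∈ perfectMatchings (S \ {x, y}) := by
  rw [mem_perfectMatchings] at hσ ⊢
  obtain ⟨h1, h2⟩ := hσ
  have h' : σ y = x := by rw [← h, h1]
  have key : ∀ p, (σ * Equiv.swap x y) p = if p = x then x else if p = y then y else σ p := by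
    intro p
    rw [Equiv.Perm.mul_apply, Equiv.swap_apply_def]
    split_ifs <;> simp_all
  have hx : ∀ p, σ p = x ↔ p = y := fun p => by
    rw [← h']; exact σ.injective.eq_iff
  have hy : ∀ p, σ p = y ↔ p = x := fun p => by
    rw [← h]; exact σ.injective.eq_iff
  constructor
  · intro p
    rw [key, key]
    split_ifs <;> simp_all
  · intro p
    rw [key, Finset.mem_sdiff, ← h2 p]
    split_ifs <;> simp_all

lemma mul_swap_mem_perfectMatchings' {S : Finset α} {σ : Equiv.Perm α} {x y : α}
    (hxS : x ∈ S) (hyS : y ∈ S)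
    (hσ : σ ∈ perfectMatchings (S \ {x, y})) (hxy : x ≠ y) :
    σ * Equiv.swap x y ∈ perfectMatchings S ∧ (σ * Equiv.swap x y) x = y := by
  rw [mem_perfectMatchings] at hσ ⊢
  obtain ⟨h1, h2⟩ := hσ
  have hx : σ x = x := by by_contra hc; have := (h2 x).1 hc; simp at this
  have hy : σ y = y := by by_contra hc; have := (h2 y).1 hc; simp at this
  have key : ∀ p, (σ * Equiv.swap x y) p = if p = x then y else if p = y then x else σ p := by
    intro p
    rw [Equiv.Perm.mul_apply, Equiv.swap_apply_def]
    split_ifs <;> simp_all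
  have hx' : ∀ p, σ p = x ↔ p = x := fun p => by
    conv_lhs => rw [← hx]
    exact σ.injective.eq_iff
  have hy' : ∀ p, σ p = y ↔ p = y := fun p => by
    conv_lhs => rw [← hy]
    exact σ.injective.eq_iff
  refine ⟨⟨?_, ?_⟩, ?_⟩
  · intro p
    rw [key, key]
    split_ifs <;> simp_all
  · intro p
    have := h2 p
    rw [Finset.mem_sdiff] at this
    rw [key]
    rcases eq_or_ne p x with rfl | hpx
    · simp [hxS, hxy.symm]
    rcases eq_or_ne p y with rfl | hpy
    · simp [hyS, hxy, hpx]
    · simp [hpx, hpy, this]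
  · simp [key]

/-- Expanding a weighted sum over perfect matchings along the partner of `x`. -/
lemma sum_perfectMatchings_expand {S : Finset α} {x : α} (hx : x ∈ S) (f : α → α → ℤ) :
    ∑ σ ∈ perfectMatchings S, ∏ p ∈ S, f p (σ p) =
      ∑ y ∈ S.erase x, f x y * f y x *
        ∑ σ ∈ perfectMatchings (S \ {x, y}), ∏ p ∈ S \ {x, y}, f p (σ p) := by
  classical
  have hmaps : ∀ σ ∈ perfectMatchings S, σ x ∈ S.erase x := by
    intro σ hσ
    rw [mem_perfectMatchings] at hσ
    have h1 := (hσ.2 x).2 hx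
    refine Finset.mem_erase.2 ⟨h1, (hσ.2 _).1 ?_⟩
    rw [hσ.1]; exact h1.symm
  rw [← Finset.sum_fiberwise_of_maps_to hmaps]
  refine Finset.sum_congr rfl fun y hy => ?_
  obtain ⟨hyx, hyS⟩ := Finset.mem_erase.1 hy
  rw [Finset.mul_sum]
  refine Finset.sum_bij' (fun σ _ => σ * Equiv.swap x y) (fun σ _ => σ * Equiv.swap x y)
    ?_ ?_ ?_ ?_ ?_
  · intro σ hσ
    rw [Finset.mem_filter] at hσ
    exact mul_swap_mem_perfectMatchings hσ.1 hyx.symm hσ.2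
  · intro σ hσ
    rw [Finset.mem_filter]
    exact mul_swap_mem_perfectMatchings' hx hyS hσ hyx.symm
  · intro σ _
    simp [mul_assoc]
  · intro σ _
    simp [mul_assoc]
  · intro σ hσ
    rw [Finset.mem_filter] at hσ
    have hσ1 := (mem_perfectMatchings.1 hσ.1).1
    have hsub : ({x, y} : Finset α) ⊆ S := by
      intro p hp; simp at hp; rcases hp with rfl | rfl <;> assumption
    rw [← Finset.prod_sdiff hsub, Finset.prod_pair hyx.symm, mul_comm]
    have : σ y = x := by rw [← hσ.2, hσ1]
    rw [hσ.2, this]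
    congr 1
    refine Finset.prod_congr rfl fun p hp => ?_
    simp only [Finset.mem_sdiff, Finset.mem_insert, Finset.mem_singleton, not_or] at hp
    rw [Equiv.Perm.mul_apply, Equiv.swap_apply_of_ne_of_ne hp.2.1 hp.2.2]

end Matchings

section Colors

variable {α : Type*}

/-- The number of points of `S` with colour `k`. -/
def colorCount (c : α → Fin 3) (S : Finset α) (k : Fin 3) : ℕ := (S.filter fun p => c p = k).card

lemma colorCount_erase [DecidableEq α] (c : α → Fin 3) {S : Finset α} {x : α} (hx : x ∈ S) (k : Fin 3) :
    colorCount c (S.erase x) k + (if c x = k then 1 else 0) = colorCount c S k := by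
  unfold colorCount
  rw [Finset.filter_erase]
  split_ifs with h
  · exact Finset.card_erase_add_one (Finset.mem_filter.2 ⟨hx, h⟩)
  · rw [Finset.erase_eq_of_notMem]; · rfl
    simp [h]

lemma colorCount_sdiff [DecidableEq α] (c : α → Fin 3) {S : Finset α} {x y : α} (hx : x ∈ S)
    (hy : y ∈ S.erase x) (k : Fin 3) :
    colorCount c (S \ {x, y}) k + (if c x = k then 1 else 0) + (if c y = k then 1 else 0) =
      colorCount c S k := by
  have : S \ {x, y} = (S.erase x).erase y := by
    ext p; simp only [Finset.mem_sdiff, Finset.mem_insert, Finset.mem_singleton, Finset.mem_erase]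
    tauto
  rw [this, ← colorCount_erase c hx, ← colorCount_erase c hy]
  ring

lemma colorCount_sum (c : α → Fin 3) (S : Finset α) :
    colorCount c S 0 + colorCount c S 1 + colorCount c S 2 = S.card := by
  rw [Finset.card_eq_sum_card_fiberwise (f := c) (t := Finset.univ) (by simp [Set.MapsTo]),
    Fin.sum_univ_three]
  rfl

variable [Fintype α] [DecidableEq α]

/-- The sum over perfect matchings of `S` of the product of colour weights. -/
def matchingSum (w : Fin 3 → Fin 3 → ℤ) (c : α → Fin 3) (S : Finset α) : ℤ :=
  ∑ σ ∈ perfectMatchings S, ∏ p ∈ S, w (c p) (c (σ p))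

lemma matchingSum_expand (w : Fin 3 → Fin 3 → ℤ) (c : α → Fin 3) {S : Finset α} {x : α}
    (hx : x ∈ S) (v : Fin 3 → ℤ)
    (hv : ∀ y ∈ S.erase x, w (c x) (c y) * w (c y) (c x) * matchingSum w c (S \ {x, y}) =
      v (c y)) :
    matchingSum w c S = ∑ k, (colorCount c (S.erase x) k : ℤ) * v k := by
  unfold matchingSum at hv ⊢
  rw [sum_perfectMatchings_expand hx (fun p q => w (c p) (c q)), Finset.sum_congr rfl hv,
    ← Finset.sum_fiberwise _ c]
  refine Finset.sum_congr rfl fun k _ => ?_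
  rw [Finset.sum_congr rfl (g := fun _ => v k)
    (fun y hy => by rw [(Finset.mem_filter.1 hy).2])]
  simp [colorCount]

lemma matchingSum_empty (w : Fin 3 → Fin 3 → ℤ) (c : α → Fin 3) :
    matchingSum w c ∅ = 1 := by
  have : perfectMatchings (∅ : Finset α) = {1} := by
    ext σ
    simp only [perfectMatchings, Finset.mem_filter, Finset.mem_univ, true_and,
      Equiv.Perm.support_eq_empty_iff, Finset.mem_singleton]
    constructor
    · exact fun h => h.2
    · rintro rfl; simp
  simp [matchingSum, this]

/-- The product of the first `r` odd numbers. -/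
def oddProd (r : ℕ) : ℤ := ∏ i ∈ Finset.range r, (2 * (i : ℤ) + 1)

lemma oddProd_succ (r : ℕ) : oddProd (r + 1) = oddProd r * (2 * r + 1) :=
  Finset.prod_range_succ _ _

/-- The product `(D + A - 1) (D + A - 3) ⋯ (D - A + 1)`. -/
def stepProd (A : ℕ) (D : ℤ) : ℤ := ∏ i ∈ Finset.range A, (D + A - 1 - 2 * i)

lemma stepProd_succ_add (A : ℕ) (D : ℤ) :
    stepProd (A + 1) (D + 1) = (D + A + 1) * stepProd A D := by
  unfold stepProd
  rw [Finset.prod_range_succ', mul_comm]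
  congr 1
  · push_cast; ring
  · refine Finset.prod_congr rfl fun i _ => ?_
    push_cast; ring

lemma stepProd_succ_sub (A : ℕ) (D : ℤ) :
    stepProd (A + 1) (D - 1) = (D - A - 1) * stepProd A D := by
  unfold stepProd
  rw [Finset.prod_range_succ, mul_comm]
  congr 1
  · push_cast; ring
  · refine Finset.prod_congr rfl fun i _ => ?_
    push_cast; ring

lemma stepProd_add_two (A : ℕ) (D : ℤ) :
    stepProd (A + 2) D = (D + A + 1) * (D - A - 1) * stepProd A D := by
  have h1 := stepProd_succ_add (A + 1) (D - 1)
  rw [sub_add_cancel, stepProd_succ_sub] at h1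
  rw [h1]; push_cast; ring

/-- Sign weights on colours for which every monochromatic pair has weight one and the three
bichromatic pairs have weights with product `-1`. -/
structure FrustratedWeight (w : Fin 3 → Fin 3 → ℤ) : Prop where
  diag : ∀ a, w a a * w a a = 1
  sq : ∀ a b, (w a b * w b a) ^ 2 = 1
  prod : (w 0 1 * w 1 0) * (w 0 2 * w 2 0) * (w 1 2 * w 2 1) = -1

lemma matchingSum_two_colors {w : Fin 3 → Fin 3 → ℤ} (hw : FrustratedWeight w) (c : α → Fin 3)
    (m : ℕ) : ∀ S : Finset α, colorCount c S 0 = 0 → S.card = 2 * m →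
      matchingSum w c S = (w 1 2 * w 2 1) ^ colorCount c S 1 * oddProd m := by
  induction m with
  | zero =>
    intro S h0 hS
    obtain rfl : S = ∅ := by simpa using hS
    simp [matchingSum_empty, colorCount, oddProd]
  | succ m ih =>
    intro S h0 hS
    obtain ⟨x, hx⟩ : S.Nonempty := by rw [← Finset.card_pos]; omega
    have hc0 : ∀ y ∈ S, c y ≠ 0 := by
      intro y hy h
      have : y ∈ S.filter fun p => c p = 0 := Finset.mem_filter.2 ⟨hy, h⟩
      rw [Finset.card_eq_zero.1 h0] at this
      simp at this
    set V : ℤ := (w 1 2 * w 2 1) ^ colorCount c S 1 * oddProd m with hV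
    have hs := hw.sq 1 2
    rw [matchingSum_expand w c hx (fun _ => V)]
    · have h1 := colorCount_sum c (S.erase x)
      have h2 := Finset.card_erase_add_one hx
      rw [← Finset.sum_mul, Fin.sum_univ_three, oddProd_succ, hV]
      have : ((colorCount c (S.erase x) 0 : ℤ) + colorCount c (S.erase x) 1 +
        colorCount c (S.erase x) 2) = 2 * m + 1 := by
        zify at h1 h2 hS; linarith
      rw [this]; ring
    · intro y hy
      have hyS := Finset.mem_of_mem_erase hy
      have k0 := colorCount_sdiff c hx hy 0
      have k1 := colorCount_sdiff c hx hy 1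
      have k2 := colorCount_sum c (S \ {x, y})
      have k3 := colorCount_sum c S
      have k4 := colorCount_sdiff c hx hy 2
      have hxc := hc0 x hx
      have hyc := hc0 y hyS
      have hcx : c x = 1 ∨ c x = 2 := by revert hxc; generalize c x = k; revert k; decide
      have hcy : c y = 1 ∨ c y = 2 := by revert hyc; generalize c y = k; revert k; decide
      have hd1 := hw.diag 1
      have hd2 := hw.diag 2
      rw [ih _ (by omega) (by
        rcases hcx with h | h <;> rcases hcy with h' | h' <;> simp [h, h'] at k0 k1 k4 <;> omega)]
      rw [hV, ← k1]
      rcases hcx with h | h <;> rcases hcy with h' | h' <;> simp only [h, h']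
      · rw [hd1, if_pos trivial]
        linear_combination
          (-(w 1 2 * w 2 1) ^ colorCount c (S \ {x, y}) 1 * oddProd m) * hs
      · simp [pow_add]; ring
      · simp [pow_add]; ring
      · rw [hd2]; simp

/-- Closed form of the matching sum when the colour `0` is not in the majority. -/
lemma matchingSum_closed {w : Fin 3 → Fin 3 → ℤ} (hw : FrustratedWeight w) (c : α → Fin 3)
    (A : ℕ) : ∀ (r : ℕ) (S : Finset α), colorCount c S 0 = A → S.card = 2 * (A + r) →
      matchingSum w c S = (w 1 2 * w 2 1) ^ colorCount c S 1 * (w 0 2 * w 2 0) ^ A *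
        oddProd r * stepProd A ((colorCount c S 2 : ℤ) - colorCount c S 1) := by
  induction A using Nat.strong_induction_on with
  | _ A ih =>
  intro r S hA hS
  rcases Nat.eq_zero_or_pos A with rfl | hApos
  · rw [matchingSum_two_colors hw c r S hA (by omega)]
    simp [stepProd]
  obtain ⟨x, hx⟩ : (S.filter fun p => c p = 0).Nonempty := by
    rw [← Finset.card_pos]; change 0 < colorCount c S 0; omega
  obtain ⟨hx, hcx⟩ := Finset.mem_filter.1 hx
  obtain ⟨A, rfl⟩ : ∃ A', A = A' + 1 := ⟨A - 1, by omega⟩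
  set B := colorCount c S 1 with hB
  set C := colorCount c S 2 with hC
  have hs12 := hw.sq 1 2
  have hs02 := hw.sq 0 2
  have hd := hw.diag 0
  have hp := hw.prod
  have h01 : w 0 1 * w 1 0 = -((w 0 2 * w 2 0) * (w 1 2 * w 2 1)) := by
    linear_combination (w 0 2 * w 2 0) * (w 1 2 * w 2 1) * hp -
      (w 0 1 * w 1 0) * (w 1 2 * w 2 1) ^ 2 * hs02 - (w 0 1 * w 1 0) * hs12
  set W12 := w 1 2 * w 2 1
  set W02 := w 0 2 * w 2 0
  have hcard : (S.erase x).card + 1 = S.card := Finset.card_erase_add_one hx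
  have htot := colorCount_sum c S
  rw [matchingSum_expand w c hx ![if A = 0 then 0 else
      W12 ^ B * W02 ^ (A + 1) * oddProd (r + 1) * stepProd (A - 1) ((C : ℤ) - B),
    -(W02 * W12) * (W12 ^ (B + 1) * W02 ^ A * oddProd r * stepProd A ((C : ℤ) - B + 1)),
    W02 * (W12 ^ B * W02 ^ A * oddProd r * stepProd A ((C : ℤ) - B - 1))]]
  · have e0 := colorCount_erase c hx 0
    have e1 := colorCount_erase c hx 1
    have e2 := colorCount_erase c hx 2
    simp [hcx] at e0 e1 e2
    have e0' : colorCount c (S.erase x) 0 = A := by omega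
    rw [Fin.sum_univ_three, e0', e1, e2, ← hB, ← hC]
    simp only [Matrix.cons_val_zero, Matrix.cons_val_one, Matrix.cons_val]
    rcases A with _ | A
    · simp [stepProd]
      linear_combination (-B * W02 * W12 ^ B * oddProd r) * hs12
    · have hBC : (B : ℤ) + C = 2 * r + A + 2 := by
        zify at htot hS hA; linarith
      rw [if_neg (by omega), stepProd_succ_add, stepProd_succ_sub, Nat.add_sub_cancel,
        show A + 1 + 1 = A + 2 from rfl, stepProd_add_two, oddProd_succ]
      push_cast
      generalize stepProd A (C - B : ℤ) = Q
      generalize oddProd r = O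
      linear_combination
        (-B * W02 ^ (A + 2) * W12 ^ B * O * (C - B + A + 1) * Q) * hs12 -
          (W02 ^ (A + 2) * W12 ^ B * O * Q * (A + 1)) * hBC
  · intro y hy
    have k0 := colorCount_sdiff c hx hy 0
    have k1 := colorCount_sdiff c hx hy 1
    have k2 := colorCount_sdiff c hx hy 2
    have k3 := colorCount_sum c (S \ {x, y})
    rw [hcx]
    obtain h | h | h : c y = 0 ∨ c y = 1 ∨ c y = 2 := by
      generalize c y = k; revert k; decide
    · simp [hcx, h, hA] at k0 k1 k2
      rw [h, ih (A - 1) (by omega) (r + 1) _ (by omega) (by omega), k1, k2, ← hB, ← hC, hd]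
      simp only [Matrix.cons_val_zero]
      rw [if_neg (by omega)]
      obtain ⟨A, rfl⟩ : ∃ A', A = A' + 1 := ⟨A - 1, by omega⟩
      simp only [Nat.add_sub_cancel]
      linear_combination (-W12 ^ B * W02 ^ A * oddProd (r + 1) * stepProd A (C - B)) * hs02
    · simp [hcx, h, hA] at k0 k1 k2
      have hcast : (B : ℤ) = colorCount c (S \ {x, y}) 1 + 1 := by rw [hB, ← k1]; push_cast; ring
      rw [h, ih A (by omega) r _ (by omega) (by omega), k2, ← hC, h01, hcast, hB, ← k1]
      simp only [Matrix.cons_val_one, Matrix.cons_val_zero]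
      rw [show (C : ℤ) - (colorCount c (S \ {x, y}) 1 + 1) + 1 =
        C - colorCount c (S \ {x, y}) 1 by ring]
      generalize stepProd A _ = Q
      generalize oddProd r = O
      linear_combination (W02 * W12 * W12 ^ colorCount c (S \ {x, y}) 1 * W02 ^ A * O * Q) * hs12
    · simp [hcx, h, hA] at k0 k1 k2
      have hcast : (C : ℤ) = colorCount c (S \ {x, y}) 2 + 1 := by rw [hC, ← k2]; push_cast; ring
      rw [h, ih A (by omega) r _ (by omega) (by omega), k1, ← hB, hcast]
      simp only [Matrix.cons_val]
      rw [show (colorCount c (S \ {x, y}) 2 : ℤ) + 1 - B - 1 =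
        colorCount c (S \ {x, y}) 2 - B by ring]

end Colors

lemma oddProd_pos (r : ℕ) : 0 < oddProd r := Finset.prod_pos fun _ _ => by positivity

lemma oddProd_add (A r : ℕ) : oddProd (A + r) = oddProd r * stepProd A (A + 2 * r) := by
  induction A with
  | zero => simp [stepProd]
  | succ A ih =>
    have := stepProd_succ_add A (A + 2 * r)
    rw [show A + 1 + r = A + r + 1 by ring, oddProd_succ, ih]
    rw [show ((A + 1 : ℕ) : ℤ) + 2 * r = A + 2 * r + 1 by push_cast; ring, this]
    push_cast; ring

lemma stepProd_sq (A : ℕ) (D : ℤ) :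
    stepProd A D ^ 2 = ∏ i ∈ Finset.range A, (D ^ 2 - ((A : ℤ) - 1 - 2 * i) ^ 2) := by
  have h : stepProd A D = ∏ i ∈ Finset.range A, (D - ((A : ℤ) - 1 - 2 * i)) := by
    unfold stepProd
    rw [← Finset.prod_range_reflect]
    refine Finset.prod_congr rfl fun i hi => ?_
    have := Finset.mem_range.1 hi
    rw [Nat.cast_sub (by omega), Nat.cast_sub (by omega)]
    push_cast; ring
  rw [sq]
  nth_rewrite 2 [h]
  rw [stepProd, ← Finset.prod_mul_distrib]
  exact Finset.prod_congr rfl fun i _ => by ring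

lemma abs_stepProd_le {A r : ℕ} {D : ℤ} {θ : ℝ} (h0 : 0 ≤ θ) (h1 : θ ≤ 1)
    (hD : |(D : ℝ)| ≤ θ * (A + 2 * r))
    (hA : (A : ℝ) ^ 2 ≤ θ ^ 2 * ((A + 2 * r) ^ 2 - A ^ 2)) :
    |(stepProd A D : ℝ)| ≤ θ ^ A * stepProd A (A + 2 * r) := by
  have hM : 0 ≤ (stepProd A (A + 2 * r) : ℝ) := by
    have := oddProd_add A r
    have h2 := oddProd_pos (A + r)
    rw [this] at h2
    exact_mod_cast (pos_of_mul_pos_right h2 (oddProd_pos r).le).le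
  refine abs_le_of_sq_le_sq' ?_ (by positivity) |> abs_le.2
  rw [mul_pow, ← pow_mul, mul_comm A 2, pow_mul]
  have e1 := congrArg (Int.cast : ℤ → ℝ) (stepProd_sq A D)
  have e2 := congrArg (Int.cast : ℤ → ℝ) (stepProd_sq A (A + 2 * r))
  push_cast at e1 e2
  rw [e1, e2]
  refine (le_abs_self _).trans ?_
  have hθ : (θ ^ 2) ^ A = ∏ i ∈ Finset.range A, θ ^ 2 := by simp
  rw [Finset.abs_prod, hθ, ← Finset.prod_mul_distrib]
  refine Finset.prod_le_prod (fun _ _ => abs_nonneg _) fun i hi => ?_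
  have hi' : (i : ℝ) + 1 ≤ A := by exact_mod_cast Finset.mem_range.1 hi
  set a : ℝ := (A : ℝ) - 1 - 2 * i
  have ha : a ^ 2 ≤ (A : ℝ) ^ 2 := by
    refine sq_le_sq' ?_ ?_ <;> simp only [a] <;> linarith [(Nat.cast_nonneg i : (0 : ℝ) ≤ i)]
  have hD2 : (D : ℝ) ^ 2 ≤ θ ^ 2 * (A + 2 * r) ^ 2 := by
    rw [← mul_pow, ← sq_abs]
    exact pow_le_pow_left₀ (abs_nonneg _) hD 2
  have hθ2 : θ ^ 2 ≤ 1 := pow_le_one₀ h0 h1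
  rw [abs_le]
  constructor
  · nlinarith [sq_nonneg (D : ℝ), sq_nonneg θ]
  · nlinarith [sq_nonneg a]

/-- The edge weight which is `-1` on pairs of points coloured `1` and `2`. -/
def cfgWeight (a b : Fin 3) : ℤ := if a = 1 ∧ b = 2 then -1 else 1

lemma frustratedWeight_cfgWeight (e : Equiv.Perm (Fin 3)) :
    FrustratedWeight fun a b => cfgWeight (e a) (e b) where
  diag := by revert e; decide
  sq := by revert e; decide
  prod := by revert e; decide

section

variable {α : Type*} [Fintype α] [DecidableEq α]

lemma card_perfectMatchings {S : Finset α} {m : ℕ} (hS : S.card = 2 * m) :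
    ((perfectMatchings S).card : ℤ) = oddProd m := by
  have h := matchingSum_two_colors (frustratedWeight_cfgWeight 1) (fun _ : α => 2) m S
    (by simp [colorCount]) hS
  simpa [matchingSum, colorCount, cfgWeight] using h

lemma abs_matchingSum_cfgWeight_le (c : α → Fin 3) {S : Finset α} {m : ℕ} (hS : S.card = 2 * m) :
    |matchingSum cfgWeight c S| ≤ oddProd m := by
  rw [← card_perfectMatchings hS, matchingSum]
  refine (Finset.abs_sum_le_sum_abs _ _).trans ?_
  rw [Finset.card_eq_sum_ones]
  push_cast
  refine Finset.sum_le_sum fun σ _ => ?_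
  rw [Finset.abs_prod]
  refine (Finset.prod_eq_one fun p _ => ?_).le
  unfold cfgWeight
  split_ifs <;> simp

lemma abs_matchingSum_cfgWeight_le_of_minority (e : Equiv.Perm (Fin 3)) (c : α → Fin 3)
    {S : Finset α} {A r : ℕ} (hA : colorCount (e ∘ c) S 0 = A) (hS : S.card = 2 * (A + r))
    {θ : ℝ} (h0 : 0 ≤ θ) (h1 : θ ≤ 1)
    (hD : |(colorCount (e ∘ c) S 2 : ℝ) - colorCount (e ∘ c) S 1| ≤ θ * (A + 2 * r))
    (hA2 : (A : ℝ) ^ 2 ≤ θ ^ 2 * ((A + 2 * r) ^ 2 - A ^ 2)) :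
    |(matchingSum cfgWeight c S : ℝ)| ≤ θ ^ A * oddProd (A + r) := by
  have hw := frustratedWeight_cfgWeight e.symm
  have h := matchingSum_closed hw (e ∘ c) A r S hA hS
  have he : matchingSum (fun a b => cfgWeight (e.symm a) (e.symm b)) (e ∘ c) S =
      matchingSum cfgWeight c S := by
    simp [matchingSum]
  have h12 : |cfgWeight (e.symm 1) (e.symm 2) * cfgWeight (e.symm 2) (e.symm 1)| = 1 := by
    have := hw.sq 1 2; rw [sq_eq_one_iff] at this; rcases this with h | h <;> simp [h]
  have h02 : |cfgWeight (e.symm 0) (e.symm 2) * cfgWeight (e.symm 2) (e.symm 0)| = 1 := by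
    have := hw.sq 0 2; rw [sq_eq_one_iff] at this; rcases this with h | h <;> simp [h]
  rw [he] at h
  have habs : |matchingSum cfgWeight c S| = oddProd r *
      |stepProd A ((colorCount (e ∘ c) S 2 : ℤ) - colorCount (e ∘ c) S 1)| := by
    rw [h, abs_mul, abs_mul, abs_mul, abs_pow, abs_pow, h12, h02, abs_of_pos (oddProd_pos r)]
    simp
  have habs' := congrArg (Int.cast : ℤ → ℝ) habs
  push_cast at habs'
  rw [habs', oddProd_add]
  have hO : (0 : ℝ) < oddProd r := by exact_mod_cast oddProd_pos r
  have := abs_stepProd_le (D := (colorCount (e ∘ c) S 2 : ℤ) - colorCount (e ∘ c) S 1)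
    h0 h1 (by push_cast; exact hD) hA2
  push_cast
  calc _ ≤ (oddProd r : ℝ) * (θ ^ A * stepProd A (A + 2 * r)) := by gcongr
    _ = _ := by ring

end

lemma colorCount_comp_fst {n d : ℕ} (s : Fin n → Fin 3) (k : Fin 3) :
    colorCount (fun p : Fin n × Fin d => s p.1) Finset.univ k =
      d * colorCount s Finset.univ k := by
  unfold colorCount
  have : (Finset.univ.filter fun p : Fin n × Fin d => s p.1 = k) =
      (Finset.univ.filter fun v => s v = k) ×ˢ Finset.univ := by
    ext p; simp
  rw [this, Finset.card_product]
  simp [mul_comm]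

lemma abs_matchingSum_vertexColoring_le {n h d j : ℕ} (hn : n = 2 * h) (hd : 3 ≤ d) (e : Equiv.Perm (Fin 3))
    (s : Fin n → Fin 3) (hj : colorCount (e ∘ s) Finset.univ 0 = j) (hj1 : 1 ≤ j)
    (hj3 : 3 * j ≤ n) :
    |(matchingSum cfgWeight (fun p : Fin n × Fin d => s p.1) Finset.univ : ℝ)| ≤
      ((|(colorCount (e ∘ s) Finset.univ 2 : ℝ) - colorCount (e ∘ s) Finset.univ 1| /
          (n - j)) ^ (3 * j) + (√3 * j / n) ^ (3 * j)) *
        oddProd (h * d) := by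
  set k := colorCount (e ∘ s) Finset.univ 1
  set l := colorCount (e ∘ s) Finset.univ 2
  have htot : j + k + l = n := by
    have := colorCount_sum (e ∘ s) Finset.univ
    rw [hj] at this; simpa using this
  have hjn : (3 : ℝ) * j ≤ n := by exact_mod_cast (by omega : 3 * j ≤ n)
  have hj0 : (1 : ℝ) ≤ j := by exact_mod_cast hj1
  have htot' : (j : ℝ) + k + l = n := by exact_mod_cast (by omega : j + k + l = n)
  have hnj : (0 : ℝ) < n - j := by linarith
  have hn0 : (0 : ℝ) < n := by linarith
  set a : ℝ := |(l : ℝ) - k| / (n - j) with ha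
  set b : ℝ := √3 * j / n with hb
  have ha0 : 0 ≤ a := by positivity
  have hb0 : 0 ≤ b := by positivity
  have hb2 : b ^ 2 = 3 * j ^ 2 / n ^ 2 := by
    rw [hb, div_pow, mul_pow, Real.sq_sqrt (by norm_num)]
  have ha1 : a ≤ 1 := by
    rw [ha, div_le_one hnj, abs_le]
    constructor <;> linarith [(Nat.cast_nonneg k : (0 : ℝ) ≤ k), (Nat.cast_nonneg l : (0 : ℝ) ≤ l)]
  have hb1 : b ≤ 1 := by
    refine abs_le_of_sq_le_sq' (b := 1) ?_ zero_le_one |>.2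
    rw [hb2, one_pow, div_le_one (by positivity)]
    nlinarith
  have hd0 : (0 : ℝ) < d := by exact_mod_cast (by omega : 0 < d)
  have hdj : d * j ≤ h * d := by nlinarith
  have hr : ((h * d - d * j : ℕ) : ℝ) = d * (n / 2 - j) := by
    rw [Nat.cast_sub hdj, hn]; push_cast; ring
  have hmax := abs_matchingSum_cfgWeight_le_of_minority e
    (fun p : Fin n × Fin d => s p.1) (S := Finset.univ) (A := d * j) (r := h * d - d * j)
    (θ := max a b)
    (by rw [← hj]; exact colorCount_comp_fst (e ∘ s) 0)
    (by rw [Nat.add_sub_cancel' hdj]; simp [hn]; ring)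
    (le_max_of_le_left ha0) (max_le ha1 hb1)
    (by
      have h1 := colorCount_comp_fst (d := d) (e ∘ s) 1
      have h2 := colorCount_comp_fst (d := d) (e ∘ s) 2
      change |((colorCount (fun p : Fin n × Fin d => (e ∘ s) p.1) Finset.univ 2 : ℕ) : ℝ) -
        ((colorCount (fun p : Fin n × Fin d => (e ∘ s) p.1) Finset.univ 1 : ℕ) : ℝ)| ≤ _
      rw [h1, h2, hr]
      push_cast
      rw [← mul_sub, abs_mul, abs_of_pos hd0]
      have : |(l : ℝ) - k| = a * (n - j) := by rw [ha]; field_simp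
      change (d : ℝ) * |(l : ℝ) - k| ≤ _
      rw [this]
      have := le_max_left a b
      calc (d : ℝ) * (a * (n - j)) ≤ d * (max a b * (n - j)) := by gcongr
        _ = _ := by ring)
    (by
      rw [hr]
      push_cast
      have h1 : b ^ 2 ≤ max a b ^ 2 := pow_le_pow_left₀ hb0 (le_max_right a b) 2
      have h2 : (d * j : ℝ) ^ 2 ≤ b ^ 2 * (d ^ 2 * (n * (n - 2 * j))) := by
        rw [hb2, div_mul_eq_mul_div, le_div_iff₀ (by positivity)]
        have : (0 : ℝ) ≤ d ^ 2 * j ^ 2 * n * (2 * n - 6 * j) := by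
          apply mul_nonneg (by positivity); linarith
        nlinarith
      have h3 : (0 : ℝ) ≤ d ^ 2 * (n * (n - 2 * j)) := by
        have : (0 : ℝ) ≤ n - 2 * j := by linarith
        positivity
      calc _ ≤ b ^ 2 * (d ^ 2 * (n * (n - 2 * j))) := h2
        _ ≤ max a b ^ 2 * (d ^ 2 * (n * (n - 2 * j))) := by gcongr
        _ = _ := by ring)
  rw [Nat.add_sub_cancel' hdj] at hmax
  refine hmax.trans ?_
  have hO : (0 : ℝ) < oddProd (h * d) := by exact_mod_cast oddProd_pos _
  refine mul_le_mul_of_nonneg_right ?_ hO.le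
  calc max a b ^ (d * j) ≤ max a b ^ (3 * j) :=
        pow_le_pow_of_le_one (le_max_of_le_left ha0) (max_le ha1 hb1)
          (Nat.mul_le_mul_right _ hd)
    _ ≤ a ^ (3 * j) + b ^ (3 * j) := by
        rcases max_choice a b with h | h <;> rw [h]
        · linarith [pow_nonneg hb0 (3 * j)]
        · linarith [pow_nonneg ha0 (3 * j)]

/-- The colourings of `V` whose colour class `0` is `P`. -/
def zeroFiber {V : Type*} [Fintype V] [DecidableEq V] (P : Finset V) : Finset (V → Fin 3) :=
  Fintype.piFinset fun v => if v ∈ P then {0} else {1, 2}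

section

variable {V : Type*} [Fintype V] [DecidableEq V]

lemma mem_zeroFiber {P : Finset V} {s : V → Fin 3} :
    s ∈ zeroFiber P ↔ (Finset.univ.filter fun v => s v = 0) = P := by
  simp only [zeroFiber, Fintype.mem_piFinset, Finset.ext_iff, Finset.mem_filter, Finset.mem_univ,
    true_and]
  refine forall_congr' fun v => ?_
  generalize s v = k
  by_cases h : v ∈ P
  · simp [h]
  · simp only [h]; revert k; decide

lemma sum_zeroFiber_prod (P : Finset V) (f : Fin 3 → ℝ) (hf : f 0 = 1) :
    ∑ s ∈ zeroFiber P, ∏ v, f (s v) = (f 1 + f 2) ^ (Fintype.card V - P.card) := by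
  rw [zeroFiber, ← Finset.prod_univ_sum]
  have : ∀ v, ∑ j ∈ (if v ∈ P then {0} else {1, 2} : Finset (Fin 3)), f j =
      if v ∈ Pᶜ then f 1 + f 2 else 1 := by
    intro v
    by_cases h : v ∈ P <;> simp [h, hf]
  rw [Finset.prod_congr rfl fun v _ => this v, Finset.prod_ite_mem, Finset.univ_inter,
    Finset.prod_const, Finset.card_compl]

lemma card_zeroFiber (P : Finset V) :
    ((zeroFiber P).card : ℝ) = 2 ^ (Fintype.card V - P.card) := by
  have := sum_zeroFiber_prod P (fun _ => 1) rfl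
  norm_num at this
  exact this

lemma sum_zeroFiber_exp (P : Finset V) (t : ℝ) :
    ∑ s ∈ zeroFiber P, Real.exp (t * ((colorCount s Finset.univ 2 : ℝ) -
        colorCount s Finset.univ 1)) =
      (2 * Real.cosh t) ^ (Fintype.card V - P.card) := by
  rw [Real.cosh_eq]
  have := sum_zeroFiber_prod P (fun k => Real.exp (t * ((if k = 2 then 1 else 0) -
    (if k = 1 then 1 else 0)))) (by simp)
  simp only [← Real.exp_sum, ← Finset.mul_sum, Finset.sum_sub_distrib, Finset.sum_boole] at this
  rw [show 2 * ((Real.exp t + Real.exp (-t)) / 2) = Real.exp (-t) + Real.exp t by ring]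
  simpa [colorCount] using this

/-- A moment bound for the imbalance of the colours `1` and `2`. -/
lemma sum_zeroFiber_abs_pow_le (P : Finset V) {p : ℕ} (hp : 0 < p)
    (hP : P.card < Fintype.card V) :
    ∑ s ∈ zeroFiber P, (|(colorCount s Finset.univ 2 : ℝ) - colorCount s Finset.univ 1| /
        (Fintype.card V - P.card)) ^ p ≤
      2 ^ (Fintype.card V - P.card) *
        (2 * √(p / (Real.exp 1 * (Fintype.card V - P.card))) ^ p) := by
  obtain ⟨m, hm⟩ : ∃ m, m = Fintype.card V - P.card := ⟨_, rfl⟩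
  have hm0 : (0 : ℝ) < m := by exact_mod_cast (by omega : 0 < m)
  have hmr : ((Fintype.card V : ℝ) - P.card) = m := by rw [hm, Nat.cast_sub hP.le]
  have hp0 : (0 : ℝ) < p := by exact_mod_cast hp
  rw [hmr, ← hm]
  set t : ℝ := √(p / m) with ht
  have ht0 : 0 < t := Real.sqrt_pos.2 (by positivity)
  have ht2 : t ^ 2 = p / m := Real.sq_sqrt (by positivity)
  have key : ∀ x : ℝ, (|x| / m) ^ p ≤ (t * Real.exp (-1)) ^ p *
      (Real.exp (t * x) + Real.exp (-t * x)) := by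
    intro x
    have h1 : |x| / m ≤ t * Real.exp (-1) * Real.exp (t * |x| / p) := by
      have h2 := Real.add_one_le_exp (t * |x| / p - 1)
      rw [sub_add_cancel, sub_eq_add_neg, Real.exp_add] at h2
      have h3 : |x| / m = t * (t * |x| / p) := by
        field_simp
        rw [ht2]; field_simp
      rw [h3]
      calc t * (t * |x| / p) ≤ t * (Real.exp (t * |x| / p) * Real.exp (-1)) := by gcongr
        _ = _ := by ring
    calc (|x| / m) ^ p ≤ (t * Real.exp (-1) * Real.exp (t * |x| / p)) ^ p := by gcongr
      _ = (t * Real.exp (-1)) ^ p * Real.exp (t * |x|) := by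
        rw [mul_pow _ (Real.exp _), ← Real.exp_nat_mul]
        congr 2; field_simp
      _ ≤ _ := by
        gcongr
        rcases abs_choice x with h | h <;> rw [h]
        · linarith [Real.exp_pos (-t * x)]
        · rw [mul_neg, neg_mul]; linarith [Real.exp_pos (t * x)]
  refine (Finset.sum_le_sum fun s _ => key _).trans ?_
  rw [← Finset.mul_sum, Finset.sum_add_distrib, sum_zeroFiber_exp, sum_zeroFiber_exp, Real.cosh_neg,
    ← hm]
  have hcosh : Real.cosh t ^ m ≤ Real.exp (p / 2) := by
    calc Real.cosh t ^ m ≤ Real.exp (t ^ 2 / 2) ^ m := by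
          gcongr
          exact Real.cosh_le_exp_half_sq t
      _ = _ := by
        rw [← Real.exp_nat_mul, ht2]; congr 1; field_simp
  have hsq : √(p / (Real.exp 1 * m)) = t * Real.exp (-1) * Real.exp (1 / 2) := by
    rw [Real.sqrt_eq_iff_eq_sq (by positivity) (by positivity), mul_pow, mul_pow, ht2,
      ← Real.exp_nat_mul, ← Real.exp_nat_mul, mul_assoc, ← Real.exp_add, mul_comm (Real.exp 1),
      ← div_div, div_eq_mul_inv, ← Real.exp_neg]
    norm_num
  rw [hsq, mul_pow _ (Real.exp (1 / 2)), ← Real.exp_nat_mul]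
  calc _ = 2 ^ m * (2 * ((t * Real.exp (-1)) ^ p * Real.cosh t ^ m)) := by ring
    _ ≤ 2 ^ m * (2 * ((t * Real.exp (-1)) ^ p * Real.exp (p / 2))) := by gcongr
    _ = _ := by rw [mul_one_div]

end

/-- The bound on the normalised matching sum of a colouring whose rarest colour is `0`. -/
def minorityTerm {n : ℕ} (s : Fin n → Fin 3) : ℝ :=
  if 1 ≤ colorCount s Finset.univ 0 ∧
      colorCount s Finset.univ 0 ≤ colorCount s Finset.univ 1 ∧
      colorCount s Finset.univ 0 ≤ colorCount s Finset.univ 2 then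
    (|(colorCount s Finset.univ 2 : ℝ) - colorCount s Finset.univ 1| /
      (n - colorCount s Finset.univ 0)) ^ (3 * colorCount s Finset.univ 0) +
    (√3 * colorCount s Finset.univ 0 / n) ^ (3 * colorCount s Finset.univ 0)
  else 0

/-- A summable bound, vanishing as `n` grows, on the contribution of minority classes of size
`j`. -/
def decayTerm (n j : ℕ) : ℝ :=
  if j = 0 ∨ n < 3 * j then 0
  else if 5 * j ≤ n then 3 * √(4.9 * j / n) ^ j else 2 * 0.85 ^ j

lemma colorCount_perm_comp {V : Type*} (e : Equiv.Perm (Fin 3)) (s : V → Fin 3) (S : Finset V)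
    (k : Fin 3) : colorCount (e ∘ s) S k = colorCount s S (e.symm k) := by
  simp [colorCount, Equiv.eq_symm_apply]

lemma minorityTerm_nonneg {n : ℕ} (s : Fin n → Fin 3) : 0 ≤ minorityTerm s := by
  unfold minorityTerm
  split_ifs with h
  · have h1 := colorCount_sum s Finset.univ
    have : (colorCount s Finset.univ 0 : ℝ) ≤ n := by
      exact_mod_cast (by simp at h1; omega : colorCount s Finset.univ 0 ≤ n)
    have h2 : (0 : ℝ) ≤ n - colorCount s Finset.univ 0 := by linarith
    positivity
  · exact le_rfl

lemma abs_matchingSum_vertexColoring_le_sum {n h d : ℕ} (hn : n = 2 * h) (hd : 3 ≤ d)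
    (s : Fin n → Fin 3) :
    |(matchingSum cfgWeight (fun p : Fin n × Fin d => s p.1) Finset.univ : ℝ)| ≤
      ((∑ k, if colorCount s Finset.univ k = 0 then (1 : ℝ) else 0) +
        ∑ k, minorityTerm (Equiv.swap 0 k ∘ s)) * oddProd (h * d) := by
  have hO : (0 : ℝ) < oddProd (h * d) := by exact_mod_cast oddProd_pos _
  have hnn : ∀ k, (0 : ℝ) ≤ if colorCount s Finset.univ k = 0 then (1 : ℝ) else 0 := by
    intro k; split_ifs <;> simp
  by_cases h0 : ∃ k, colorCount s Finset.univ k = 0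
  · obtain ⟨k, hk⟩ := h0
    have h1 := abs_matchingSum_cfgWeight_le (fun p : Fin n × Fin d => s p.1) (S := Finset.univ)
      (m := h * d) (by simp [hn]; ring)
    have h1' : |(matchingSum cfgWeight (fun p : Fin n × Fin d => s p.1) Finset.univ : ℝ)| ≤
      oddProd (h * d) := by exact_mod_cast h1
    refine h1'.trans (le_mul_of_one_le_left hO.le ?_)
    have h2 := Finset.single_le_sum (f := fun k =>
      if colorCount s Finset.univ k = 0 then (1 : ℝ) else 0) (fun k _ => hnn k) (Finset.mem_univ k)
    simp only [hk, if_true] at h2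
    linarith [Finset.sum_nonneg fun k (_ : k ∈ (Finset.univ : Finset (Fin 3))) =>
      minorityTerm_nonneg (Equiv.swap 0 k ∘ s)]
  · push Not at h0
    obtain ⟨k, -, hk⟩ := Finset.exists_min_image Finset.univ
      (fun k => colorCount s Finset.univ k) ⟨0, Finset.mem_univ _⟩
    have hc : ∀ i, colorCount (Equiv.swap 0 k ∘ s) Finset.univ i =
        colorCount s Finset.univ (Equiv.swap 0 k i) := fun i => by
      rw [colorCount_perm_comp, Equiv.symm_swap]
    have hc0 : colorCount (Equiv.swap 0 k ∘ s) Finset.univ 0 = colorCount s Finset.univ k := by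
      simp [hc]
    have hcond : 1 ≤ colorCount (Equiv.swap 0 k ∘ s) Finset.univ 0 ∧
      colorCount (Equiv.swap 0 k ∘ s) Finset.univ 0 ≤
        colorCount (Equiv.swap 0 k ∘ s) Finset.univ 1 ∧
      colorCount (Equiv.swap 0 k ∘ s) Finset.univ 0 ≤
        colorCount (Equiv.swap 0 k ∘ s) Finset.univ 2 := by
      rw [hc0, hc, hc]
      exact ⟨Nat.one_le_iff_ne_zero.2 (h0 k), hk _ (Finset.mem_univ _), hk _ (Finset.mem_univ _)⟩
    have htot := colorCount_sum (Equiv.swap 0 k ∘ s) Finset.univ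
    rw [Finset.card_univ, Fintype.card_fin] at htot
    have h1 := abs_matchingSum_vertexColoring_le (d := d) hn hd (Equiv.swap 0 k) s rfl hcond.1
      (by omega)
    refine h1.trans (mul_le_mul_of_nonneg_right ?_ hO.le)
    have h2 := Finset.single_le_sum (f := fun k => minorityTerm (Equiv.swap 0 k ∘ s))
      (fun k _ => minorityTerm_nonneg _) (Finset.mem_univ k)
    have h3 : minorityTerm (Equiv.swap 0 k ∘ s) = _ := if_pos hcond
    rw [← h3]
    refine h2.trans (le_add_of_nonneg_left (Finset.sum_nonneg fun k _ => hnn k))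

lemma sum_colorCount_eq_zero (n : ℕ) (k : Fin 3) :
    (∑ s : Fin n → Fin 3, if colorCount s Finset.univ k = 0 then (1 : ℝ) else 0) = 2 ^ n := by
  rw [Finset.sum_boole]
  have : (Finset.univ.filter fun s : Fin n → Fin 3 => colorCount s Finset.univ k = 0) =
      Fintype.piFinset fun _ => Finset.univ.erase k := by
    ext s
    simp [colorCount, Finset.filter_eq_empty_iff]
  rw [this, Fintype.card_piFinset]
  simp

lemma choose_mul_pow_le {n j : ℕ} (hj : 1 ≤ j) (hjn : j ≤ n) :
    (n.choose j : ℝ) * 2 ^ (n - j) ≤ 2 ^ n * (Real.exp 1 * n / (2 * j)) ^ j := by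
  have hj0 : (0 : ℝ) < j := by exact_mod_cast hj
  have h1 : (n.choose j : ℝ) ≤ n ^ j / j.factorial := Nat.choose_le_pow_div j n
  have h2 := Real.pow_div_factorial_le_exp (j : ℝ) hj0.le j
  have h3 : (n : ℝ) ^ j / j.factorial ≤ (Real.exp 1 * n / j) ^ j := by
    rw [div_pow, mul_pow, ← Real.exp_nat_mul, mul_one, le_div_iff₀ (by positivity)]
    calc (n : ℝ) ^ j / j.factorial * j ^ j = (j : ℝ) ^ j / j.factorial * n ^ j := by ring
      _ ≤ _ := by gcongr
  have h4 : (2 : ℝ) ^ n = 2 ^ (n - j) * 2 ^ j := by rw [← pow_add]; congr 1; omega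
  calc (n.choose j : ℝ) * 2 ^ (n - j) ≤ (Real.exp 1 * n / j) ^ j * 2 ^ (n - j) := by
        gcongr; exact h1.trans h3
    _ = _ := by
        rw [h4, mul_comm (2 : ℝ) j, ← div_div, div_pow _ (2 : ℝ)]
        field_simp

lemma le_of_sq_bound {x y : ℝ} (hy : 0 ≤ y) (h : x ^ 2 ≤ y ^ 2) : x ≤ y :=
  (abs_le_of_sq_le_sq' h hy).2

lemma rate_moment_le {n j : ℝ} (hj : 0 < j) (hjn : 5 * j ≤ n) :
    Real.exp 1 * n / (2 * j) * √(3 * j / (Real.exp 1 * (n - j))) ^ 3 ≤ √(4.9 * j / n) := by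
  have he := Real.exp_one_gt_d9
  have hn : 0 < n := by linarith
  have hnj : 0 < n - j := by linarith
  refine le_of_sq_bound (Real.sqrt_nonneg _) ?_
  rw [Real.sq_sqrt (by positivity), mul_pow, ← pow_mul, mul_comm 3 2, pow_mul,
    Real.sq_sqrt (by positivity), div_pow, div_pow, div_mul_div_comm,
    div_le_div_iff₀ (by positivity) hn]
  have h1 : 0.512 * n ^ 3 ≤ (n - j) ^ 3 := by
    have : (0.8 * n) ^ 3 ≤ (n - j) ^ 3 := by gcongr; linarith
    nlinarith
  have h2 : 27 * n ^ 3 ≤ 4.9 * 4 * Real.exp 1 * (n - j) ^ 3 := by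
    have : (2.718 : ℝ) * (0.512 * n ^ 3) ≤ Real.exp 1 * (n - j) ^ 3 := by
      gcongr; linarith
    nlinarith [pow_pos hn 3]
  have h3 : 0 ≤ Real.exp 1 ^ 2 * j ^ 3 := by positivity
  nlinarith [mul_le_mul_of_nonneg_left h2 h3]

lemma sqrt_three_rate_sq {n j : ℝ} (hj : 0 < j) (hn : 0 < n) :
    (Real.exp 1 * n / (2 * j) * (√3 * j / n) ^ 3) ^ 2 = 6.75 * Real.exp 1 ^ 2 * (j / n) ^ 4 := by
  have : √3 ^ 6 = 27 := by
    rw [show 6 = 2 * 3 by norm_num, pow_mul, Real.sq_sqrt (by norm_num)]; norm_num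
  rw [mul_pow, ← pow_mul, div_pow, div_pow, mul_pow, mul_pow √3, this]
  field_simp
  norm_num
  ring

lemma rate_static_le {n j : ℝ} (hj : 0 < j) (hjn : 3 * j ≤ n) :
    Real.exp 1 * n / (2 * j) * (√3 * j / n) ^ 3 ≤ √(4.9 * j / n) ∧
      Real.exp 1 * n / (2 * j) * (√3 * j / n) ^ 3 ≤ 0.85 := by
  have he := Real.exp_one_lt_d9
  have he2 : Real.exp 1 ^ 2 ≤ 7.4 := by nlinarith [Real.exp_pos 1]
  have hn : 0 < n := by linarith
  have hβ : j / n ≤ 1 / 3 := by rw [div_le_div_iff₀ hn (by norm_num)]; linarith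
  have hβ0 : 0 < j / n := by positivity
  have hβ3 : (j / n) ^ 3 ≤ (1 / 3) ^ 3 := by gcongr
  have hβ4 : (j / n) ^ 4 ≤ (1 / 3) ^ 4 := by gcongr
  constructor
  · refine le_of_sq_bound (Real.sqrt_nonneg _) ?_
    rw [Real.sq_sqrt (by positivity), sqrt_three_rate_sq hj hn, mul_div_assoc]
    calc 6.75 * Real.exp 1 ^ 2 * (j / n) ^ 4 ≤ 6.75 * 7.4 * ((1 / 3) ^ 3 * (j / n)) := by
          rw [pow_succ (j / n) 3]; gcongr
      _ ≤ _ := by nlinarith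
  · refine le_of_sq_bound (by norm_num) ?_
    rw [sqrt_three_rate_sq hj hn]
    calc 6.75 * Real.exp 1 ^ 2 * (j / n) ^ 4 ≤ 6.75 * 7.4 * (1 / 3) ^ 4 := by gcongr
      _ ≤ _ := by norm_num

lemma rate_large_le {n j : ℝ} (hj : 0 < j) (hjn : n < 5 * j) (hn : 0 < n) :
    Real.exp 1 * n / (2 * j) * (1 / 2) ^ 3 ≤ 0.85 := by
  have he := Real.exp_one_lt_d9
  rw [div_mul_eq_mul_div, div_le_iff₀ (by positivity)]
  nlinarith

lemma sum_zeroFiber_minorityTerm_le {n : ℕ} (P : Finset (Fin n)) :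
    (n.choose P.card : ℝ) * ∑ s ∈ zeroFiber P, minorityTerm s ≤ 2 ^ n * decayTerm n P.card := by
  obtain ⟨j, hj⟩ : ∃ j, P.card = j := ⟨_, rfl⟩
  have hc0 : ∀ s ∈ zeroFiber P, colorCount s Finset.univ 0 = j := fun s hs => by
    rw [colorCount, mem_zeroFiber.1 hs, hj]
  rw [hj]
  unfold decayTerm
  by_cases h0 : j = 0 ∨ n < 3 * j
  · rw [if_pos h0, Finset.sum_eq_zero, mul_zero, mul_zero]
    intro s hs
    have h1 := colorCount_sum s Finset.univ
    rw [Finset.card_univ, Fintype.card_fin] at h1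
    have := hc0 s hs
    exact if_neg (by omega)
  rw [if_neg h0]
  push Not at h0
  have hj1 : 1 ≤ j := Nat.one_le_iff_ne_zero.2 h0.1
  have hjn : 3 * j ≤ n := h0.2
  have hj0 : (0 : ℝ) < j := by exact_mod_cast hj1
  have hjn' : 3 * (j : ℝ) ≤ n := by exact_mod_cast hjn
  have hn0 : (0 : ℝ) < n := by linarith
  have hnj : (0 : ℝ) < n - j := by linarith
  have hcard := card_zeroFiber P
  rw [hj, Fintype.card_fin] at hcard
  have hchoose := choose_mul_pow_le hj1 (by omega : j ≤ n)
  set E := Real.exp 1 * n / (2 * j) with hE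
  have hE0 : 0 ≤ E := by positivity
  have hstat := rate_static_le hj0 hjn'
  have hY0 : 0 ≤ E * (√3 * j / n) ^ 3 := by positivity
  suffices hX : ∃ X : ℝ, (∑ s ∈ zeroFiber P, minorityTerm s ≤
      2 ^ (n - j) * (X + (√3 * j / n) ^ (3 * j))) ∧ 0 ≤ X ∧
      E ^ j * (X + (√3 * j / n) ^ (3 * j)) ≤
        if 5 * j ≤ n then 3 * √(4.9 * j / n) ^ j else 2 * 0.85 ^ j by
    obtain ⟨X, hX1, hX0, hX2⟩ := hX
    calc _ ≤ (n.choose j : ℝ) * (2 ^ (n - j) * (X + (√3 * j / n) ^ (3 * j))) := by gcongr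
      _ = (n.choose j : ℝ) * 2 ^ (n - j) * (X + (√3 * j / n) ^ (3 * j)) := by ring
      _ ≤ 2 ^ n * E ^ j * (X + (√3 * j / n) ^ (3 * j)) := by gcongr
      _ = 2 ^ n * (E ^ j * (X + (√3 * j / n) ^ (3 * j))) := by ring
      _ ≤ _ := by gcongr
  by_cases h5 : 5 * j ≤ n
  · have h5' : 5 * (j : ℝ) ≤ n := by exact_mod_cast h5
    refine ⟨2 * √((3 * j : ℕ) / (Real.exp 1 * (n - j))) ^ (3 * j), ?_, by positivity, ?_⟩
    · have hmom := sum_zeroFiber_abs_pow_le P (p := 3 * j) (by omega)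
        (by rw [hj, Fintype.card_fin]; omega)
      rw [hj, Fintype.card_fin] at hmom
      have hle : ∀ s ∈ zeroFiber P, minorityTerm s ≤
          (|(colorCount s Finset.univ 2 : ℝ) - colorCount s Finset.univ 1| / (n - j)) ^ (3 * j) +
            (√3 * j / n) ^ (3 * j) := by
        intro s hs
        unfold minorityTerm
        rw [hc0 s hs]
        split_ifs
        · exact le_rfl
        · positivity
      refine (Finset.sum_le_sum hle).trans ?_
      rw [Finset.sum_add_distrib, Finset.sum_const, nsmul_eq_mul, hcard, mul_add]
      gcongr
    · rw [if_pos h5]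
      have hr := rate_moment_le hj0 h5'
      have e1 : E ^ j * (2 * √((3 * j : ℕ) / (Real.exp 1 * (n - j))) ^ (3 * j) +
          (√3 * j / n) ^ (3 * j)) =
          2 * (E * √(3 * j / (Real.exp 1 * (n - j))) ^ 3) ^ j + (E * (√3 * j / n) ^ 3) ^ j := by
        push_cast
        simp only [pow_mul, mul_pow]; ring
      rw [e1]
      have i1 := pow_le_pow_left₀ (by positivity) hr j
      have i2 := pow_le_pow_left₀ (by positivity) hstat.1 j
      linarith
  · have h5' : (n : ℝ) < 5 * j := by exact_mod_cast (by omega : n < 5 * j)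
    refine ⟨(1 / 2) ^ (3 * j), ?_, by positivity, ?_⟩
    · have hle : ∀ s ∈ zeroFiber P, minorityTerm s ≤
          (1 / 2) ^ (3 * j) + (√3 * j / n) ^ (3 * j) := by
        intro s hs
        have h1 := colorCount_sum s Finset.univ
        rw [Finset.card_univ, Fintype.card_fin] at h1
        unfold minorityTerm
        rw [hc0 s hs] at h1 ⊢
        split_ifs with hcond
        · refine add_le_add (pow_le_pow_left₀ (by positivity) ?_ _) le_rfl
          rw [div_le_div_iff₀ hnj (by norm_num)]
          have h1' : (j : ℝ) + colorCount s Finset.univ 1 + colorCount s Finset.univ 2 = n := by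
            exact_mod_cast h1
          have k1 : (j : ℝ) ≤ colorCount s Finset.univ 1 := by exact_mod_cast hcond.2.1
          have k2 : (j : ℝ) ≤ colorCount s Finset.univ 2 := by exact_mod_cast hcond.2.2
          have : |(colorCount s Finset.univ 2 : ℝ) - colorCount s Finset.univ 1| ≤ n - 3 * j := by
            rw [abs_le]; constructor <;> linarith
          linarith
        · positivity
      refine (Finset.sum_le_sum hle).trans ?_
      rw [Finset.sum_const, nsmul_eq_mul, hcard]
    · rw [if_neg h5]
      have hr := rate_large_le hj0 h5' hn0
      have e1 : E ^ j * ((1 / 2) ^ (3 * j) + (√3 * j / n) ^ (3 * j)) =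
          (E * (1 / 2) ^ 3) ^ j + (E * (√3 * j / n) ^ 3) ^ j := by
        simp only [pow_mul, mul_pow]; ring
      rw [e1]
      have i1 := pow_le_pow_left₀ (by positivity) hr j
      have i2 := pow_le_pow_left₀ (by positivity) hstat.2 j
      linarith

lemma sum_minorityTerm_le (n : ℕ) :
    ∑ s : Fin n → Fin 3, minorityTerm s ≤ 2 ^ n * ∑ j ∈ Finset.range (n + 1), decayTerm n j := by
  classical
  rw [← Finset.sum_fiberwise_of_maps_to (s := Finset.univ)
    (t := (Finset.univ : Finset (Fin n)).powerset)
    (g := fun s : Fin n → Fin 3 => Finset.univ.filter fun v => s v = 0) (by simp),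
    Finset.sum_powerset, Finset.card_univ, Fintype.card_fin, Finset.mul_sum]
  refine Finset.sum_le_sum fun j hj => ?_
  have hj' : j ≤ n := Nat.lt_succ_iff.1 (Finset.mem_range.1 hj)
  have hch : (0 : ℝ) < n.choose j := by exact_mod_cast Nat.choose_pos hj'
  have key : ∀ P ∈ Finset.powersetCard j (Finset.univ : Finset (Fin n)),
      ∑ s : Fin n → Fin 3 with (Finset.univ.filter fun v => s v = 0) = P, minorityTerm s ≤
        2 ^ n * decayTerm n j / n.choose j := by
    intro P hP
    have hPc := (Finset.mem_powersetCard.1 hP).2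
    rw [le_div_iff₀ hch, mul_comm]
    have := sum_zeroFiber_minorityTerm_le P
    rw [hPc] at this
    have hset : (Finset.univ.filter fun s : Fin n → Fin 3 =>
        (Finset.univ.filter fun v => s v = 0) = P) = zeroFiber P := by
      ext s
      rw [mem_zeroFiber]
      simp [Finset.ext_iff]
    rwa [hset]
  refine (Finset.sum_le_sum key).trans ?_
  rw [Finset.sum_const, Finset.card_powersetCard, Finset.card_univ, Fintype.card_fin, nsmul_eq_mul]
  exact (mul_div_cancel₀ _ hch.ne').le

/-- Summing the signed matching counts over all vertex colourings. -/
lemma sum_abs_matchingSum_le {n h d : ℕ} (hn : n = 2 * h) (hd : 3 ≤ d) :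
    ∑ s : Fin n → Fin 3,
        |(matchingSum cfgWeight (fun p : Fin n × Fin d => s p.1) Finset.univ : ℝ)| ≤
      2 ^ n * (3 + 3 * ∑ j ∈ Finset.range (n + 1), decayTerm n j) * oddProd (h * d) := by
  have hO : (0 : ℝ) < oddProd (h * d) := by exact_mod_cast oddProd_pos _
  refine (Finset.sum_le_sum fun s _ => abs_matchingSum_vertexColoring_le_sum hn hd s).trans ?_
  rw [← Finset.sum_mul]
  refine mul_le_mul_of_nonneg_right ?_ hO.le
  have hcomm : ∀ f : (Fin n → Fin 3) → Fin 3 → ℝ, ∑ s, ∑ k, f s k = ∑ k, ∑ s, f s k :=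
    fun _ => Finset.sum_comm
  rw [Finset.sum_add_distrib, hcomm, hcomm]
  simp only [sum_colorCount_eq_zero]
  have : ∀ k : Fin 3, ∑ s : Fin n → Fin 3, minorityTerm (Equiv.swap 0 k ∘ s) =
      ∑ s : Fin n → Fin 3, minorityTerm s := fun k =>
    Fintype.sum_equiv (Equiv.piCongrRight fun _ => Equiv.swap 0 k) _ _ fun s => rfl
  simp only [this]
  simp only [Finset.sum_const, Finset.card_univ, Fintype.card_fin, nsmul_eq_mul]
  have := sum_minorityTerm_le n
  push_cast
  linarith

lemma decayTerm_nonneg (n j : ℕ) : 0 ≤ decayTerm n j := by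
  unfold decayTerm; split_ifs <;> positivity

lemma decayTerm_le (n j : ℕ) : decayTerm n j ≤ 3 * 0.99 ^ j := by
  unfold decayTerm
  split_ifs with h0 h5
  · positivity
  · push Not at h0
    have hj0 : (0 : ℝ) < j := by exact_mod_cast Nat.pos_of_ne_zero h0.1
    have h5' : 5 * (j : ℝ) ≤ n := by exact_mod_cast h5
    gcongr
    rw [Real.sqrt_le_left (by norm_num), div_le_iff₀ (by linarith)]
    nlinarith
  · gcongr <;> norm_num

lemma tendsto_decayTerm (j : ℕ) :
    Filter.Tendsto (fun n => decayTerm n j) Filter.atTop (nhds 0) := by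
  rcases Nat.eq_zero_or_pos j with rfl | hj
  · simp [decayTerm]
  have h : Filter.Tendsto (fun n : ℕ => 3 * √(4.9 * j / n) ^ j) Filter.atTop (nhds 0) := by
    have h1 := (tendsto_const_div_atTop_nhds_zero_nat (4.9 * (j : ℝ))).sqrt
    have h2 := (h1.pow j).const_mul 3
    simpa [hj.ne'] using h2
  refine h.congr' ?_
  filter_upwards [Filter.eventually_ge_atTop (5 * j)] with n hn
  rw [decayTerm, if_neg (by omega), if_pos hn]

lemma tendsto_sum_decayTerm :
    Filter.Tendsto (fun n => ∑ j ∈ Finset.range (n + 1), decayTerm n j) Filter.atTop (nhds 0) := by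
  have h := tendsto_tsum_of_dominated_convergence (𝓕 := Filter.atTop)
    (f := fun n j => decayTerm n j) (g := fun _ => (0 : ℝ)) (bound := fun j => 3 * 0.99 ^ j)
    ((summable_geometric_of_lt_one (by norm_num) (by norm_num)).mul_left 3) tendsto_decayTerm
    (Filter.Eventually.of_forall fun n j => by
      rw [Real.norm_of_nonneg (decayTerm_nonneg n j)]; exact decayTerm_le n j)
  rw [tsum_zero] at h
  refine h.congr fun n => tsum_eq_sum fun j hj => ?_
  rw [Finset.mem_range, not_lt] at hj
  exact if_pos (by omega)

/-! ### Averaging over the measurement angles -/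

/-- The sign attached to the basis state `z` and the outcome `x`. -/
def graphSign {n : ℕ} (m : Fin n → Fin n → ℕ) (x z : Fin n → Bool) : ℤ :=
  (-1) ^ ((∑ i : Fin n, ∑ j : Fin n, if i < j ∧ z i ∧ z j then m i j else 0) +
    ∑ i : Fin n, (if x i ∧ z i then 1 else 0))

/-- The net frequency in the angle at a vertex whose four replicas are in states `q`. -/
def charge (q : Fin 4 → Bool) : ℤ := ∑ a : Fin 4, (-1) ^ (a : ℕ) * (-1) ^ (if q a then 1 else 0)

/-- The colour recording which replicas differ at a vertex. -/
def replicaColor (q : Fin 4 → Bool) : Fin 3 :=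
  if q 0 ≠ q 1 then 1 else if q 0 ≠ q 3 then 2 else 0

lemma gsProb_sq (n : ℕ) (m : Fin n → Fin n → ℕ) (θ : Fin n → ℝ) (x : Fin n → Bool) :
    ((gsProb n m θ x ^ 2 : ℝ) : ℂ) = ∑ y : Fin 4 → Fin n → Bool,
      (1 / 2 ^ n : ℂ) ^ 4 * ((∏ a, graphSign m x (y a) : ℤ) : ℂ) *
        ∏ j, Complex.exp (-Complex.I * θ j * charge fun a => y a j) := by
  have key : ∀ a : Fin 4, (1 / 2 ^ n : ℂ) * ∑ z : Fin n → Bool, (graphSign m x z : ℂ) *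
      ∏ j, Complex.exp (-Complex.I * θ j * ((-1) ^ (a : ℕ) * (-1) ^ (if z j then 1 else 0))) =
      if (a : ℕ) % 2 = 0 then gsAmp n m θ x else (starRingEnd ℂ) (gsAmp n m θ x) := by
    intro a
    have he : Even (a : ℕ) ↔ (a : ℕ) % 2 = 0 := Nat.even_iff
    split_ifs with h
    · rw [(he.2 h).neg_one_pow]
      simp [gsAmp, graphSign]
    · rw [(Nat.not_even_iff_odd.1 (he.not.2 h)).neg_one_pow]
      simp [gsAmp, graphSign, ← Complex.exp_conj, apply_ite (starRingEnd ℂ), Complex.conj_ofNat]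
  have hprod : ((gsProb n m θ x ^ 2 : ℝ) : ℂ) = ∏ a : Fin 4, ((1 / 2 ^ n : ℂ) *
      ∑ z : Fin n → Bool, (graphSign m x z : ℂ) * ∏ j,
        Complex.exp (-Complex.I * θ j * ((-1) ^ (a : ℕ) * (-1) ^ (if z j then 1 else 0)))) := by
    simp_rw [key]
    rw [Fin.prod_univ_four]
    simp only [Complex.ofReal_pow, gsProb, Complex.normSq_eq_conj_mul_self]
    simp
    ring
  rw [hprod, Finset.prod_mul_distrib, Finset.prod_const, Finset.card_univ, Fintype.card_fin,
    Finset.prod_univ_sum, Finset.mul_sum]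
  rw [Fintype.piFinset_univ]
  refine Finset.sum_congr rfl fun y _ => ?_
  rw [Finset.prod_mul_distrib, Finset.prod_comm]
  push_cast
  rw [← mul_assoc]
  congr 1
  refine Finset.prod_congr rfl fun j _ => ?_
  rw [← Complex.exp_sum, ← Finset.mul_sum]
  simp [charge]

lemma integral_exp_charge (c : ℤ) :
    ∫ t in Set.Icc (0 : ℝ) (2 * Real.pi), Complex.exp (-Complex.I * t * c) =
      if c = 0 then (2 * Real.pi : ℂ) else 0 := by
  have h0 : (0 : ℝ) ≤ 2 * Real.pi := by positivity
  rw [integral_Icc_eq_integral_Ioc, ← intervalIntegral.integral_of_le h0]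
  split_ifs with hc
  · simp [hc]
  · have hc' : (-Complex.I * c : ℂ) ≠ 0 := by simp [hc]
    have := integral_exp_mul_complex (a := 0) (b := 2 * Real.pi) hc'
    simp_rw [show ∀ t : ℝ, -Complex.I * t * c = (-Complex.I * c) * t from fun t => by ring]
    rw [this]
    have h1 : Complex.exp (-Complex.I * c * ((2 * Real.pi : ℝ) : ℂ)) = 1 := by
      rw [Complex.exp_eq_one_iff]
      exact ⟨-c, by push_cast; ring⟩
    rw [h1]
    simp

lemma integral_prod_exp_charge {n : ℕ} (c : Fin n → ℤ) :
    ∫ θ in Set.univ.pi (fun _ : Fin n => Set.Icc (0 : ℝ) (2 * Real.pi)),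
        ∏ j, Complex.exp (-Complex.I * θ j * c j) =
      ∏ j, if c j = 0 then (2 * Real.pi : ℂ) else 0 := by
  rw [volume_pi, Measure.restrict_pi_pi]
  rw [integral_fintype_prod_eq_prod (f := fun j (t : ℝ) => Complex.exp (-Complex.I * t * c j))]
  exact Finset.prod_congr rfl fun j _ => integral_exp_charge (c j)

lemma replica_x_sign (q : Fin 4 → Bool) (hq : charge q = 0) (b : Bool) :
    ∏ a, (-1 : ℤ) ^ (if b ∧ q a then 1 else 0) = 1 := by
  revert q b; decide

lemma replica_edge_sign (q q' : Fin 4 → Bool) (hq : charge q = 0) (hq' : charge q' = 0) :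
    ∏ a, (if q a ∧ q' a then (-1 : ℤ) else 1) =
      cfgWeight (replicaColor q) (replicaColor q') *
        cfgWeight (replicaColor q') (replicaColor q) := by
  revert q q'; unfold cfgWeight; decide

/-- The product of the edge signs of a vertex colouring. -/
def edgeSign {n : ℕ} (m : Fin n → Fin n → ℕ) (s : Fin n → Fin 3) : ℤ :=
  ∏ i, ∏ j, if i < j then (cfgWeight (s i) (s j) * cfgWeight (s j) (s i)) ^ m i j else 1

lemma prod_graphSign {n : ℕ} (m : Fin n → Fin n → ℕ) (x : Fin n → Bool)
    (y : Fin 4 → Fin n → Bool) (hy : ∀ j, charge (fun a => y a j) = 0) :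
    ∏ a, graphSign m x (y a) = edgeSign m fun j => replicaColor fun a => y a j := by
  simp only [graphSign, pow_add, Finset.prod_mul_distrib, ← Finset.prod_pow_eq_pow_sum]
  have hx : ∏ a, ∏ i, (-1 : ℤ) ^ (if x i ∧ y a i then 1 else 0) = 1 := by
    rw [Finset.prod_comm]
    exact Finset.prod_eq_one fun i _ => replica_x_sign _ (hy i) (x i)
  rw [hx, mul_one, Finset.prod_comm, edgeSign]
  refine Finset.prod_congr rfl fun i _ => ?_
  rw [Finset.prod_comm]
  refine Finset.prod_congr rfl fun j _ => ?_
  rw [← replica_edge_sign _ _ (hy i) (hy j)]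
  by_cases hij : i < j
  · rw [if_pos hij, ← Finset.prod_pow]
    refine Finset.prod_congr rfl fun a _ => ?_
    by_cases h : y a i = true ∧ y a j = true <;> simp [hij, h]
  · simp [hij]

lemma card_neutral_replicaColor (k : Fin 3) :
    (Finset.univ.filter fun q : Fin 4 → Bool => charge q = 0 ∧ replicaColor q = k).card = 2 := by
  revert k; decide

lemma sum_neutral {n : ℕ} (F : (Fin n → Fin 3) → ℂ) :
    (∑ y : Fin n → Fin 4 → Bool, if ∀ j, charge (y j) = 0 then F fun j => replicaColor (y j)
      else 0) = 2 ^ n * ∑ s, F s := by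
  rw [← Finset.sum_filter, ← Finset.sum_fiberwise_of_maps_to (t := Finset.univ)
    (g := fun (y : Fin n → Fin 4 → Bool) j => replicaColor (y j)) (by simp), Finset.mul_sum]
  refine Finset.sum_congr rfl fun s _ => ?_
  rw [Finset.sum_congr rfl (g := fun _ => F s) (by
    intro y hy
    rw [(Finset.mem_filter.1 hy).2])]
  rw [Finset.sum_const, nsmul_eq_mul]
  congr 1
  have : (Finset.filter (fun y : Fin n → Fin 4 → Bool => (fun j => replicaColor (y j)) = s)
      (Finset.univ.filter fun y => ∀ j, charge (y j) = 0)) =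
      Fintype.piFinset fun j => Finset.univ.filter fun q => charge q = 0 ∧ replicaColor q = s j := by
    ext y
    simp [funext_iff, forall_and]
  rw [this, Fintype.card_piFinset]
  simp [card_neutral_replicaColor]

/-- The angle average of the second moment as a sum over vertex colourings. -/
lemma avgSecondMoment_eq (n : ℕ) (m : Fin n → Fin n → ℕ) :
    avgSecondMoment n m = (2 ^ n)⁻¹ * ∑ s, (edgeSign m s : ℝ) := by
  have hpi : (2 * Real.pi : ℂ) ≠ 0 := by
    exact_mod_cast (by positivity : (2 * Real.pi : ℝ) ≠ 0)
  have hint : ∀ y : Fin 4 → Fin n → Bool, IntegrableOn (fun θ : Fin n → ℝ =>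
      ∏ j, Complex.exp (-Complex.I * θ j * charge fun a => y a j))
      (Set.univ.pi (fun _ : Fin n => Set.Icc (0 : ℝ) (2 * Real.pi))) := fun y =>
    ContinuousOn.integrableOn_compact (isCompact_univ_pi fun _ => isCompact_Icc)
      (by fun_prop)
  have hx : ∀ x : Fin n → Bool,
      ∫ θ in Set.univ.pi (fun _ : Fin n => Set.Icc (0 : ℝ) (2 * Real.pi)),
        ((gsProb n m θ x ^ 2 : ℝ) : ℂ) =
      (1 / 2 ^ n) ^ 4 * (2 * Real.pi) ^ n * (2 ^ n * ∑ s, (edgeSign m s : ℂ)) := by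
    intro x
    simp_rw [gsProb_sq]
    rw [integral_finsetSum _ fun y _ => (hint y).const_mul _]
    simp_rw [integral_const_mul, integral_prod_exp_charge]
    rw [← sum_neutral, Finset.mul_sum]
    refine Fintype.sum_equiv (Equiv.piComm fun _ _ => Bool) _ _ fun y => ?_
    change _ = _ * (if ∀ j, charge (fun a => y a j) = 0 then
      (edgeSign m fun j => replicaColor fun a => y a j : ℂ) else 0)
    split_ifs with hy
    · rw [prod_graphSign m x y hy]
      simp [hy]
      ring
    · push Not at hy
      obtain ⟨j, hj⟩ := hy
      rw [Finset.prod_eq_zero (Finset.mem_univ j) (if_neg hj)]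
      simp
  have hsum : ((∫ θ in Set.univ.pi (fun _ : Fin n => Set.Icc (0 : ℝ) (2 * Real.pi)),
      secondMoment n m θ : ℝ) : ℂ) = 2 ^ n * (2 ^ n * ((1 / 2 ^ n) ^ 4 * (2 * Real.pi) ^ n *
        (2 ^ n * ∑ s, (edgeSign m s : ℂ)))) := by
    rw [← integral_complex_ofReal]
    simp only [secondMoment, Complex.ofReal_mul, Complex.ofReal_sum]
    rw [integral_const_mul, integral_finsetSum]
    · simp_rw [hx]
      simp
    · intro x _
      simp_rw [gsProb_sq]
      exact integrable_finsetSum _ fun y _ => (hint y).const_mul _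
  have : ((avgSecondMoment n m : ℝ) : ℂ) = (((2 ^ n)⁻¹ * ∑ s, (edgeSign m s : ℝ) : ℝ) : ℂ) := by
    rw [avgSecondMoment, Complex.ofReal_mul, hsum]
    push_cast
    field_simp
  exact_mod_cast this

/-! ### Regular graphs and perfect matchings of half-edges -/

open Classical in
/-- The perfect matchings of the half-edges `Fin n × Fin d` that induce a simple graph. -/
def simpleMatchings (n d : ℕ) : Finset (Equiv.Perm (Fin n × Fin d)) :=
  (perfectMatchings Finset.univ).filter fun σ => (∀ p, (σ p).1 ≠ p.1) ∧
    ∀ p q, p.1 = q.1 → (σ p).1 = (σ q).1 → p = q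

lemma mem_simpleMatchings {n d : ℕ} {σ : Equiv.Perm (Fin n × Fin d)} :
    σ ∈ simpleMatchings n d ↔ (∀ p, σ (σ p) = p) ∧ (∀ p, (σ p).1 ≠ p.1) ∧
      ∀ p q, p.1 = q.1 → (σ p).1 = (σ q).1 → p = q := by
  classical
  simp only [simpleMatchings, Finset.mem_filter, mem_perfectMatchings, Finset.mem_univ, iff_true]
  refine ⟨fun h => ⟨h.1.1, h.2⟩, fun h => ⟨⟨h.1, fun p hp => h.2.1 p (by rw [hp])⟩, h.2⟩⟩

/-- The graph obtained by contracting half-edges to their vertices. -/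
def matchingGraph {n d : ℕ} (σ : Equiv.Perm (Fin n × Fin d)) : SimpleGraph (Fin n) :=
  SimpleGraph.fromRel fun v w => ∃ i, (σ (v, i)).1 = w

lemma matchingGraph_adj {n d : ℕ} {σ : Equiv.Perm (Fin n × Fin d)} (hσ : σ ∈ simpleMatchings n d)
    (v w : Fin n) : (matchingGraph σ).Adj v w ↔ ∃ i, (σ (v, i)).1 = w := by
  obtain ⟨h1, h2, -⟩ := mem_simpleMatchings.1 hσ
  rw [matchingGraph, SimpleGraph.fromRel_adj]
  have hsymm : (∃ i, (σ (w, i)).1 = v) → ∃ i, (σ (v, i)).1 = w := by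
    rintro ⟨i, rfl⟩
    exact ⟨(σ (w, i)).2, by rw [Prod.mk.eta, h1]⟩
  constructor
  · rintro ⟨-, h | h⟩
    exacts [h, hsymm h]
  · rintro ⟨i, rfl⟩
    exact ⟨(h2 (v, i)).symm, Or.inl ⟨i, rfl⟩⟩

open Classical in
lemma matchingGraph_neighbors {n d : ℕ} {σ : Equiv.Perm (Fin n × Fin d)}
    (hσ : σ ∈ simpleMatchings n d) (v : Fin n) :
    (Finset.univ.filter fun w => (matchingGraph σ).Adj v w) =
      Finset.univ.image fun i => (σ (v, i)).1 := by
  ext w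
  simp [matchingGraph_adj hσ]

lemma simpleMatchings_injective {n d : ℕ} {σ : Equiv.Perm (Fin n × Fin d)}
    (hσ : σ ∈ simpleMatchings n d) (v : Fin n) :
    Function.Injective fun i => (σ (v, i)).1 := fun i j hij =>
  (Prod.ext_iff.1 ((mem_simpleMatchings.1 hσ).2.2 (v, i) (v, j) rfl hij)).2

lemma matchingGraph_mem {n d : ℕ} {σ : Equiv.Perm (Fin n × Fin d)}
    (hσ : σ ∈ simpleMatchings n d) : matchingGraph σ ∈ regularGraphs n d := by
  classical
  simp only [regularGraphs, Finset.mem_filter, Finset.mem_univ, true_and]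
  intro v
  have := congrArg Finset.card (matchingGraph_neighbors hσ v)
  rw [Finset.card_image_of_injective _ (simpleMatchings_injective hσ v)] at this
  simpa using this

/-- The matching determined by a labelling of the neighbours of each vertex. -/
def labelMatching {n d : ℕ} {G : SimpleGraph (Fin n)} (e : ∀ v, Fin d ≃ {w // G.Adj v w}) :
    Equiv.Perm (Fin n × Fin d) :=
  Function.Involutive.toPerm
    (fun p => ((e p.1 p.2).1, (e (e p.1 p.2).1).symm ⟨p.1, (e p.1 p.2).2.symm⟩)) (by
      have key : ∀ v w (i : Fin d) (h : (e v i).1 = w) (h' : G.Adj w v),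
          (((e v i).1, (e (e v i).1).symm ⟨v, (e v i).2.symm⟩) : Fin n × Fin d) =
            (w, (e w).symm ⟨v, h'⟩) := by
        rintro v w i rfl h'; rfl
      rintro ⟨v, i⟩
      refine (key _ v _ (by simp) (e v i).2).trans ?_
      simp)

lemma labelMatching_fst {n d : ℕ} {G : SimpleGraph (Fin n)} (e : ∀ v, Fin d ≃ {w // G.Adj v w})
    (p : Fin n × Fin d) : (labelMatching e p).1 = (e p.1 p.2).1 := rfl

lemma labelMatching_mem {n d : ℕ} {G : SimpleGraph (Fin n)} (e : ∀ v, Fin d ≃ {w // G.Adj v w}) :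
    labelMatching e ∈ simpleMatchings n d := by
  rw [mem_simpleMatchings]
  refine ⟨fun p => (labelMatching e).left_inv p, fun p => ?_, ?_⟩
  · rw [labelMatching_fst]
    exact (e p.1 p.2).2.ne'
  · rintro ⟨v, i⟩ ⟨w, j⟩ h
    obtain rfl : v = w := h
    intro h
    rw [labelMatching_fst, labelMatching_fst] at h
    obtain rfl : i = j := (e v).injective (Subtype.ext h)
    rfl

lemma matchingGraph_labelMatching {n d : ℕ} {G : SimpleGraph (Fin n)}
    (e : ∀ v, Fin d ≃ {w // G.Adj v w}) : matchingGraph (labelMatching e) = G := by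
  ext v w
  rw [matchingGraph_adj (labelMatching_mem e)]
  simp only [labelMatching_fst]
  constructor
  · rintro ⟨i, rfl⟩
    exact (e v i).2
  · intro h
    exact ⟨(e v).symm ⟨w, h⟩, by simp⟩

open Classical in
lemma card_matchingGraph_fiber {n d : ℕ} {G : SimpleGraph (Fin n)} (hG : G ∈ regularGraphs n d) :
    ((simpleMatchings n d).filter fun σ => matchingGraph σ = G).card = d.factorial ^ n := by
  have hcard : Fintype.card (∀ v, Fin d ≃ {w // G.Adj v w}) = d.factorial ^ n := by
    rw [Fintype.card_pi]
    have : ∀ v, Fintype.card (Fin d ≃ {w // G.Adj v w}) = d.factorial := by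
      intro v
      have h1 : Fintype.card {w // G.Adj v w} = d := by
        rw [Fintype.card_subtype]
        exact (Finset.mem_filter.1 hG).2 v
      rw [Fintype.card_equiv (Fintype.equivOfCardEq (by simp [h1])), Fintype.card_fin]
    simp [this]
  rw [← hcard, ← Finset.card_univ]
  symm
  refine Finset.card_bij (fun e _ => labelMatching e) ?_ ?_ ?_
  · intro e _
    exact Finset.mem_filter.2 ⟨labelMatching_mem e, matchingGraph_labelMatching e⟩
  · intro e _ e' _ h
    funext v
    ext i : 2
    have := congrArg (fun σ => (σ (v, i)).1) h
    simpa [labelMatching_fst] using this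
  · intro σ hσ
    obtain ⟨hσ, hσG⟩ := Finset.mem_filter.1 hσ
    have hadj := matchingGraph_adj hσ
    rw [hσG] at hadj
    refine ⟨fun v => Equiv.ofBijective (fun i => ⟨(σ (v, i)).1, (hadj v _).2 ⟨i, rfl⟩⟩) ⟨?_, ?_⟩,
      Finset.mem_univ _, ?_⟩
    · intro i j hij
      exact simpleMatchings_injective hσ v (congrArg Subtype.val hij)
    · rintro ⟨w, hw⟩
      obtain ⟨i, hi⟩ := (hadj v w).1 hw
      exact ⟨i, Subtype.ext hi⟩
    · refine Equiv.ext ?_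
      rintro ⟨v, i⟩
      refine Prod.ext rfl ?_
      refine (Equiv.symm_apply_eq _).2 (Subtype.ext ?_)
      change v = (σ ((σ (v, i)).1, (σ (v, i)).2)).1
      rw [Prod.mk.eta, (mem_simpleMatchings.1 hσ).1]

/-- The configuration-model weight of a matching. -/
def configWeight {n d : ℕ} (σ : Equiv.Perm (Fin n × Fin d)) : ℤ :=
  ∑ s : Fin n → Fin 3, ∏ p, cfgWeight (s p.1) (s (σ p).1)

lemma prod_prod_eq_prod_lt {n : ℕ} (g : Fin n → Fin n → ℤ) (hg : ∀ i, g i i = 1) :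
    ∏ i, ∏ j, g i j = ∏ i, ∏ j, if i < j then g i j * g j i else 1 := by
  have h1 : ∀ i j, g i j = (if i < j then g i j else 1) * (if j < i then g i j else 1) := by
    intro i j
    rcases lt_trichotomy i j with h | rfl | h
    · simp [h, h.not_gt]
    · simp [hg]
    · simp [h, h.not_gt]
  have h2 : ∏ i, ∏ j, (if j < i then g i j else 1) = ∏ i, ∏ j, if i < j then g j i else 1 :=
    Finset.prod_comm
  calc ∏ i, ∏ j, g i j
      = (∏ i, ∏ j, if i < j then g i j else 1) * ∏ i, ∏ j, if j < i then g i j else 1 := by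
        simp_rw [← Finset.prod_mul_distrib, ← h1]
    _ = _ := by
        rw [h2]
        simp_rw [← Finset.prod_mul_distrib]
        refine Finset.prod_congr rfl fun i _ => Finset.prod_congr rfl fun j _ => ?_
        split_ifs <;> simp

open Classical in
lemma prod_cfgWeight_eq_edgeSign {n d : ℕ} {σ : Equiv.Perm (Fin n × Fin d)}
    (hσ : σ ∈ simpleMatchings n d) (s : Fin n → Fin 3) :
    ∏ p, cfgWeight (s p.1) (s (σ p).1) =
      edgeSign (fun i j => if (matchingGraph σ).Adj i j then 1 else 0) s := by
  have h1 : ∏ p, cfgWeight (s p.1) (s (σ p).1) =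
      ∏ v, ∏ w, if (matchingGraph σ).Adj v w then cfgWeight (s v) (s w) else 1 := by
    rw [Fintype.prod_prod_type]
    refine Finset.prod_congr rfl fun v _ => ?_
    rw [← Finset.prod_filter, matchingGraph_neighbors hσ,
      Finset.prod_image (simpleMatchings_injective hσ v).injOn]
  rw [h1, prod_prod_eq_prod_lt _ (by simp), edgeSign]
  refine Finset.prod_congr rfl fun v _ => Finset.prod_congr rfl fun w _ => ?_
  by_cases h : (matchingGraph σ).Adj v w <;> simp [h, (matchingGraph σ).adj_comm w v]

lemma configWeight_nonneg {n d : ℕ} {σ : Equiv.Perm (Fin n × Fin d)}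
    (hσ : ∀ p, σ (σ p) = p) : 0 ≤ configWeight σ := by
  classical
  rw [configWeight, ← Finset.sum_fiberwise_of_maps_to (t := Finset.univ)
    (g := fun s : Fin n → Fin 3 => Finset.univ.filter fun v => s v = 1) (by simp)]
  refine Finset.sum_nonneg fun U _ => ?_
  let T : Fin n → Finset (Fin 3) := fun w => if w ∈ U then {1} else {0, 2}
  let c : Fin n → Fin 3 → ℤ := fun w a => ∏ i, if a = 2 ∧ (σ (w, i)).1 ∈ U then -1 else 1
  have hT : (Finset.univ.filter fun s : Fin n → Fin 3 =>
      (Finset.univ.filter fun v => s v = 1) = U) = Fintype.piFinset T := by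
    ext s
    simp only [Finset.mem_filter, Finset.mem_univ, true_and, Fintype.mem_piFinset, Finset.ext_iff,
      T]
    refine forall_congr' fun w => ?_
    generalize s w = k
    by_cases hw : w ∈ U
    · simp [hw]
    · simp only [hw, iff_false, if_false]
      revert k; decide
  have hc : ∀ s ∈ Fintype.piFinset T, ∏ p, cfgWeight (s p.1) (s (σ p).1) = ∏ w, c w (s w) := by
    intro s hs
    rw [← hT] at hs
    have hs' : (Finset.univ.filter fun v => s v = 1) = U := (Finset.mem_filter.1 hs).2
    rw [← Fintype.prod_prod_type' (fun w i => if s w = 2 ∧ (σ (w, i)).1 ∈ U then (-1 : ℤ) else 1)]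
    refine Fintype.prod_equiv σ _ _ fun p => ?_
    simp only [Prod.mk.eta, hσ, cfgWeight, ← hs', Finset.mem_filter, Finset.mem_univ, true_and]
    simp only [and_comm]
  rw [hT, Finset.sum_congr rfl hc, ← Finset.prod_univ_sum]
  refine Finset.prod_nonneg fun w _ => ?_
  by_cases hw : w ∈ U
  · simp [T, c, hw]
  · have h2 : c w 2 = 1 ∨ c w 2 = -1 := by
      simp only [c]
      refine Finset.prod_induction _ (fun z : ℤ => z = 1 ∨ z = -1) ?_ (Or.inl rfl) ?_
      · rintro a b (rfl | rfl) (rfl | rfl) <;> simp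
      · intro i _
        split_ifs <;> simp
    have h0 : c w 0 = 1 := by simp [c]
    simp only [T, hw, if_false]
    rw [Finset.sum_pair (by decide), h0]
    rcases h2 with h2 | h2 <;> rw [h2] <;> norm_num

lemma regularAvgM2_mul_card (n d : ℕ) (hne : (simpleMatchings n d).Nonempty) :
    regularAvgM2 n d * (simpleMatchings n d).card =
      (2 ^ n)⁻¹ * ∑ σ ∈ simpleMatchings n d, (configWeight σ : ℝ) := by
  classical
  have hmaps : ∀ σ ∈ simpleMatchings n d, matchingGraph σ ∈ regularGraphs n d :=
    fun σ hσ => matchingGraph_mem hσ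
  have hcard : ((simpleMatchings n d).card : ℝ) =
      (regularGraphs n d).card * (d.factorial : ℝ) ^ n := by
    rw [Finset.card_eq_sum_card_fiberwise hmaps,
      Finset.sum_congr rfl fun G hG => card_matchingGraph_fiber hG]
    simp
  have hpos : ((regularGraphs n d).card : ℝ) ≠ 0 := by
    obtain ⟨σ, hσ⟩ := hne
    have : 0 < (regularGraphs n d).card := Finset.card_pos.2 ⟨_, hmaps σ hσ⟩
    positivity
  have hsum : (2 ^ n)⁻¹ * ∑ σ ∈ simpleMatchings n d, (configWeight σ : ℝ) =
      (d.factorial : ℝ) ^ n * ∑ G ∈ regularGraphs n d,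
        avgSecondMoment n (fun i j => if G.Adj i j then 1 else 0) := by
    rw [← Finset.sum_fiberwise_of_maps_to hmaps, Finset.mul_sum, Finset.mul_sum]
    refine Finset.sum_congr rfl fun G hG => ?_
    have hfib : ∀ σ ∈ (simpleMatchings n d).filter (fun σ => matchingGraph σ = G),
        (configWeight σ : ℝ) =
          2 ^ n * avgSecondMoment n (fun i j => if G.Adj i j then 1 else 0) := by
      intro σ hσ
      rw [Finset.mem_filter] at hσ
      have h := fun s => prod_cfgWeight_eq_edgeSign hσ.1 s
      rw [hσ.2] at h
      rw [avgSecondMoment_eq, mul_inv_cancel_left₀ (by positivity), configWeight]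
      simp only [h, Int.cast_sum]
    rw [Finset.sum_congr rfl hfib, Finset.sum_const, card_matchingGraph_fiber hG, nsmul_eq_mul]
    push_cast
    field_simp
  rw [hsum, hcard, regularAvgM2]
  field_simp

lemma sum_configWeight (n d : ℕ) :
    ∑ σ ∈ perfectMatchings (Finset.univ : Finset (Fin n × Fin d)), configWeight σ =
      ∑ s : Fin n → Fin 3, matchingSum cfgWeight (fun p : Fin n × Fin d => s p.1) Finset.univ := by
  simp only [configWeight, matchingSum]
  exact Finset.sum_comm

/-- Comparison of the regular-graph average with the configuration model. -/
lemma regularAvgM2_mul_card_le {n h d : ℕ} (hn : n = 2 * h) (hd : 3 ≤ d)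
    (hne : (simpleMatchings n d).Nonempty) :
    regularAvgM2 n d * (simpleMatchings n d).card ≤
      (3 + 3 * ∑ j ∈ Finset.range (n + 1), decayTerm n j) *
        (perfectMatchings (Finset.univ : Finset (Fin n × Fin d))).card := by
  classical
  have hcard : ((perfectMatchings (Finset.univ : Finset (Fin n × Fin d))).card : ℝ) =
      oddProd (h * d) := by
    exact_mod_cast card_perfectMatchings (by
      rw [Finset.card_univ, Fintype.card_prod, Fintype.card_fin, Fintype.card_fin, hn, mul_assoc])
  rw [regularAvgM2_mul_card n d hne, hcard, inv_mul_le_iff₀ (by positivity), ← mul_assoc]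
  refine le_trans ?_ (sum_abs_matchingSum_le hn hd)
  have h1 : ∑ σ ∈ simpleMatchings n d, configWeight σ ≤
      ∑ σ ∈ perfectMatchings (Finset.univ : Finset (Fin n × Fin d)), configWeight σ :=
    Finset.sum_le_sum_of_subset_of_nonneg (Finset.filter_subset _ _) fun σ hσ _ =>
      configWeight_nonneg (mem_perfectMatchings.1 hσ).1
  rw [sum_configWeight] at h1
  calc ∑ σ ∈ simpleMatchings n d, (configWeight σ : ℝ)
      ≤ ∑ s : Fin n → Fin 3,
          (matchingSum cfgWeight (fun p : Fin n × Fin d => s p.1) Finset.univ : ℝ) := by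
        exact_mod_cast h1
    _ ≤ _ := Finset.sum_le_sum fun s _ => le_abs_self _

/-! ### A counting form of the lopsided local lemma -/

section LocalLemma

open Classical in
/-- The outcomes in `Ω` avoiding all events `A j` with `j ∈ T`. -/
def avoiding {β ι : Type*} (Ω : Finset β) (A : ι → β → Prop) (T : Finset ι) : Finset β :=
  Ω.filter fun σ => ∀ j ∈ T, ¬A j σ

variable {β ι : Type*} {Ω : Finset β} {A : ι → β → Prop}

lemma mem_avoiding {T : Finset ι} {σ : β} : σ ∈ avoiding Ω A T ↔ σ ∈ Ω ∧ ∀ j ∈ T, ¬A j σ := by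
  simp [avoiding]

open Classical in
lemma card_avoiding_le_add_sum (S T : Finset ι) :
    (avoiding Ω A T).card ≤ (avoiding Ω A (S ∪ T)).card +
      ∑ j ∈ S, ((avoiding Ω A T).filter (A j)).card := by
  have : avoiding Ω A T ⊆ avoiding Ω A (S ∪ T) ∪ S.biUnion fun j => (avoiding Ω A T).filter (A j) := by
    intro σ hσ
    by_cases h : ∃ j ∈ S, A j σ
    · obtain ⟨j, hj, hA⟩ := h
      exact Finset.mem_union_right _ (Finset.mem_biUnion.2 ⟨j, hj, Finset.mem_filter.2 ⟨hσ, hA⟩⟩)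
    · push Not at h
      refine Finset.mem_union_left _ (mem_avoiding.2 ⟨(mem_avoiding.1 hσ).1, fun j hj => ?_⟩)
      rcases Finset.mem_union.1 hj with hj | hj
      exacts [h j hj, (mem_avoiding.1 hσ).2 j hj]
  exact (Finset.card_le_card this).trans ((Finset.card_union_le _ _).trans
    (Nat.add_le_add_left Finset.card_biUnion_le _))

open Classical in
lemma card_filter_avoiding_le {I : Finset ι} {R : ι → ι → Prop} {p x : ι → ℝ}
    (hx : ∀ i ∈ I, 0 ≤ x i)
    (hneg : ∀ i ∈ I, ∀ T ⊆ I, (∀ j ∈ T, ¬R i j) →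
      (((avoiding Ω A T).filter (A i)).card : ℝ) ≤ p i * (avoiding Ω A T).card)
    (hp : ∀ i ∈ I, p i ≤ x i * (1 - ∑ j ∈ I.filter (R i), x j))
    (T : Finset ι) (hT : T ⊆ I) {i : ι} (hi : i ∈ I) :
    (((avoiding Ω A T).filter (A i)).card : ℝ) ≤ x i * (avoiding Ω A T).card := by
  induction T using Finset.strongInduction generalizing i with
  | H T ih =>
    set S := T.filter (R i) with hS
    set U := T.filter fun j => ¬R i j with hU
    have hSU : S ∪ U = T := Finset.filter_union_filter_not_eq _ _
    have hUT : U ⊆ T := Finset.filter_subset _ _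
    have hSI : S ⊆ I.filter (R i) := Finset.filter_subset_filter _ hT
    have h1 : (((avoiding Ω A T).filter (A i)).card : ℝ) ≤ p i * (avoiding Ω A U).card := by
      refine le_trans ?_ (hneg i hi U (hUT.trans hT) fun j hj => (Finset.mem_filter.1 hj).2)
      refine Nat.cast_le.2 (Finset.card_le_card (Finset.filter_subset_filter _ fun σ hσ => ?_))
      exact mem_avoiding.2 ⟨(mem_avoiding.1 hσ).1, fun j hj => (mem_avoiding.1 hσ).2 j (hUT hj)⟩
    have h2 : ∀ j ∈ S, (((avoiding Ω A U).filter (A j)).card : ℝ) ≤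
        x j * (avoiding Ω A U).card := by
      intro j hj
      have hjT := (Finset.mem_filter.1 hj)
      refine ih U (Finset.ssubset_iff_subset_ne.2 ⟨hUT, fun h => ?_⟩) (hUT.trans hT) (hT hjT.1)
      exact (Finset.mem_filter.1 (h ▸ hjT.1 : j ∈ U)).2 hjT.2
    have h3 : ((avoiding Ω A U).card : ℝ) ≤ (avoiding Ω A T).card +
        ∑ j ∈ S, (((avoiding Ω A U).filter (A j)).card : ℝ) := by
      have := card_avoiding_le_add_sum (Ω := Ω) (A := A) S U
      rw [hSU] at this
      exact_mod_cast this
    have h4 : ∑ j ∈ S, x j ≤ ∑ j ∈ I.filter (R i), x j :=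
      Finset.sum_le_sum_of_subset_of_nonneg hSI fun j hj _ => hx j (Finset.mem_filter.1 hj).1
    have h5 := Finset.sum_le_sum h2
    rw [← Finset.sum_mul] at h5
    have hU0 : (0 : ℝ) ≤ (avoiding Ω A U).card := by positivity
    calc _ ≤ p i * (avoiding Ω A U).card := h1
      _ ≤ x i * (1 - ∑ j ∈ I.filter (R i), x j) * (avoiding Ω A U).card := by gcongr; exact hp i hi
      _ = x i * ((1 - ∑ j ∈ I.filter (R i), x j) * (avoiding Ω A U).card) := by ring
      _ ≤ _ := by
        refine mul_le_mul_of_nonneg_left ?_ (hx i hi)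
        nlinarith

open Classical in
lemma prod_mul_card_le_card_avoiding {I : Finset ι} {R : ι → ι → Prop} {p x : ι → ℝ}
    (hx : ∀ i ∈ I, 0 ≤ x i) (hx1 : ∀ i ∈ I, x i ≤ 1)
    (hneg : ∀ i ∈ I, ∀ T ⊆ I, (∀ j ∈ T, ¬R i j) →
      (((avoiding Ω A T).filter (A i)).card : ℝ) ≤ p i * (avoiding Ω A T).card)
    (hp : ∀ i ∈ I, p i ≤ x i * (1 - ∑ j ∈ I.filter (R i), x j)) :
    (∏ i ∈ I, (1 - x i)) * Ω.card ≤ (avoiding Ω A I).card := by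
  have key : ∀ T ⊆ I, (∏ i ∈ T, (1 - x i)) * Ω.card ≤ (avoiding Ω A T).card := by
    intro T
    induction T using Finset.induction_on with
    | empty => intro _; simp [avoiding]
    | insert i T hiT ih =>
      intro hT
      obtain ⟨hi, hT⟩ := Finset.insert_subset_iff.1 hT
      have h1 := card_filter_avoiding_le hx hneg hp T hT hi
      have h2 : ((avoiding Ω A T).card : ℝ) ≤ (avoiding Ω A (insert i T)).card +
          (((avoiding Ω A T).filter (A i)).card : ℝ) := by
        have := card_avoiding_le_add_sum (Ω := Ω) (A := A) {i} T
        rw [Finset.sum_singleton, ← Finset.insert_eq] at this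
        exact_mod_cast this
      rw [Finset.prod_insert hiT, mul_assoc]
      have h3 := mul_le_mul_of_nonneg_left (ih hT) (sub_nonneg.2 (hx1 i hi))
      linarith
  exact key I subset_rfl

end LocalLemma

/-! ### Negative correlation for perfect matchings -/

lemma card_mul_card_filter_le {α : Type*} [Fintype α] [DecidableEq α] (C : Finset (Equiv.Perm α)) (X : Finset α)
    {b b' : α} (hbb : b ≠ b') (hbX : b ∉ X)
    (hC : ∀ σ ∈ C, σ b = b' → ∀ c ∈ X, Equiv.swap b' c * σ * Equiv.swap b' c ∈ C) :
    X.card * (C.filter fun σ => σ b = b').card ≤ C.card := by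
  have h1 : ∀ c ∈ X, (C.filter fun σ => σ b = b').card ≤ (C.filter fun σ => σ b = c).card := by
    intro c hc
    refine Finset.card_le_card_of_injOn (fun σ => Equiv.swap b' c * σ * Equiv.swap b' c) ?_ ?_
    · intro σ hσ
      obtain ⟨hσC, hσ⟩ := Finset.mem_filter.1 hσ
      refine Finset.mem_filter.2 ⟨hC σ hσC hσ c hc, ?_⟩
      have hbc : b ≠ c := fun h => hbX (h ▸ hc)
      simp [Equiv.swap_apply_of_ne_of_ne hbb hbc, hσ]
    · intro σ _ τ _ h
      simpa using h
  calc X.card * (C.filter fun σ => σ b = b').card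
      = ∑ c ∈ X, (C.filter fun σ => σ b = b').card := by simp
    _ ≤ ∑ c ∈ X, (C.filter fun σ => σ b = c).card := Finset.sum_le_sum h1
    _ = (X.biUnion fun c => C.filter fun σ => σ b = c).card := by
        rw [Finset.card_biUnion]
        intro c _ c' _ hcc
        rw [Function.onFun, Finset.disjoint_left]
        intro σ h h'
        exact hcc ((Finset.mem_filter.1 h).2.symm.trans (Finset.mem_filter.1 h').2)
    _ ≤ C.card := Finset.card_le_card
        (Finset.biUnion_subset.2 fun c _ => Finset.filter_subset _ _)

lemma apply_eq_of_swap_conj {α : Type*} [DecidableEq α] {σ : Equiv.Perm α}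
    (hσ : ∀ p, σ (σ p) = p) {b b' c u u' : α} (hb : σ b = b') (hbb : b ≠ b') (hbc : b ≠ c)
    (hub : u ≠ b) (hub' : u ≠ b') (hu'b : u' ≠ b) (hu'b' : u' ≠ b')
    (h : (Equiv.swap b' c * σ * Equiv.swap b' c) u = u') : σ u = u' := by
  have h' : σ (Equiv.swap b' c u) = Equiv.swap b' c u' := by
    rw [← h]; simp
  have hb' : σ b' = b := by rw [← hb, hσ]
  by_cases huc : u = c
  · rw [huc, Equiv.swap_apply_right, hb'] at h'
    have := (Equiv.swap_apply_eq_iff.1 h'.symm)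
    rw [Equiv.swap_apply_of_ne_of_ne hbb hbc] at this
    exact absurd this hu'b
  by_cases huc' : u' = c
  · rw [huc', Equiv.swap_apply_right, Equiv.swap_apply_of_ne_of_ne hub' huc] at h'
    exact absurd (σ.injective (h'.trans hb.symm)) hub
  rwa [Equiv.swap_apply_of_ne_of_ne hub' huc, Equiv.swap_apply_of_ne_of_ne hu'b' huc'] at h'

lemma swap_conj_mem_perfectMatchings {α : Type*} [Fintype α] [DecidableEq α] {σ : Equiv.Perm α}
    (hσ : σ ∈ perfectMatchings Finset.univ) (b c : α) :
    Equiv.swap b c * σ * Equiv.swap b c ∈ perfectMatchings Finset.univ := by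
  rw [mem_perfectMatchings] at hσ ⊢
  refine ⟨fun p => by simp [hσ.1], fun p => ?_⟩
  simp only [Finset.mem_univ, iff_true, Equiv.Perm.coe_mul, Function.comp_apply, ne_eq] at hσ ⊢
  rw [Equiv.swap_apply_eq_iff]
  exact hσ.2 _

/-! ### The proportion of simple matchings is at least `2^{-d²}` -/

/-- A vertex with two of its half-edge labels. -/
abbrev LabelPair (n d : ℕ) := Fin n × (Fin d × Fin d)

/-- The first half-edge of a label pair. -/
def LabelPair.fst {n d : ℕ} (y : LabelPair n d) : Fin n × Fin d := (y.1, y.2.1)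

/-- The second half-edge of a label pair. -/
def LabelPair.snd {n d : ℕ} (y : LabelPair n d) : Fin n × Fin d := (y.1, y.2.2)

/-- The event that a loop (left summand) or a double edge (right summand) is present. -/
def badEvent {n d : ℕ} : LabelPair n d ⊕ LabelPair n d × LabelPair n d →
    Equiv.Perm (Fin n × Fin d) → Prop
  | Sum.inl y, σ => σ y.fst = y.snd
  | Sum.inr e, σ => σ e.1.fst = e.2.fst ∧ σ e.1.snd = e.2.snd

/-- The half-edges involved in a loop or double edge. -/
def badPoints {n d : ℕ} : LabelPair n d ⊕ LabelPair n d × LabelPair n d → Finset (Fin n × Fin d)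
  | Sum.inl y => {y.fst, y.snd}
  | Sum.inr e => {e.1.fst, e.1.snd, e.2.fst, e.2.snd}

/-- The label pairs that can form a loop. -/
def loopIndex (n d : ℕ) : Finset (LabelPair n d) := Finset.univ.filter fun y => y.2.1 < y.2.2

/-- The pairs of label pairs that can form a double edge. -/
def doubleIndex (n d : ℕ) : Finset (LabelPair n d × LabelPair n d) :=
  Finset.univ.filter fun e => e.1.2.1 < e.1.2.2 ∧ e.2.2.1 ≠ e.2.2.2 ∧ e.1.1 ≠ e.2.1

/-- All potential loops and double edges. -/
def badIndex (n d : ℕ) : Finset (LabelPair n d ⊕ LabelPair n d × LabelPair n d) :=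
  (loopIndex n d).disjSum (doubleIndex n d)

/-- The probability bounds for loops and double edges. -/
def badProb (n d : ℕ) : LabelPair n d ⊕ LabelPair n d × LabelPair n d → ℝ
  | Sum.inl _ => 1 / (n * d - 1)
  | Sum.inr _ => 1 / ((n * d - 1) * (n * d - 3))

lemma avoiding_badIndex_subset (n d : ℕ) :
    avoiding (perfectMatchings Finset.univ) badEvent (badIndex n d) ⊆ simpleMatchings n d := by
  intro σ hσ
  obtain ⟨hΩ, hA⟩ := mem_avoiding.1 hσ
  rw [mem_perfectMatchings] at hΩ
  obtain ⟨hinv, hfix⟩ := hΩ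
  have hloop : ∀ p, (σ p).1 ≠ p.1 := by
    rintro ⟨v, i⟩ h
    have hv : σ (v, i) = (v, (σ (v, i)).2) := Prod.ext h rfl
    set j := (σ (v, i)).2
    rcases lt_trichotomy i j with hij | hij | hij
    · exact hA (Sum.inl (v, (i, j))) (by simp [badIndex, loopIndex, hij]) hv
    · exact (hfix (v, i)).2 (Finset.mem_univ _) (by rw [hv, ← hij])
    · refine hA (Sum.inl (v, (j, i))) (by simp [badIndex, loopIndex, hij]) ?_
      change σ (v, j) = (v, i)
      rw [← hv, hinv]
  refine mem_simpleMatchings.2 ⟨hinv, hloop, ?_⟩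
  have hlt : ∀ v i j, i < j → (σ (v, i)).1 ≠ (σ (v, j)).1 := by
    intro v i j hij h
    have hne : σ (v, i) ≠ σ (v, j) := fun h' => hij.ne (Prod.ext_iff.1 (σ.injective h')).2
    refine hA (Sum.inr ((v, (i, j)), ((σ (v, i)).1, ((σ (v, i)).2, (σ (v, j)).2)))) ?_ ⟨rfl, ?_⟩
    · simp only [badIndex, doubleIndex, Finset.inr_mem_disjSum, Finset.mem_filter,
        Finset.mem_univ, true_and]
      exact ⟨hij, fun h' => hne (Prod.ext h h'), (hloop (v, i)).symm⟩
    · exact Prod.ext h.symm rfl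
  rintro ⟨v, i⟩ ⟨w, j⟩ hvw h
  obtain rfl : v = w := hvw
  rcases lt_trichotomy i j with hij | rfl | hij
  · exact absurd h (hlt v i j hij)
  · rfl
  · exact absurd h.symm (hlt v j i hij)

lemma swap_conj_mem_avoiding {n d : ℕ}
    {T : Finset (LabelPair n d ⊕ LabelPair n d × LabelPair n d)}
    {σ : Equiv.Perm (Fin n × Fin d)}
    (hσ : σ ∈ avoiding (perfectMatchings Finset.univ) badEvent T)
    {b b' c : Fin n × Fin d} (hb : σ b = b') (hbb : b ≠ b') (hbc : b ≠ c)
    (hT : ∀ j ∈ T, b ∉ badPoints j ∧ b' ∉ badPoints j) :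
    Equiv.swap b' c * σ * Equiv.swap b' c ∈
      avoiding (perfectMatchings Finset.univ) badEvent T := by
  obtain ⟨hΩ, hA⟩ := mem_avoiding.1 hσ
  have hinv := (mem_perfectMatchings.1 hΩ).1
  refine mem_avoiding.2 ⟨swap_conj_mem_perfectMatchings hΩ _ _, fun j hj h => hA j hj ?_⟩
  obtain ⟨h1, h2⟩ := hT j hj
  have key := fun u u' => apply_eq_of_swap_conj hinv hb hbb hbc (u := u) (u' := u')
  rcases j with y | e
  · simp only [badPoints, Finset.mem_insert, Finset.mem_singleton, not_or] at h1 h2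
    exact key _ _ (Ne.symm h1.1) (Ne.symm h2.1) (Ne.symm h1.2) (Ne.symm h2.2) h
  · simp only [badPoints, Finset.mem_insert, Finset.mem_singleton, not_or] at h1 h2
    exact ⟨key _ _ (Ne.symm h1.1) (Ne.symm h2.1) (Ne.symm h1.2.2.1) (Ne.symm h2.2.2.1) h.1,
      key _ _ (Ne.symm h1.2.1) (Ne.symm h2.2.1) (Ne.symm h1.2.2.2) (Ne.symm h2.2.2.2) h.2⟩

open Classical in
lemma card_badEvent_le {n d : ℕ} (hN : 3 < n * d)
    {i : LabelPair n d ⊕ LabelPair n d × LabelPair n d} (hi : i ∈ badIndex n d)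
    {T : Finset (LabelPair n d ⊕ LabelPair n d × LabelPair n d)}
    (hT : ∀ j ∈ T, Disjoint (badPoints i) (badPoints j)) :
    (((avoiding (perfectMatchings Finset.univ) badEvent T).filter (badEvent i)).card : ℝ) ≤
      badProb n d i * (avoiding (perfectMatchings Finset.univ) badEvent T).card := by
  set C := avoiding (perfectMatchings (Finset.univ : Finset (Fin n × Fin d))) badEvent T with hC
  have hN' : (3 : ℝ) < n * d := by exact_mod_cast hN
  have hT' : ∀ b ∈ badPoints i, ∀ j ∈ T, b ∉ badPoints j := fun b hb j hj =>
    Finset.disjoint_left.1 (hT j hj) hb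
  have hone : ∀ b b', b ≠ b' → b ∈ badPoints i → b' ∈ badPoints i →
      ((n : ℝ) * d - 1) * (C.filter fun σ => σ b = b').card ≤ C.card := by
    intro b b' hbb hb hb'
    have h := card_mul_card_filter_le C (Finset.univ.erase b) hbb (Finset.notMem_erase _ _)
      fun σ hσ hσb c hc => swap_conj_mem_avoiding hσ hσb hbb (Finset.ne_of_mem_erase hc).symm
        fun j hj => ⟨hT' b hb j hj, hT' b' hb' j hj⟩
    have hX : ((Finset.univ.erase b).card : ℝ) = n * d - 1 := by
      rw [Finset.card_erase_of_mem (Finset.mem_univ _), Nat.cast_sub (by simp; omega)]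
      simp
    rw [← hX]
    exact_mod_cast h
  rcases i with y | ⟨y, y'⟩
  · have hlt : y.2.1 < y.2.2 := by simpa [badIndex, loopIndex] using hi
    have hne : y.fst ≠ y.snd := fun h => hlt.ne (Prod.ext_iff.1 h).2
    have h := hone y.fst y.snd hne (by simp [badPoints]) (by simp [badPoints])
    have hfil : C.filter (badEvent (Sum.inl y)) = C.filter fun σ => σ y.fst = y.snd := by
      ext σ
      simp only [Finset.mem_filter]
      rfl
    rw [hfil, badProb, one_div, le_inv_mul_iff₀ (by linarith)]
    exact h
  · have hlt : y.2.1 < y.2.2 ∧ y'.2.1 ≠ y'.2.2 ∧ y.1 ≠ y'.1 := by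
      simpa [badIndex, doubleIndex] using hi
    have ne1 : y.fst ≠ y'.fst := fun h => hlt.2.2 (Prod.ext_iff.1 h).1
    have ne2 : y.snd ≠ y'.snd := fun h => hlt.2.2 (Prod.ext_iff.1 h).1
    have ne3 : y.fst ≠ y'.snd := fun h => hlt.2.2 (Prod.ext_iff.1 h).1
    have ne4 : y.snd ≠ y'.fst := fun h => hlt.2.2 (Prod.ext_iff.1 h).1
    have ne5 : y.fst ≠ y.snd := fun h => hlt.1.ne (Prod.ext_iff.1 h).2
    have ne6 : y'.fst ≠ y'.snd := fun h => hlt.2.1 (Prod.ext_iff.1 h).2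
    have h := hone y.fst y'.fst ne1 (by simp [badPoints]) (by simp [badPoints])
    set C' := C.filter fun σ => σ y.fst = y'.fst with hC'
    have h2 := card_mul_card_filter_le C' (Finset.univ \ {y.fst, y.snd, y'.fst}) ne2 (by simp)
      (by
        intro σ hσ hσb c hc
        obtain ⟨hσC, hσ1⟩ := Finset.mem_filter.1 hσ
        simp only [Finset.mem_sdiff, Finset.mem_univ, Finset.mem_insert, Finset.mem_singleton,
          true_and, not_or] at hc
        refine Finset.mem_filter.2 ⟨swap_conj_mem_avoiding hσC hσb ne2 (Ne.symm hc.2.1)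
          fun j hj => ⟨hT' _ (by simp [badPoints]) j hj, hT' _ (by simp [badPoints]) j hj⟩, ?_⟩
        simp only [Equiv.Perm.coe_mul, Function.comp_apply]
        rw [Equiv.swap_apply_of_ne_of_ne ne3 (Ne.symm hc.1), hσ1,
          Equiv.swap_apply_of_ne_of_ne ne6 (Ne.symm hc.2.2)])
    have hX : ((Finset.univ \ {y.fst, y.snd, y'.fst} : Finset (Fin n × Fin d)).card : ℝ) =
        n * d - 3 := by
      have h3 : ({y.fst, y.snd, y'.fst} : Finset (Fin n × Fin d)).card = 3 :=
        Finset.card_eq_three.2 ⟨_, _, _, ne5, ne1, ne4, rfl⟩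
      rw [Finset.card_sdiff_of_subset (Finset.subset_univ _), h3,
        Nat.cast_sub (by simp; omega)]
      simp
    have h2' : ((n : ℝ) * d - 3) * (C'.filter fun σ => σ y.snd = y'.snd).card ≤ C'.card := by
      rw [← hX]; exact_mod_cast h2
    have hfil : C.filter (badEvent (Sum.inr (y, y'))) =
        C'.filter fun σ => σ y.snd = y'.snd := by
      rw [hC', Finset.filter_filter]
      ext σ
      simp only [Finset.mem_filter]
      rfl
    rw [hfil, badProb, one_div, le_inv_mul_iff₀ (by nlinarith), mul_assoc]
    refine le_trans ?_ h
    exact mul_le_mul_of_nonneg_left h2' (by linarith)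

lemma card_labelPair_touching_le {n d : ℕ} (q : Fin n × Fin d) :
    (Finset.univ.filter fun y : LabelPair n d => q = y.fst ∨ q = y.snd).card ≤ 2 * d := by
  have : (Finset.univ.filter fun y : LabelPair n d => q = y.fst ∨ q = y.snd) ⊆
      (Finset.univ.image fun k => (q.1, (q.2, k))) ∪
        Finset.univ.image fun k => (q.1, (k, q.2)) := by
    rintro ⟨v, i, j⟩ h
    simp only [Finset.mem_filter, Finset.mem_univ, true_and] at h
    rcases h with rfl | rfl <;> simp [LabelPair.fst, LabelPair.snd]
  refine (Finset.card_le_card this).trans ((Finset.card_union_le _ _).trans ?_)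
  have h1 := Finset.card_image_le (s := Finset.univ) (f := fun k : Fin d => (q.1, (q.2, k)))
  have h2 := Finset.card_image_le (s := Finset.univ) (f := fun k : Fin d => (q.1, (k, q.2)))
  simp only [Finset.card_univ, Fintype.card_fin] at h1 h2
  omega

open Classical in
lemma sum_touching_le {n d : ℕ} (hN : 3 < n * d) (q : Fin n × Fin d) :
    ∑ j ∈ (badIndex n d).filter (fun j => q ∈ badPoints j), badProb n d j ≤
      2 * d / (n * d - 1) + 4 * n * d ^ 3 / ((n * d - 1) * (n * d - 3)) := by
  have hN' : (3 : ℝ) < n * d := by exact_mod_cast hN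
  set Q := Finset.univ.filter fun y : LabelPair n d => q = y.fst ∨ q = y.snd with hQ
  have hQc : Q.card ≤ 2 * d := card_labelPair_touching_le q
  have hsub : (badIndex n d).filter (fun j => q ∈ badPoints j) ⊆
      Q.disjSum (Q ×ˢ Finset.univ ∪ Finset.univ ×ˢ Q) := by
    intro j hj
    have hj' := (Finset.mem_filter.1 hj).2
    rcases j with y | ⟨y, y'⟩
    · simp only [badPoints, Finset.mem_insert, Finset.mem_singleton] at hj'
      simpa [hQ] using hj'
    · simp only [badPoints, Finset.mem_insert, Finset.mem_singleton] at hj'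
      simp only [Finset.inr_mem_disjSum, Finset.mem_union, Finset.mem_product, Finset.mem_univ,
        and_true, true_and, hQ, Finset.mem_filter]
      tauto
  have hd1 : (0 : ℝ) < n * d - 1 := by linarith
  have hd3 : (0 : ℝ) < n * d - 3 := by linarith
  have hnn : ∀ j, 0 ≤ badProb n d j := by
    rintro (y | e) <;> simp only [badProb] <;> positivity
  refine (Finset.sum_le_sum_of_subset_of_nonneg hsub fun j _ _ => hnn j).trans ?_
  rw [Finset.sum_disjSum]
  simp only [badProb, Finset.sum_const, nsmul_eq_mul, mul_one_div]
  have hQr : (Q.card : ℝ) ≤ 2 * d := by exact_mod_cast hQc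
  have hP : (((Q ×ˢ Finset.univ ∪ Finset.univ ×ˢ Q).card : ℕ) : ℝ) ≤ 4 * n * d ^ 3 := by
    have h1 := Finset.card_union_le (Q ×ˢ (Finset.univ : Finset (LabelPair n d)))
      ((Finset.univ : Finset (LabelPair n d)) ×ˢ Q)
    simp only [Finset.card_product, Finset.card_univ, Fintype.card_prod, Fintype.card_fin] at h1
    have h2 : (Q ×ˢ Finset.univ ∪ Finset.univ ×ˢ Q).card ≤ 4 * n * d ^ 3 := by
      refine h1.trans ?_
      calc Q.card * (n * (d * d)) + n * (d * d) * Q.card = 2 * (n * (d * d)) * Q.card := by ring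
        _ ≤ 2 * (n * (d * d)) * (2 * d) := by gcongr
        _ = _ := by ring
    exact_mod_cast h2
  gcongr

lemma card_badPoints_le {n d : ℕ} (i : LabelPair n d ⊕ LabelPair n d × LabelPair n d) :
    (badPoints i).card ≤ 4 := by
  rcases i with y | e
  · exact Finset.card_le_two.trans (by norm_num)
  · exact Finset.card_le_four

open Classical in
lemma sum_neighbors_le {n d : ℕ} (hN : 3 < n * d)
    (i : LabelPair n d ⊕ LabelPair n d × LabelPair n d) :
    ∑ j ∈ (badIndex n d).filter (fun j => ¬Disjoint (badPoints i) (badPoints j)),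
        badProb n d j ≤
      4 * (2 * d / (n * d - 1) + 4 * n * d ^ 3 / ((n * d - 1) * (n * d - 3))) := by
  have hN' : (3 : ℝ) < n * d := by exact_mod_cast hN
  have hd1 : (0 : ℝ) < n * d - 1 := by linarith
  have hd3 : (0 : ℝ) < n * d - 3 := by linarith
  have hnn : ∀ j, 0 ≤ badProb n d j := by
    rintro (y | e) <;> simp only [badProb] <;> positivity
  have hsub : (badIndex n d).filter (fun j => ¬Disjoint (badPoints i) (badPoints j)) ⊆
      (badPoints i).biUnion fun q => (badIndex n d).filter (fun j => q ∈ badPoints j) := by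
    intro j hj
    obtain ⟨hj, hd⟩ := Finset.mem_filter.1 hj
    obtain ⟨q, hq, hq'⟩ := Finset.not_disjoint_iff.1 hd
    exact Finset.mem_biUnion.2 ⟨q, hq, Finset.mem_filter.2 ⟨hj, hq'⟩⟩
  have hbi : ∀ S : Finset (Fin n × Fin d),
      ∑ j ∈ S.biUnion (fun q => (badIndex n d).filter (fun j => q ∈ badPoints j)), badProb n d j ≤
        ∑ q ∈ S, ∑ j ∈ (badIndex n d).filter (fun j => q ∈ badPoints j), badProb n d j := by
    intro S
    induction S using Finset.induction_on with
    | empty => simp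
    | insert q S hq ih =>
      rw [Finset.biUnion_insert, Finset.sum_insert hq]
      have := Finset.sum_union_inter
        (s₁ := (badIndex n d).filter (fun j => q ∈ badPoints j))
        (s₂ := S.biUnion fun q => (badIndex n d).filter (fun j => q ∈ badPoints j))
        (f := badProb n d)
      have h0 := Finset.sum_nonneg fun j (_ : j ∈
        ((badIndex n d).filter (fun j => q ∈ badPoints j)) ∩
          S.biUnion fun q => (badIndex n d).filter (fun j => q ∈ badPoints j)) => hnn j
      linarith
  refine (Finset.sum_le_sum_of_subset_of_nonneg hsub fun j _ _ => hnn j).trans ((hbi _).trans ?_)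
  refine (Finset.sum_le_card_nsmul _ _ _ fun q _ => sum_touching_le hN q).trans ?_
  rw [nsmul_eq_mul]
  have : ((badPoints i).card : ℝ) ≤ 4 := by exact_mod_cast card_badPoints_le i
  gcongr

lemma card_filter_lt_mul_two (d : ℕ) :
    2 * ((Finset.univ.filter fun e : Fin d × Fin d => e.1 < e.2).card) = d * (d - 1) := by
  have h : ((Finset.univ : Finset (Fin d)).offDiag).card = d * (d - 1) := by
    rw [Finset.offDiag_card, Finset.card_univ, Fintype.card_fin, Nat.mul_sub_one]
  have hu : (Finset.univ : Finset (Fin d)).offDiag =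
      (Finset.univ.filter fun e : Fin d × Fin d => e.1 < e.2) ∪
        Finset.univ.filter fun e : Fin d × Fin d => e.2 < e.1 := by
    ext e
    simp [Finset.mem_offDiag]
  rw [← h, hu, Finset.card_union_of_disjoint, two_mul]
  · congr 1
    refine Finset.card_bij (fun e _ => e.swap) ?_ ?_ ?_
    · simp
    · intro a _ b _ hab
      exact Prod.swap_injective hab
    · intro b hb
      exact ⟨b.swap, by simpa using hb, by simp⟩
  · rw [Finset.disjoint_left]
    intro e he he'
    simp only [Finset.mem_filter, Finset.mem_univ, true_and] at he he'
    exact he.not_gt he'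

lemma card_loopIndex (n d : ℕ) : 2 * (loopIndex n d).card = n * (d * (d - 1)) := by
  have : loopIndex n d = Finset.univ ×ˢ Finset.univ.filter fun e : Fin d × Fin d => e.1 < e.2 := by
    ext y; simp [loopIndex]
  rw [this, Finset.card_product, ← card_filter_lt_mul_two, Finset.card_univ, Fintype.card_fin]
  ring

lemma card_doubleIndex_le (n d : ℕ) :
    2 * (doubleIndex n d).card ≤ (n * (d * (d - 1))) * (n * (d * (d - 1))) := by
  have : doubleIndex n d ⊆ loopIndex n d ×ˢ (Finset.univ ×ˢ (Finset.univ : Finset (Fin d)).offDiag) := by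
    intro e he
    simp only [doubleIndex, Finset.mem_filter, Finset.mem_univ, true_and] at he
    simp [loopIndex, Finset.mem_offDiag, he.1, he.2.1]
  have h := Finset.card_le_card this
  rw [Finset.card_product, Finset.card_product, Finset.offDiag_card, Finset.card_univ,
    Finset.card_univ, Fintype.card_fin, Fintype.card_fin, ← Nat.mul_sub_one] at h
  rw [← card_loopIndex, mul_assoc]
  rw [card_loopIndex]
  omega

lemma exp_neg_le_one_sub {x : ℝ} (hx0 : 0 ≤ x) (hx1 : x ≤ 1 / 100) :
    Real.exp (-(100 / 99 * x)) ≤ 1 - x := by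
  rw [Real.exp_neg]
  refine inv_le_of_inv_le₀ (by linarith) ?_
  refine le_trans ?_ (Real.add_one_le_exp _)
  rw [inv_le_iff_one_le_mul₀ (by linarith)]
  nlinarith

/-- A fraction at least `2^{-d²}` of all matchings is simple when `n` is large compared with `d`. -/
lemma card_perfectMatchings_le {n d : ℕ} (hd : 3 ≤ d) (hn : 1000 * d ≤ n) :
    ((perfectMatchings (Finset.univ : Finset (Fin n × Fin d))).card : ℝ) ≤
      2 ^ (d ^ 2) * (simpleMatchings n d).card := by
  classical
  have hdr : (3 : ℝ) ≤ d := by exact_mod_cast hd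
  have hnr : 1000 * (d : ℝ) ≤ n := by exact_mod_cast hn
  have hNr : 9000 ≤ (n : ℝ) * d := by nlinarith
  have hN : 3 < n * d := by
    have : 9000 ≤ n * d := by exact_mod_cast hNr
    omega
  have hd1 : (0 : ℝ) < n * d - 1 := by linarith
  have hd3 : (0 : ℝ) < n * d - 3 := by linarith
  have hpd : (n : ℝ) * d / 1.001 ≤ n * d - 1 := by
    rw [div_le_iff₀ (by norm_num)]; linarith
  have hpd3 : (n : ℝ) * d / 1.001 ≤ n * d - 3 := by
    rw [div_le_iff₀ (by norm_num)]; linarith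
  have hprod : ((n : ℝ) * d) ^ 2 / 1.0021 ≤ (n * d - 1) * (n * d - 3) := by
    calc ((n : ℝ) * d) ^ 2 / 1.0021 ≤ (n * d / 1.001) * (n * d / 1.001) := by
          rw [div_mul_div_comm, ← sq]; gcongr; norm_num
      _ ≤ _ := by gcongr
  have hn0 : (0 : ℝ) < n := by linarith
  have hd0 : (0 : ℝ) < d := by linarith
  have hsumN : 4 * (2 * d / (n * d - 1) + 4 * n * d ^ 3 / ((n * d - 1) * (n * d - 3))) ≤
      (4 / 25 : ℝ) := by
    have h1 : 2 * (d : ℝ) / (n * d - 1) ≤ 0.001 := by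
      rw [div_le_iff₀ hd1]; nlinarith
    have h2 : 4 * (n : ℝ) * d ^ 3 / ((n * d - 1) * (n * d - 3)) ≤ 0.0041 := by
      rw [div_le_iff₀ (by positivity)]
      rw [div_le_iff₀ (by norm_num)] at hprod
      have h3 : (1000 : ℝ) * (n * d ^ 3) ≤ (n * d) ^ 2 := by
        have := mul_le_mul_of_nonneg_right hnr (by positivity : 0 ≤ (n : ℝ) * d ^ 2)
        nlinarith
      linarith
    linarith
  have hp0 : ∀ j, 0 ≤ badProb n d j := by
    rintro (y | e) <;> simp only [badProb] <;> positivity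
  have hps : ∀ j, 5 / 4 * badProb n d j ≤ 1 / 100 := by
    rintro (y | e)
    · simp only [badProb]
      rw [← mul_div_assoc, div_le_iff₀ hd1]; linarith
    · simp only [badProb]
      rw [← mul_div_assoc, div_le_iff₀ (by positivity)]; nlinarith
  have hlll := prod_mul_card_le_card_avoiding
    (Ω := perfectMatchings (Finset.univ : Finset (Fin n × Fin d))) (A := badEvent)
    (I := badIndex n d) (R := fun i j => ¬Disjoint (badPoints i) (badPoints j))
    (p := badProb n d) (x := fun j => 5 / 4 * badProb n d j)
    (fun i _ => mul_nonneg (by norm_num) (hp0 i)) (fun i _ => (hps i).trans (by norm_num))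
    (fun i hi T _ hT => card_badEvent_le hN hi fun j hj => not_not.1 (hT j hj))
    (fun i _ => by
      rw [← Finset.mul_sum]
      have h1 := mul_le_mul_of_nonneg_left ((sum_neighbors_le hN i).trans hsumN) (hp0 i)
      rw [Finset.filter_congr_decidable] at h1 ⊢
      linarith)
  have hsum : ∑ j ∈ badIndex n d, badProb n d j ≤ 0.502 * (d : ℝ) ^ 2 := by
    have hdc : ((d * (d - 1) : ℕ) : ℝ) = d * (d - 1) := by
      rw [Nat.cast_mul, Nat.cast_sub (by omega)]; simp
    have h1 : 2 * ((loopIndex n d).card : ℝ) = n * (d * (d - 1)) := by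
      rw [← hdc]; exact_mod_cast card_loopIndex n d
    have h2 : 2 * ((doubleIndex n d).card : ℝ) ≤ (n * (d * (d - 1))) * (n * (d * (d - 1))) := by
      rw [← hdc]; exact_mod_cast card_doubleIndex_le n d
    rw [badIndex, Finset.sum_disjSum]
    simp only [badProb, Finset.sum_const, nsmul_eq_mul, mul_one_div]
    have h3 : ((loopIndex n d).card : ℝ) / (n * d - 1) ≤ 0.50105 * (d - 1) := by
      rw [div_le_iff₀ hd1]
      rw [div_le_iff₀ (by norm_num)] at hpd
      have := mul_le_mul_of_nonneg_right hpd (by linarith : (0 : ℝ) ≤ d - 1)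
      nlinarith
    have h4 : ((doubleIndex n d).card : ℝ) / ((n * d - 1) * (n * d - 3)) ≤
        0.50105 * (d - 1) ^ 2 := by
      rw [div_le_iff₀ (by positivity)]
      rw [div_le_iff₀ (by norm_num)] at hprod
      have := mul_le_mul_of_nonneg_right hprod (by positivity : (0 : ℝ) ≤ (d - 1) ^ 2)
      nlinarith
    nlinarith
  have hprodge : ((2 : ℝ) ^ (d ^ 2))⁻¹ ≤ ∏ i ∈ badIndex n d, (1 - 5 / 4 * badProb n d i) := by
    calc ((2 : ℝ) ^ (d ^ 2))⁻¹ = Real.exp (-(Real.log 2 * (d : ℝ) ^ 2)) := by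
          rw [Real.exp_neg, ← Real.rpow_natCast, Real.rpow_def_of_pos (by norm_num)]
          push_cast; rfl
      _ ≤ Real.exp (∑ i ∈ badIndex n d, -(100 / 99 * (5 / 4 * badProb n d i))) := by
          rw [Real.exp_le_exp, Finset.sum_neg_distrib, ← Finset.mul_sum, ← Finset.mul_sum,
            neg_le_neg_iff]
          have := Real.log_two_gt_d9
          nlinarith [sq_nonneg (d : ℝ)]
      _ = ∏ i ∈ badIndex n d, Real.exp (-(100 / 99 * (5 / 4 * badProb n d i))) := Real.exp_sum _ _
      _ ≤ _ := Finset.prod_le_prod (fun i _ => (Real.exp_pos _).le)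
          fun i _ => exp_neg_le_one_sub (mul_nonneg (by norm_num) (hp0 i)) (hps i)
  have hfin : ((2 : ℝ) ^ (d ^ 2))⁻¹ *
      (perfectMatchings (Finset.univ : Finset (Fin n × Fin d))).card ≤
        (simpleMatchings n d).card := by
    refine (mul_le_mul_of_nonneg_right hprodge (by positivity)).trans (hlll.trans ?_)
    exact Nat.cast_le.2 (Finset.card_le_card (avoiding_badIndex_subset n d))
  rwa [inv_mul_le_iff₀ (by positivity)] at hfin

/-! ### The limit -/

lemma regularAvgM2_nonneg (n d : ℕ) : 0 ≤ regularAvgM2 n d := by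
  refine div_nonneg (Finset.sum_nonneg fun G _ => mul_nonneg (by positivity) ?_) (by positivity)
  exact integral_nonneg fun θ => mul_nonneg (by positivity)
    (Finset.sum_nonneg fun x _ => sq_nonneg _)

lemma regularAvgM2_div_le {n d : ℕ} (hn : Even n) (hd : 3 ≤ d) (hdn : 1000 * d ≤ n) :
    regularAvgM2 n d / 2 ^ (d ^ 2) ≤ 3 + 3 * ∑ j ∈ Finset.range (n + 1), decayTerm n j := by
  obtain ⟨h, hh⟩ := hn
  have hn2 : n = 2 * h := by omega
  have hle := card_perfectMatchings_le hd hdn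
  have hpm : (0 : ℝ) < (perfectMatchings (Finset.univ : Finset (Fin n × Fin d))).card := by
    have h1 := card_perfectMatchings (S := (Finset.univ : Finset (Fin n × Fin d))) (m := h * d) (by
      rw [Finset.card_univ, Fintype.card_prod, Fintype.card_fin, Fintype.card_fin, hn2, mul_assoc])
    have h2 := oddProd_pos (h * d)
    rw [← h1] at h2
    exact_mod_cast h2
  have hs : (0 : ℝ) < (simpleMatchings n d).card := by
    by_contra hcon
    have : (2 : ℝ) ^ (d ^ 2) * (simpleMatchings n d).card ≤ 0 :=
      mul_nonpos_of_nonneg_of_nonpos (by positivity) (not_lt.1 hcon)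
    linarith
  have hmain := regularAvgM2_mul_card_le hn2 hd (Finset.card_pos.1 (by exact_mod_cast hs))
  have hdec : 0 ≤ ∑ j ∈ Finset.range (n + 1), decayTerm n j :=
    Finset.sum_nonneg fun j _ => decayTerm_nonneg n j
  rw [div_le_iff₀ (by positivity)]
  refine le_of_mul_le_mul_right (hmain.trans ?_) hs
  rw [mul_assoc]
  gcongr

lemma eventually_mul_le_of_tendsto_div_sqrt {d : ℕ → ℕ}
    (hd : Filter.Tendsto (fun n => (d n : ℝ) / Real.sqrt n) Filter.atTop (nhds 0)) (K : ℕ) :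
    ∀ᶠ n in Filter.atTop, K * d n ≤ n := by
  have hK : (0 : ℝ) < 1 / (K + 1) := by positivity
  filter_upwards [hd.eventually_lt_const hK, Filter.eventually_ge_atTop 1] with n h1 hn
  have hn' : (1 : ℝ) ≤ n := by exact_mod_cast hn
  have hs : 0 < √(n : ℝ) := Real.sqrt_pos.2 (by linarith)
  rw [div_lt_div_iff₀ hs (by positivity)] at h1
  have hsn : √(n : ℝ) ≤ n := by
    rw [Real.sqrt_le_left (by linarith)]; nlinarith
  have : (K : ℝ) * d n ≤ n := by nlinarith [(d n).cast_nonneg (α := ℝ)]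
  exact_mod_cast this

/-- for `d_n ≥ 3` with `d_n/√n → 0`, along even `n` with `d_n < n`,
`limsup E_{G,θ}[m₂(G,θ)] / 2^{d_n²} ≤ 3` for uniformly random simple `d_n`-regular
graphs. -/
theorem stmt_6 (d : ℕ → ℕ) (hd3 : ∀ n, 3 ≤ d n)
    (hdsub : Filter.Tendsto (fun n => (d n : ℝ) / Real.sqrt n) Filter.atTop (nhds 0)) :
    Filter.limsup (fun n => regularAvgM2 n (d n) / 2 ^ ((d n) ^ 2))
      (Filter.atTop ⊓ Filter.principal {n | Even n ∧ d n < n}) ≤ 3 := by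
  have hev := eventually_mul_le_of_tendsto_div_sqrt hdsub 1000
  have hne : (Filter.atTop ⊓ Filter.principal {n | Even n ∧ d n < n}).NeBot := by
    rw [Filter.inf_principal_neBot_iff]
    intro U hU
    obtain ⟨N, hN⟩ := Filter.mem_atTop_sets.1 (Filter.inter_mem hU hev)
    obtain ⟨h1, h2⟩ := hN (2 * N) (by omega)
    have h2' : 1000 * d (2 * N) ≤ 2 * N := h2
    have := hd3 (2 * N)
    exact ⟨2 * N, h1, even_two_mul N, by omega⟩
  have hlim : Filter.Tendsto (fun n => 3 + 3 * ∑ j ∈ Finset.range (n + 1), decayTerm n j)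
      (Filter.atTop ⊓ Filter.principal {n | Even n ∧ d n < n}) (nhds 3) := by
    have := ((tendsto_sum_decayTerm.const_mul 3).const_add 3).mono_left
      (inf_le_left : Filter.atTop ⊓ Filter.principal {n | Even n ∧ d n < n} ≤ Filter.atTop)
    simpa using this
  rw [← hlim.limsup_eq]
  refine Filter.limsup_le_limsup ?_ ?_ hlim.isBoundedUnder_le
  · filter_upwards [Filter.mem_inf_of_left hev,
      Filter.mem_inf_of_right (Filter.mem_principal_self _)] with n h1 h2
    exact regularAvgM2_div_le h2.1 (hd3 n) h1
  · exact Filter.isCoboundedUnder_le_of_le _ fun n =>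
      div_nonneg (regularAvgM2_nonneg n (d n)) (by positivity)
end
end

section
/- Let n ≥ 1 and let A ⊆ ℂ² be a set of unit vectors such that every unit vector u ∈ ℂ² has some a ∈ A with ‖u − a‖ ≤ ln(3/2)/n (an (ln(3/2)/n)-net of the set of single-qubit states). For α = (α₁,…,α_n) a tuple of unit vectors in ℂ², let v_α ∈ ℂ^{({0,1}^n)} be the product vector v_α(x) = Π_{i=1}^n α_i(x_i). Then for every ψ ∈ ℂ^{({0,1}^n)}: sup over all tuples α of unit vectors of |⟨v_α, ψ⟩|² ≤ 2 · sup over all tuples β with each β_i ∈ A of |⟨v_β, ψ⟩|². -/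
open scoped BigOperators

noncomputable section

section MultilinearNorm

variable {ι E : Type*} [Fintype ι] [NormedAddCommGroup E] [InnerProductSpace ℂ E]

/-- A multilinear form bounded by `M` on tuples of unit vectors is bounded by `M * ∏ i, ‖v i‖`. -/
theorem MultilinearMap.norm_le_mul_prod_of_unit (F : MultilinearMap ℂ (fun _ : ι => E) ℂ) (M : ℝ)
    (hF : ∀ v : ι → E, (∀ i, ‖v i‖ = 1) → ‖F v‖ ≤ M) (v : ι → E) :
    ‖F v‖ ≤ M * ∏ i, ‖v i‖ := by
  by_cases h : ∃ i, v i = 0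
  · obtain ⟨i, hi⟩ := h
    rw [F.map_coord_zero i hi, Finset.prod_eq_zero (Finset.mem_univ i) (by simp [hi])]
    simp
  · push Not at h
    have hn : ∀ i, ‖v i‖ ≠ 0 := fun i => norm_ne_zero_iff.2 (h i)
    have hv : v = fun i => ((‖v i‖ : ℝ) : ℂ) • ((((‖v i‖ : ℝ) : ℂ)⁻¹) • v i) := by
      funext i
      rw [smul_smul, mul_inv_cancel₀ (by exact_mod_cast hn i), one_smul]
    have hb := hF (fun i => (((‖v i‖ : ℝ) : ℂ)⁻¹) • v i) (fun i => by
      rw [norm_smul, norm_inv, Complex.norm_real, norm_norm, inv_mul_cancel₀ (hn i)])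
    conv_lhs => rw [hv]
    rw [F.map_smul_univ, norm_smul, norm_prod, mul_comm]
    simp only [Complex.norm_real, norm_norm]
    gcongr

/-- At a norming unit vector `a` of a linear form `l` of norm at most `M`, moving to another unit
vector `b` decreases the real part of `l` by at most `M * ‖b - a‖ ^ 2 / 2`. -/
theorem LinearMap.neg_le_re_map_sub_of_norming (l : E →ₗ[ℂ] ℂ) {M : ℝ} (hM : 0 ≤ M)
    (hl : ∀ v, ‖l v‖ ≤ M * ‖v‖) {a b : E} (ha : ‖a‖ = 1) (hb : ‖b‖ = 1) (hla : l a = M) :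
    -(M * (‖b - a‖ ^ 2 / 2)) ≤ (l (b - a)).re := by
  set d := b - a with hd
  have hinner : 2 * RCLike.re (inner ℂ a d) = -‖d‖ ^ 2 := by
    have h := norm_add_sq (𝕜 := ℂ) a d
    rw [hd, add_sub_cancel, ← hd, ha, hb] at h
    linarith
  have key : ∀ t : ℝ, 0 < t → -(l d).re ≤ M * (‖d‖ ^ 2 / 2) + t * (M * (‖d‖ ^ 2 / 2)) := by
    intro t ht
    have h1 : ‖a - (t : ℂ) • d‖ ^ 2 = 1 + t * ‖d‖ ^ 2 + t ^ 2 * ‖d‖ ^ 2 := by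
      rw [norm_sub_sq (𝕜 := ℂ), inner_smul_right, norm_smul, ha, Complex.norm_real, mul_pow,
        Real.norm_eq_abs, sq_abs]
      have h2 : RCLike.re ((t : ℂ) * inner ℂ a d) = t * RCLike.re (inner ℂ a d) := by simp
      rw [h2]
      linear_combination (-t) * hinner
    have h3 : ‖a - (t : ℂ) • d‖ ≤ 1 + (t + t ^ 2) * (‖d‖ ^ 2 / 2) := by
      refine abs_le_of_sq_le_sq' ?_ (by positivity) |>.2
      rw [h1]
      nlinarith [sq_nonneg ((t + t ^ 2) * (‖d‖ ^ 2 / 2))]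
    have h4 : M - t * (l d).re ≤ M * (1 + (t + t ^ 2) * (‖d‖ ^ 2 / 2)) := by
      have h5 := (Complex.re_le_norm _).trans (hl (a - (t : ℂ) • d))
      have h6 : (l (a - (t : ℂ) • d)).re = M - t * (l d).re := by
        simp [map_sub, hla]
      rw [h6] at h5
      exact h5.trans (mul_le_mul_of_nonneg_left h3 hM)
    refine le_of_mul_le_mul_left ?_ ht
    linarith
  have hlim : -(l d).re ≤ M * (‖d‖ ^ 2 / 2) := by
    refine le_of_forall_pos_le_add fun e he => ?_
    set K := M * (‖d‖ ^ 2 / 2) with hK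
    have hK0 : 0 ≤ K := by positivity
    have h := key (e / (K + 1)) (by positivity)
    have h7 : e / (K + 1) * K ≤ e := by
      rw [div_mul_eq_mul_div, div_le_iff₀ (by positivity)]
      nlinarith
    linarith
  linarith

variable [DecidableEq ι] (F : MultilinearMap ℂ (fun _ : ι => E) ℂ) {M ε : ℝ} {a b : ι → E}

/-- At a norming tuple `a`, the variation of `F` in coordinate `i` has small real part, also after
the coordinates in `s` have been replaced by those of a tuple `b` close to `a`. -/
theorem MultilinearMap.neg_le_re_update_piecewise (hM : 0 ≤ M)
    (hF : ∀ v : ι → E, ‖F v‖ ≤ M * ∏ i, ‖v i‖) (ha : ∀ i, ‖a i‖ = 1) (hb : ∀ i, ‖b i‖ = 1)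
    (hFa : F a = M) (hab : ∀ i, ‖b i - a i‖ ≤ ε) (i : ι) (s : Finset ι) (hi : i ∉ s) :
    -(M * (ε ^ 2 / 2 + s.card * ε ^ 2)) ≤
      (F (Function.update (s.piecewise b a) i (b i - a i))).re := by
  have hε : 0 ≤ ε := (norm_nonneg _).trans (hab i)
  induction s using Finset.induction_on with
  | empty =>
    have h := (F.toLinearMap a i).neg_le_re_map_sub_of_norming hM (a := a i) (b := b i)
      (fun v => by
        refine (hF _).trans_eq ?_
        congr 1
        rw [Finset.prod_eq_single i]
        · simp
        · intro j _ hj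
          simp [hj, ha]
        · simp) (ha i) (hb i) (by simp [hFa])
    have h2 : ‖b i - a i‖ ^ 2 ≤ ε ^ 2 := pow_le_pow_left₀ (norm_nonneg _) (hab i) 2
    have h3 : M * (‖b i - a i‖ ^ 2 / 2) ≤ M * (ε ^ 2 / 2) := by gcongr
    simp only [Finset.piecewise_empty, Finset.card_empty, Nat.cast_zero, zero_mul, add_zero]
    simp only [MultilinearMap.toLinearMap_apply] at h
    linarith
  | insert j s hj ih =>
    have hij : i ≠ j := fun h => hi (h ▸ Finset.mem_insert_self j s)
    have ih := ih fun h => hi (Finset.mem_insert_of_mem h)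
    set w := s.piecewise b a with hw
    have hwj : w j = a j := by simp [hw, hj]
    have hw1 : ∀ k, ‖w k‖ = 1 := fun k => by
      by_cases hk : k ∈ s <;> simp [hw, hk, ha, hb]
    have hstep : F (Function.update ((insert j s).piecewise b a) i (b i - a i)) =
        F (Function.update w i (b i - a i)) +
          F (Function.update (Function.update w i (b i - a i)) j (b j - a j)) := by
      rw [Finset.piecewise_insert, Function.update_comm hij.symm, ← hw]
      generalize b i - a i = d
      have hself : Function.update (Function.update w i d) j (a j) = Function.update w i d := by
        rw [Function.update_eq_self_iff]
        simp [hij.symm, hwj]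
      rw [F.map_update_sub, hself]
      ring
    have hsecond : ‖F (Function.update (Function.update w i (b i - a i)) j (b j - a j))‖ ≤
        M * ε ^ 2 := by
      refine (hF _).trans ?_
      have hprod : ∏ k, ‖Function.update (Function.update w i (b i - a i)) j (b j - a j) k‖ =
          ‖b i - a i‖ * ‖b j - a j‖ := by
        rw [← Finset.prod_subset (Finset.subset_univ {i, j}), Finset.prod_pair hij]
        · simp [hij]
        · intro k _ hk
          simp only [Finset.mem_insert, Finset.mem_singleton, not_or] at hk
          simp [hk.1, hk.2, hw1]
      rw [hprod, sq]
      exact mul_le_mul_of_nonneg_left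
        (mul_le_mul (hab i) (hab j) (norm_nonneg _) hε) hM
    have hre := (abs_le.1 ((Complex.abs_re_le_norm _).trans hsecond)).1
    rw [hstep, Complex.add_re, Finset.card_insert_of_notMem hj]
    push_cast
    linarith

/-- If `a` is a tuple of unit vectors at which a multilinear form `F` attains its norm `M`, then
perturbing `a` by `ε` in the coordinates in `s` costs only a quadratic relative error. -/
theorem MultilinearMap.mul_one_sub_le_re_piecewise (hM : 0 ≤ M)
    (hF : ∀ v : ι → E, ‖F v‖ ≤ M * ∏ i, ‖v i‖) (ha : ∀ i, ‖a i‖ = 1) (hb : ∀ i, ‖b i‖ = 1)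
    (hFa : F a = M) (hab : ∀ i, ‖b i - a i‖ ≤ ε) (s : Finset ι) :
    M * (1 - (s.card * ε) ^ 2 / 2) ≤ (F (s.piecewise b a)).re := by
  induction s using Finset.induction_on with
  | empty => simp [hFa]
  | insert i s hi ih =>
    have h := F.neg_le_re_update_piecewise hM hF ha hb hFa hab i s hi
    have hself : Function.update (s.piecewise b a) i (a i) = s.piecewise b a := by
      rw [Function.update_eq_self_iff]
      simp [hi]
    rw [F.map_update_sub, hself, ← Finset.piecewise_insert, Complex.sub_re] at h
    rw [Finset.card_insert_of_notMem hi]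
    push_cast
    linarith

/-- If a multilinear form attains its maximal modulus over tuples of unit vectors at `a`, then
its modulus at an `ε`-close tuple of unit vectors is almost as large. -/
theorem MultilinearMap.mul_one_sub_le_norm_of_isMax
    (hmax : ∀ v : ι → E, (∀ i, ‖v i‖ = 1) → ‖F v‖ ≤ ‖F a‖)
    (ha : ∀ i, ‖a i‖ = 1) (hb : ∀ i, ‖b i‖ = 1) (hab : ∀ i, ‖b i - a i‖ ≤ ε) :
    ‖F a‖ * (1 - (Fintype.card ι * ε) ^ 2 / 2) ≤ ‖F b‖ := by
  by_cases h0 : F a = 0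
  · simp [h0]
  have hne : ((‖F a‖ : ℝ) : ℂ) ≠ 0 := by exact_mod_cast norm_ne_zero_iff.2 h0
  set c : ℂ := ‖F a‖ / F a with hc
  have hc1 : ‖c‖ = 1 := by
    rw [hc, norm_div, Complex.norm_real, norm_norm, div_self (norm_ne_zero_iff.2 h0)]
  have hnorm : ∀ v, ‖(c • F) v‖ = ‖F v‖ := fun v => by
    rw [smul_apply, norm_smul, hc1, one_mul]
  have h := (c • F).mul_one_sub_le_re_piecewise (norm_nonneg (F a))
    (fun v => by
      rw [hnorm]
      exact F.norm_le_mul_prod_of_unit _ hmax v) ha hb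
    (by rw [smul_apply, smul_eq_mul, hc, div_mul_cancel₀ _ h0]) hab Finset.univ
  rw [Finset.piecewise_univ, Finset.card_univ] at h
  exact h.trans ((Complex.re_le_norm _).trans_eq (hnorm b))

end MultilinearNorm

/-- The multilinear form sending a tuple `v` of single-qubit vectors to `⟨ψ, ⊗ᵢ vᵢ⟩`. -/
def productOverlap {n : ℕ} (ψ : (Fin n → Bool) → ℂ) :
    MultilinearMap ℂ (fun _ : Fin n => EuclideanSpace ℂ Bool) ℂ :=
  ∑ x : Fin n → Bool, (starRingEnd ℂ) (ψ x) •
    (MultilinearMap.mkPiAlgebra ℂ (Fin n) ℂ).compLinearMap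
      (fun i => (EuclideanSpace.proj (𝕜 := ℂ) (x i)).toLinearMap)

theorem productOverlap_apply {n : ℕ} (ψ : (Fin n → Bool) → ℂ)
    (v : Fin n → EuclideanSpace ℂ Bool) :
    productOverlap ψ v = ∑ x : Fin n → Bool, (starRingEnd ℂ) (ψ x) * ∏ i, v i (x i) := by
  simp [productOverlap]

theorem normSq_sum_conj_prod_mul {n : ℕ} (ψ : (Fin n → Bool) → ℂ) (α : Fin n → Bool → ℂ) :
    Complex.normSq (∑ x : Fin n → Bool, (starRingEnd ℂ) (∏ i, α i (x i)) * ψ x) =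
      ‖productOverlap ψ (fun i => WithLp.toLp 2 (α i))‖ ^ 2 := by
  rw [← Complex.normSq_eq_norm_sq, productOverlap_apply, ← Complex.normSq_conj]
  congr 1
  simp [map_sum, mul_comm]

theorem norm_toLp_eq_sqrt_sum_normSq (u : Bool → ℂ) :
    ‖WithLp.toLp 2 u‖ = Real.sqrt (∑ b : Bool, Complex.normSq (u b)) := by
  rw [EuclideanSpace.norm_eq]
  simp [Complex.normSq_eq_norm_sq]

theorem norm_toLp_eq_one_iff (u : Bool → ℂ) :
    ‖WithLp.toLp 2 u‖ = 1 ↔ ∑ b : Bool, Complex.normSq (u b) = 1 := by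
  rw [norm_toLp_eq_sqrt_sum_normSq, Real.sqrt_eq_one]

theorem exists_isMax_productOverlap {n : ℕ} (ψ : (Fin n → Bool) → ℂ) :
    ∃ a : Fin n → EuclideanSpace ℂ Bool, (∀ i, ‖a i‖ = 1) ∧
      ∀ v : Fin n → EuclideanSpace ℂ Bool, (∀ i, ‖v i‖ = 1) →
        ‖productOverlap ψ v‖ ≤ ‖productOverlap ψ a‖ := by
  have hK : IsCompact (Set.univ.pi fun _ : Fin n => Metric.sphere (0 : EuclideanSpace ℂ Bool) 1) :=
    isCompact_univ_pi fun _ => isCompact_sphere _ _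
  have hcont : Continuous fun v : Fin n → EuclideanSpace ℂ Bool => ‖productOverlap ψ v‖ := by
    simp only [productOverlap_apply]
    fun_prop
  obtain ⟨a, ha, hmax⟩ := hK.exists_isMaxOn
    ⟨fun _ => EuclideanSpace.single true 1, fun i _ => by simp⟩ hcont.continuousOn
  exact ⟨a, fun i => by simpa using ha i trivial, fun v hv => hmax fun i _ => by simpa using hv i⟩

/-- if `A` is an `(ln(3/2)/n)`-net of the unit vectors of `ℂ²` (vectors
indexed by `Bool`), then for every `ψ : ℂ^{({0,1}^n)}`, the supremum of `|⟨v_α, ψ⟩|²`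
over tuples `α` of unit vectors (with `v_α(x) = Π_i α_i(x_i)`) is at most twice the
supremum over tuples `β` with every `β_i ∈ A`. -/
theorem stmt_12 (n : ℕ) (hn : 1 ≤ n) (A : Set (Bool → ℂ))
    (hA : ∀ a ∈ A, ∑ b : Bool, Complex.normSq (a b) = 1)
    (hnet : ∀ u : Bool → ℂ, (∑ b : Bool, Complex.normSq (u b)) = 1 →
      ∃ a ∈ A, Real.sqrt (∑ b : Bool, Complex.normSq (u b - a b)) ≤ Real.log (3 / 2) / n)
    (ψ : (Fin n → Bool) → ℂ) :
    sSup {t : ℝ | ∃ α : Fin n → Bool → ℂ,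
        (∀ i, ∑ b : Bool, Complex.normSq (α i b) = 1) ∧
        t = Complex.normSq
          (∑ x : Fin n → Bool, (starRingEnd ℂ) (∏ i, α i (x i)) * ψ x)} ≤
      2 * sSup {t : ℝ | ∃ β : Fin n → Bool → ℂ, (∀ i, β i ∈ A) ∧
        t = Complex.normSq
          (∑ x : Fin n → Bool, (starRingEnd ℂ) (∏ i, β i (x i)) * ψ x)} := by
  obtain ⟨a, ha, hmax⟩ := exists_isMax_productOverlap ψ
  choose! f hfA hf using hnet
  have ha' : ∀ i, ∑ b : Bool, Complex.normSq (a i b) = 1 := fun i =>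
    (norm_toLp_eq_one_iff _).1 (ha i)
  have hn0 : (n : ℝ) ≠ 0 := by positivity
  have hle : ∀ α : Fin n → Bool → ℂ, (∀ i, ∑ b : Bool, Complex.normSq (α i b) = 1) →
      Complex.normSq (∑ x : Fin n → Bool, (starRingEnd ℂ) (∏ i, α i (x i)) * ψ x) ≤
        ‖productOverlap ψ a‖ ^ 2 := fun α hα => by
    rw [normSq_sum_conj_prod_mul]
    exact pow_le_pow_left₀ (norm_nonneg _)
      (hmax _ fun i => (norm_toLp_eq_one_iff _).2 (hα i)) 2
  set β : Fin n → Bool → ℂ := fun i => f (a i) with hβ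
  have hβA : ∀ i, β i ∈ A := fun i => hfA _ (ha' i)
  have hgap := (productOverlap ψ).mul_one_sub_le_norm_of_isMax (ε := Real.log (3 / 2) / n)
    (b := fun i => WithLp.toLp 2 (β i)) hmax ha
    (fun i => (norm_toLp_eq_one_iff _).2 (hA _ (hβA i)))
    (fun i => by
      rw [norm_sub_rev]
      exact (norm_toLp_eq_sqrt_sum_normSq (fun b => a i b - β i b)).trans_le (hf _ (ha' i)))
  rw [Fintype.card_fin, mul_div_cancel₀ _ hn0] at hgap
  have hlog : Real.log (3 / 2) ≤ 1 / 2 := by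
    linarith [Real.log_le_sub_one_of_pos (show (0 : ℝ) < 3 / 2 by norm_num)]
  have hlog0 : 0 ≤ Real.log (3 / 2) := Real.log_nonneg (by norm_num)
  have hgap' : ‖productOverlap ψ a‖ * (7 / 8) ≤
      ‖productOverlap ψ fun i => WithLp.toLp 2 (β i)‖ :=
    (mul_le_mul_of_nonneg_left (by nlinarith) (norm_nonneg _)).trans hgap
  have hsq := pow_le_pow_left₀ (by positivity) hgap' 2
  have hβsup := le_csSup (a := ‖productOverlap ψ fun i => WithLp.toLp 2 (β i)‖ ^ 2)
    (s := {t : ℝ | ∃ β : Fin n → Bool → ℂ, (∀ i, β i ∈ A) ∧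
        t = Complex.normSq
          (∑ x : Fin n → Bool, (starRingEnd ℂ) (∏ i, β i (x i)) * ψ x)})
    ⟨_, by
      rintro t ⟨γ, hγ, rfl⟩
      exact hle γ fun i => hA _ (hγ i)⟩
    ⟨β, hβA, (normSq_sum_conj_prod_mul ψ β).symm⟩
  refine le_trans (b := ‖productOverlap ψ a‖ ^ 2)
    (csSup_le ⟨_, ⟨fun i => a i, ha', rfl⟩⟩ ?_) ?_
  · rintro t ⟨α, hα, rfl⟩
    exact hle α hα
  · nlinarith [sq_nonneg ‖productOverlap ψ a‖]
end
end

section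
/- Let S_n be the set of n × n symmetric matrices over 𝔽₂ with zero diagonal (adjacency matrices), so |S_n| = 2^{n(n−1)/2}. For every integer h with 0 ≤ h ≤ ⌊n/2⌋, the fraction of matrices in S_n of rank exactly 2h satisfies (e^{-2}/4) · 2^{-(n−2h)²/2} · 2^{(n−2h)/2} ≤ |{A ∈ S_n : rank(A) = 2h}| / |S_n| ≤ e^{2/3} · 2^{-(n−2h)²/2} · 2^{(n−2h)/2}. -/
open scoped BigOperators

noncomputable section

/-- The set `S_n` of `n × n` symmetric matrices over `𝔽₂` with zero diagonal
(adjacency matrices). -/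
def symZeroDiag (n : ℕ) : Finset (Matrix (Fin n) (Fin n) (ZMod 2)) :=
  Finset.univ.filter fun A => A.IsSymm ∧ ∀ i, A i i = 0

open Classical in
/-- The probability of the event `p` under the uniform distribution on `S_n` (the
fraction of matrices in `S_n` satisfying `p`). -/
def symProb (n : ℕ) (p : Matrix (Fin n) (Fin n) (ZMod 2) → Prop) : ℝ :=
  (((symZeroDiag n).filter p).card : ℝ) / ((symZeroDiag n).card : ℝ)

/-- The principal submatrix `A[S]` of `A` on the rows and columns indexed by `S`. -/
def principalSub {n : ℕ} (A : Matrix (Fin n) (Fin n) (ZMod 2)) (S : Finset (Fin n)) :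
    Matrix ↥S ↥S (ZMod 2) :=
  A.submatrix (fun i => (i : Fin n)) (fun j => (j : Fin n))

theorem rank_vecCons_of_mem {K : Type*} [Field K] {m n : ℕ} {v : Fin n → K}
    {A : Matrix (Fin m) (Fin n) K} (hv : v ∈ Submodule.span K (Set.range A.row)) :
    (Matrix.of (Matrix.vecCons v A)).rank = A.rank := by
  have hr : Set.range (Matrix.of (Matrix.vecCons v A)).row = insert v (Set.range A.row) :=
    Fin.range_cons v A
  rw [Matrix.rank_eq_finrank_span_row, Matrix.rank_eq_finrank_span_row, hr,
    Submodule.span_insert_eq_span hv]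

theorem rank_vecCons_of_notMem {K : Type*} [Field K] {m n : ℕ} {v : Fin n → K}
    {A : Matrix (Fin m) (Fin n) K} (hv : v ∉ Submodule.span K (Set.range A.row)) :
    (Matrix.of (Matrix.vecCons v A)).rank = A.rank + 1 := by
  have hr : Set.range (Matrix.of (Matrix.vecCons v A)).row = insert v (Set.range A.row) :=
    Fin.range_cons v A
  rw [Matrix.rank_eq_finrank_span_row, Matrix.rank_eq_finrank_span_row, hr,
    Submodule.span_insert, sup_comm, Submodule.finrank_sup_span_singleton hv]

/-- The square matrix obtained from `A` by prepending the row and the column `(0, b)`. -/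
def border {R : Type*} [Zero R] {n : ℕ} (b : Fin n → R) (A : Matrix (Fin n) (Fin n) R) :
    Matrix (Fin (n + 1)) (Fin (n + 1)) R :=
  Matrix.of (Matrix.vecCons (Matrix.vecCons 0 b) fun i => Matrix.vecCons (b i) (A i))

theorem mem_symZeroDiag {n : ℕ} {A : Matrix (Fin n) (Fin n) (ZMod 2)} :
    A ∈ symZeroDiag n ↔ A.IsSymm ∧ ∀ i, A i i = 0 := by
  simp [symZeroDiag]

theorem border_mem_symZeroDiag {n : ℕ} {A : Matrix (Fin n) (Fin n) (ZMod 2)}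
    (hA : A ∈ symZeroDiag n) (b : Fin n → ZMod 2) : border b A ∈ symZeroDiag (n + 1) := by
  obtain ⟨hs, hd⟩ := mem_symZeroDiag.1 hA
  refine mem_symZeroDiag.2 ⟨Matrix.IsSymm.ext fun i j => ?_, fun i => ?_⟩
  · refine Fin.cases ?_ (fun i => ?_) i <;> refine Fin.cases ?_ (fun j => ?_) j <;>
      simp [border, hs.apply]
  · refine Fin.cases ?_ (fun i => ?_) i <;> simp [border, hd]

theorem sum_mul_eq_zero_of_mem_symZeroDiag {n : ℕ} {A : Matrix (Fin n) (Fin n) (ZMod 2)}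
    (hA : A ∈ symZeroDiag n) (x : Fin n → ZMod 2) : ∑ i, ∑ j, x i * (x j * A j i) = 0 := by
  obtain ⟨hs, hd⟩ := mem_symZeroDiag.1 hA
  rw [← Finset.sum_product']
  refine Finset.sum_involution (fun p _ => p.swap) (fun p _ => ?_) (fun p _ hp h => hp ?_)
    (by simp) (by simp)
  · rw [Prod.fst_swap, Prod.snd_swap, hs.apply p.2 p.1, mul_left_comm]
    exact CharTwo.add_self_eq_zero _
  · have : p.2 = p.1 := congrArg Prod.fst h
    simp [this, hd]

theorem cons_zero_mem_span_iff {n : ℕ} {A : Matrix (Fin n) (Fin n) (ZMod 2)}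
    (hA : A ∈ symZeroDiag n) (b : Fin n → ZMod 2) :
    Matrix.vecCons 0 b ∈ Submodule.span (ZMod 2)
        (Set.range (Matrix.of fun i => Matrix.vecCons (b i) (A i)).row) ↔
      b ∈ Submodule.span (ZMod 2) (Set.range A.row) := by
  rw [Submodule.mem_span_range_iff_exists_fun, Submodule.mem_span_range_iff_exists_fun]
  refine exists_congr fun x => ⟨fun h => funext fun j => ?_, fun h => funext fun j => ?_⟩
  · simpa [Finset.sum_apply] using congrFun h j.succ
  · have hb (i : Fin n) : b i = ∑ j, x j * A j i := by simp [← h, Finset.sum_apply]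
    refine Fin.cases ?_ (fun j => ?_) j
    · rw [← sum_mul_eq_zero_of_mem_symZeroDiag hA x]
      simp [Finset.sum_apply, hb, Finset.mul_sum]
    · simp [Finset.sum_apply, hb]

theorem rank_cons_col {n : ℕ} {A : Matrix (Fin n) (Fin n) (ZMod 2)}
    (hA : A.IsSymm) (b : Fin n → ZMod 2) :
    (Matrix.of fun i => Matrix.vecCons (b i) (A i)).rank =
      (Matrix.of (Matrix.vecCons b A)).rank := by
  rw [← Matrix.rank_transpose]
  congr 1
  ext i j
  refine Fin.cases ?_ (fun i => ?_) i
  · rfl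
  · exact hA.apply i j

theorem rank_border_of_mem {n : ℕ} {A : Matrix (Fin n) (Fin n) (ZMod 2)}
    (hA : A ∈ symZeroDiag n) {b : Fin n → ZMod 2}
    (hb : b ∈ Submodule.span (ZMod 2) (Set.range A.row)) : (border b A).rank = A.rank := by
  rw [← rank_vecCons_of_mem hb, ← rank_cons_col (mem_symZeroDiag.1 hA).1]
  exact rank_vecCons_of_mem ((cons_zero_mem_span_iff hA b).2 hb)

theorem rank_border_of_notMem {n : ℕ} {A : Matrix (Fin n) (Fin n) (ZMod 2)}
    (hA : A ∈ symZeroDiag n) {b : Fin n → ZMod 2}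
    (hb : b ∉ Submodule.span (ZMod 2) (Set.range A.row)) : (border b A).rank = A.rank + 2 := by
  have h := rank_vecCons_of_notMem hb
  rw [← rank_cons_col (mem_symZeroDiag.1 hA).1] at h
  have h' := rank_vecCons_of_notMem (mt (cons_zero_mem_span_iff hA b).1 hb)
  rw [h] at h'
  exact h'

theorem card_filter_symZeroDiag_succ (n : ℕ)
    (p : Matrix (Fin (n + 1)) (Fin (n + 1)) (ZMod 2) → Prop) [DecidablePred p] :
    ((symZeroDiag (n + 1)).filter p).card =
      ∑ A ∈ symZeroDiag n, (Finset.univ.filter fun b => p (border b A)).card := by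
  rw [← Finset.card_sigma]
  symm
  refine Finset.card_bij (fun x _ => border x.2 x.1) (fun x hx => ?_) (fun x _ y _ h => ?_)
    fun M hM => ?_
  · simp only [Finset.mem_sigma, Finset.mem_filter, Finset.mem_univ, true_and] at hx
    exact Finset.mem_filter.2 ⟨border_mem_symZeroDiag hx.1 _, hx.2⟩
  · obtain ⟨A, b⟩ := x
    obtain ⟨A', b'⟩ := y
    have hA : A = A' := by
      ext i j
      simpa [border] using congrFun (congrFun h i.succ) j.succ
    have hb : b = b' := by
      ext j
      simpa [border] using congrFun (congrFun h 0) j.succ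
    rw [hA, hb]
  · obtain ⟨hM, hp⟩ := Finset.mem_filter.1 hM
    obtain ⟨hs, hd⟩ := mem_symZeroDiag.1 hM
    have hborder : border (fun j => M 0 j.succ) (M.submatrix Fin.succ Fin.succ) = M := by
      ext i j
      refine Fin.cases ?_ (fun i => ?_) i <;> refine Fin.cases ?_ (fun j => ?_) j <;>
        simp [border, hd, hs.apply]
    refine ⟨⟨M.submatrix Fin.succ Fin.succ, fun j => M 0 j.succ⟩, ?_, hborder⟩
    simp only [Finset.mem_sigma, Finset.mem_filter, Finset.mem_univ, true_and]
    exact ⟨mem_symZeroDiag.2 ⟨hs.submatrix _, fun i => hd _⟩, hborder.symm ▸ hp⟩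

open Classical in
theorem card_filter_mem_span_row {n : ℕ} (A : Matrix (Fin n) (Fin n) (ZMod 2)) :
    (Finset.univ.filter fun b => b ∈ Submodule.span (ZMod 2) (Set.range A.row)).card =
      2 ^ A.rank := by
  rw [Matrix.rank_eq_finrank_span_row, ← Fintype.card_subtype]
  have h := Module.card_eq_pow_finrank (K := ZMod 2)
    (V := Submodule.span (ZMod 2) (Set.range A.row))
  rw [ZMod.card] at h
  rw [← h]

theorem card_filter_rank_border {n : ℕ} {A : Matrix (Fin n) (Fin n) (ZMod 2)}
    (hA : A ∈ symZeroDiag n) (k : ℕ) :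
    ((Finset.univ.filter fun b => (border b A).rank = k).card : ℝ) =
      (if A.rank = k then 2 ^ k else 0) + if A.rank + 2 = k then 2 ^ n - 2 ^ A.rank else 0 := by
  classical
  have hcompl : ((Finset.univ.filter fun b : Fin n → ZMod 2 =>
      b ∉ Submodule.span (ZMod 2) (Set.range A.row)).card : ℝ) = 2 ^ n - 2 ^ A.rank := by
    have h := Finset.card_filter_add_card_filter_not (s := (Finset.univ : Finset (Fin n → ZMod 2)))
      (fun b => b ∈ Submodule.span (ZMod 2) (Set.range A.row))
    rw [card_filter_mem_span_row, Finset.card_univ, Fintype.card_fun, ZMod.card,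
      Fintype.card_fin] at h
    rw [eq_sub_iff_add_eq']
    exact_mod_cast h
  by_cases h1 : A.rank = k
  · have h2 : ¬ A.rank + 2 = k := by omega
    have : ∀ b, (border b A).rank = k ↔ b ∈ Submodule.span (ZMod 2) (Set.range A.row) := by
      intro b
      by_cases hb : b ∈ Submodule.span (ZMod 2) (Set.range A.row)
      · simp [hb, rank_border_of_mem hA hb, h1]
      · simp [hb, rank_border_of_notMem hA hb, h2]
    simp only [this, card_filter_mem_span_row, h1]
    simp
  · by_cases h2 : A.rank + 2 = k
    · have : ∀ b, (border b A).rank = k ↔ b ∉ Submodule.span (ZMod 2) (Set.range A.row) := by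
        intro b
        by_cases hb : b ∈ Submodule.span (ZMod 2) (Set.range A.row)
        · simp [hb, rank_border_of_mem hA hb, h1]
        · simp [hb, rank_border_of_notMem hA hb, h2]
      simp only [this, hcompl, if_neg h1, if_pos h2, zero_add]
    · have : ∀ b, ¬ (border b A).rank = k := by
        intro b
        by_cases hb : b ∈ Submodule.span (ZMod 2) (Set.range A.row)
        · simp [rank_border_of_mem hA hb, h1]
        · simp [rank_border_of_notMem hA hb, h2]
      simp [this, h1, h2]

theorem card_symZeroDiag_succ (n : ℕ) :
    (symZeroDiag (n + 1)).card = 2 ^ n * (symZeroDiag n).card := by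
  classical
  have h := card_filter_symZeroDiag_succ n fun _ => True
  simpa [mul_comm] using h

theorem card_symZeroDiag_pos (n : ℕ) : 0 < (symZeroDiag n).card :=
  Finset.card_pos.2 ⟨0, mem_symZeroDiag.2 ⟨Matrix.isSymm_zero, fun _ => rfl⟩⟩

theorem symProb_eq_div (n : ℕ) (p : Matrix (Fin n) (Fin n) (ZMod 2) → Prop) [DecidablePred p] :
    symProb n p = ((symZeroDiag n).filter p).card / (symZeroDiag n).card := by
  unfold symProb
  congr!

theorem symProb_rank_add_two (n k : ℕ) :
    symProb (n + 1) (fun A => A.rank = k + 2) =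
      2 ^ (k + 2) / 2 ^ n * symProb n (fun A => A.rank = k + 2) +
        (1 - 2 ^ k / 2 ^ n) * symProb n (fun A => A.rank = k) := by
  have hpos : ((symZeroDiag n).card : ℝ) ≠ 0 := by exact_mod_cast (card_symZeroDiag_pos n).ne'
  have h : (((symZeroDiag (n + 1)).filter fun A => A.rank = k + 2).card : ℝ) =
      2 ^ (k + 2) * ((symZeroDiag n).filter fun A => A.rank = k + 2).card +
        (2 ^ n - 2 ^ k) * ((symZeroDiag n).filter fun A => A.rank = k).card := by
    rw [card_filter_symZeroDiag_succ, Nat.cast_sum,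
      Finset.sum_congr rfl fun A hA => card_filter_rank_border hA (k + 2),
      Finset.sum_add_distrib, ← Finset.sum_filter, ← Finset.sum_filter, Finset.sum_const,
      nsmul_eq_mul, mul_comm]
    simp only [add_left_inj]
    congr 1
    rw [Finset.sum_congr rfl fun A hA => by rw [(Finset.mem_filter.1 hA).2], Finset.sum_const,
      nsmul_eq_mul, mul_comm]
  simp only [symProb_eq_div, card_symZeroDiag_succ]
  push_cast
  have h2 : (2 : ℝ) ^ n ≠ 0 := by positivity
  field_simp
  exact h

theorem symProb_rank_eq_zero_of_lt {n k : ℕ} (h : n < k) :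
    symProb n (fun A => A.rank = k) = 0 := by
  have (A : Matrix (Fin n) (Fin n) (ZMod 2)) : ¬ A.rank = k := by
    have := A.rank_le_width
    omega
  simp [symProb, this]

theorem card_symZeroDiag (n : ℕ) : (symZeroDiag n).card = 2 ^ n.choose 2 := by
  induction n with
  | zero => decide
  | succ n ih =>
    rw [card_symZeroDiag_succ, ih, ← pow_add, Nat.choose_succ_succ' n 1, Nat.choose_one_right]

theorem symProb_rank_zero (n : ℕ) :
    symProb n (fun A => A.rank = 0) = (1 / 2) ^ n.choose 2 := by
  have hc : (((symZeroDiag n).filter fun A => A.rank = 0).card) = 1 := by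
    refine Finset.card_eq_one.2 ⟨0, Finset.eq_singleton_iff_unique_mem.2 ⟨?_, fun A hA => ?_⟩⟩
    · simp [mem_symZeroDiag, Matrix.isSymm_zero]
    · have h := (Finset.mem_filter.1 hA).2
      rw [Matrix.rank_eq_finrank_span_row, Submodule.finrank_eq_zero, Submodule.span_eq_bot] at h
      exact funext fun i => h _ ⟨i, rfl⟩
  rw [symProb_eq_div, hc, card_symZeroDiag]
  simp

/-- The product of `1 - 2 ^ (-j)` over `1 ≤ j ≤ n`. -/
def halfPochhammer (n : ℕ) : ℝ := ∏ j ∈ Finset.range n, (1 - (1 / 2) ^ (j + 1))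

/-- The product of `1 - 4 ^ (-j)` over `1 ≤ j ≤ h`. -/
def quarterPochhammer (h : ℕ) : ℝ := ∏ j ∈ Finset.range h, (1 - (1 / 4) ^ (j + 1))

theorem halfPochhammer_succ (n : ℕ) :
    halfPochhammer (n + 1) = halfPochhammer n * (1 - (1 / 2) ^ (n + 1)) :=
  Finset.prod_range_succ _ _

theorem quarterPochhammer_succ (h : ℕ) :
    quarterPochhammer (h + 1) = quarterPochhammer h * (1 - (1 / 4) ^ (h + 1)) :=
  Finset.prod_range_succ _ _

theorem halfPochhammer_zero : halfPochhammer 0 = 1 := Finset.prod_range_zero _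

theorem quarterPochhammer_zero : quarterPochhammer 0 = 1 := Finset.prod_range_zero _

theorem one_quarter_lt_halfPochhammer (n : ℕ) : 1 / 4 < halfPochhammer n := by
  suffices h : ∀ n, 1 / 4 + (1 / 2 : ℝ) ^ (n + 2) ≤ halfPochhammer (n + 1) by
    cases n with
    | zero => norm_num [halfPochhammer_zero]
    | succ n => linarith [h n, show (0 : ℝ) < (1 / 2) ^ (n + 2) by positivity]
  intro n
  induction n with
  | zero => norm_num [halfPochhammer_succ, halfPochhammer_zero]
  | succ n ih =>
    rw [halfPochhammer_succ]
    have h0 : (0 : ℝ) < (1 / 2) ^ n := by positivity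
    have h1 : (1 / 2 : ℝ) ^ n ≤ 1 := pow_le_one₀ (by norm_num) (by norm_num)
    simp only [pow_succ] at ih ⊢
    nlinarith

theorem halfPochhammer_le_one (n : ℕ) : halfPochhammer n ≤ 1 :=
  Finset.prod_le_one
    (fun j _ => sub_nonneg.2 (pow_le_one₀ (by norm_num) (by norm_num)))
    fun j _ => sub_le_self _ (by positivity)

theorem halfPochhammer_antitone : Antitone halfPochhammer := by
  refine antitone_nat_of_succ_le fun n => ?_
  rw [halfPochhammer_succ]
  refine mul_le_of_le_one_right ?_ (sub_le_self _ (by positivity))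
  linarith [one_quarter_lt_halfPochhammer n]

theorem two_thirds_lt_quarterPochhammer (h : ℕ) : 2 / 3 < quarterPochhammer h := by
  suffices H : 2 / 3 + 1 / 3 * (1 / 4 : ℝ) ^ h ≤ quarterPochhammer h by
    linarith [show (0 : ℝ) < (1 / 4) ^ h by positivity]
  induction h with
  | zero => norm_num [quarterPochhammer_zero]
  | succ h ih =>
    rw [quarterPochhammer_succ]
    have h0 : (0 : ℝ) < (1 / 4) ^ h := by positivity
    have h1 : (1 / 4 : ℝ) ^ h ≤ 1 := pow_le_one₀ (by norm_num) (by norm_num)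
    simp only [pow_succ]
    nlinarith

theorem quarterPochhammer_le_one (h : ℕ) : quarterPochhammer h ≤ 1 :=
  Finset.prod_le_one
    (fun j _ => sub_nonneg.2 (pow_le_one₀ (by norm_num) (by norm_num)))
    fun j _ => sub_le_self _ (by positivity)

theorem symProb_rank_two_mul (h d : ℕ) :
    symProb (2 * h + d) (fun A => A.rank = 2 * h) =
      (1 / 2) ^ d.choose 2 *
        (halfPochhammer (2 * h + d) / (halfPochhammer d * quarterPochhammer h)) := by
  have hp (m : ℕ) : halfPochhammer m ≠ 0 := by linarith [one_quarter_lt_halfPochhammer m]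
  have hq (m : ℕ) : quarterPochhammer m ≠ 0 := by linarith [two_thirds_lt_quarterPochhammer m]
  induction h generalizing d with
  | zero =>
    have := hp d
    simp only [mul_zero, zero_add, symProb_rank_zero, quarterPochhammer_zero, mul_one]
    field_simp
  | succ h ih =>
    induction d with
    | zero =>
      rw [show 2 * (h + 1) + 0 = 2 * h + 1 + 1 by ring, show 2 * (h + 1) = 2 * h + 2 by ring,
        symProb_rank_add_two, symProb_rank_eq_zero_of_lt (by omega), ih 1]
      have h1 := hp (2 * h + 1)
      have h2 := hq h
      have h3 := hq (h + 1)
      rw [quarterPochhammer_succ] at h3 ⊢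
      rw [halfPochhammer_succ (2 * h + 1), halfPochhammer_succ 0, halfPochhammer_zero,
        show (1 / 2 : ℝ) ^ (2 * h + 1 + 1) = (1 / 4) ^ (h + 1) by
          rw [show 2 * h + 1 + 1 = 2 * (h + 1) by ring, pow_mul]; norm_num]
      have h4 : 1 - (1 / 4 : ℝ) ^ (h + 1) ≠ 0 := right_ne_zero_of_mul h3
      rw [pow_succ 2 (2 * h)]
      field_simp
      norm_num
      ring
    | succ d ihd =>
      rw [show 2 * (h + 1) + (d + 1) = 2 * (h + 1) + d + 1 by ring,
        show 2 * (h + 1) = 2 * h + 2 by ring, symProb_rank_add_two,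
        show 2 * h + 2 = 2 * (h + 1) by ring, ihd,
        show 2 * (h + 1) + d = 2 * h + (d + 2) by ring, ih (d + 2)]
      have h1 := hp (2 * h + (d + 2))
      have h2 := hq h
      have h3 := hq (h + 1)
      have h4 := hp d
      have h5 := hp (d + 1)
      have h6 := hp (d + 1 + 1)
      rw [halfPochhammer_succ (2 * h + (d + 2)), halfPochhammer_succ (d + 1)]
      rw [halfPochhammer_succ (d + 1)] at h6
      rw [halfPochhammer_succ d] at h5 h6 ⊢
      rw [quarterPochhammer_succ] at h3 ⊢
      have hx1 := right_ne_zero_of_mul h5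
      have hx2 := right_ne_zero_of_mul h6
      have hy := right_ne_zero_of_mul h3
      have hc1 : (d + 1).choose 2 = d + d.choose 2 := by
        rw [Nat.choose_succ_succ' d 1, Nat.choose_one_right]
      have hc2 : (d + 2).choose 2 = d + 1 + (d + d.choose 2) := by
        rw [Nat.choose_succ_succ' (d + 1) 1, Nat.choose_one_right, hc1]
      have hxy : (1 / 2 : ℝ) ^ (2 * h + (d + 2) + 1) = (1 / 2) ^ d * (1 / 4) ^ h / 8 := by
        rw [show 2 * h + (d + 2) + 1 = d + 2 * h + 3 by ring, pow_add, pow_add, pow_mul]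
        norm_num
        ring
      have hr1 : (2 : ℝ) ^ (2 * (h + 1)) / 2 ^ (2 * h + (d + 2)) = (1 / 2) ^ d := by
        rw [show 2 * h + (d + 2) = 2 * (h + 1) + d by ring, pow_add, one_div, inv_pow]
        field_simp
      have hr2 : (2 : ℝ) ^ (2 * h) / 2 ^ (2 * h + (d + 2)) = (1 / 2) ^ d / 4 := by
        rw [pow_add, pow_add 2 d, one_div, inv_pow]
        field_simp
        norm_num
      rw [hc1, hc2, hxy, hr1, hr2]
      simp only [pow_add, pow_one] at hx1 hx2 hy ⊢
      generalize (1 / 2 : ℝ) ^ d = x at *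
      generalize (1 / 4 : ℝ) ^ h = y at *
      generalize (1 / 2 : ℝ) ^ d.choose 2 = t at *
      have hx1' : 2 - x ≠ 0 := fun h => hx1 (by linarith)
      have hx2' : 4 - x ≠ 0 := fun h => hx2 (by linarith)
      have hy' : 4 - y ≠ 0 := fun h => hy (by linarith)
      rw [show 1 - x * (1 / 2) = (2 - x) / 2 by ring,
        show 1 - x * (1 / 2) * (1 / 2) = (4 - x) / 4 by ring,
        show 1 - y * (1 / 4) = (4 - y) / 4 by ring]
      field_simp
      ring

theorem rpow_mul_rpow_eq_half_pow_choose (d : ℕ) :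
    (2 : ℝ) ^ (-((d : ℝ) ^ 2 / 2)) * (2 : ℝ) ^ ((d : ℝ) / 2) = (1 / 2) ^ d.choose 2 := by
  rw [← Real.rpow_add two_pos, one_div, inv_pow, ← Real.rpow_natCast 2 (d.choose 2),
    ← Real.rpow_neg two_pos.le,
    Nat.cast_choose_two]
  ring_nf

/-- for `0 ≤ h ≤ ⌊n/2⌋`, the fraction of `n × n` symmetric zero-diagonal
matrices over `ZMod 2` of rank exactly `2h` lies between
`(e^(-2)/4) * 2^(-(n-2h)^2/2) * 2^((n-2h)/2)` and `e^(2/3) * 2^(-(n-2h)^2/2) * 2^((n-2h)/2)`. -/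
theorem stmt_13 (n h : ℕ) (hh : 2 * h ≤ n) :
    Real.exp (-2) / 4 * (2 : ℝ) ^ (-(((n : ℝ) - 2 * h) ^ 2 / 2)) *
          (2 : ℝ) ^ (((n : ℝ) - 2 * h) / 2) ≤
        symProb n (fun A => A.rank = 2 * h) ∧
      symProb n (fun A => A.rank = 2 * h) ≤
        Real.exp (2 / 3) * (2 : ℝ) ^ (-(((n : ℝ) - 2 * h) ^ 2 / 2)) *
          (2 : ℝ) ^ (((n : ℝ) - 2 * h) / 2) := by
  obtain ⟨d, rfl⟩ := Nat.exists_eq_add_of_le hh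
  have hd : ((2 * h + d : ℕ) : ℝ) - 2 * h = d := by push_cast; ring
  rw [hd, mul_assoc, mul_assoc, rpow_mul_rpow_eq_half_pow_choose, symProb_rank_two_mul,
    mul_comm _ ((1 / 2 : ℝ) ^ d.choose 2), mul_comm _ ((1 / 2 : ℝ) ^ d.choose 2)]
  have hn := one_quarter_lt_halfPochhammer (2 * h + d)
  have hd0 := one_quarter_lt_halfPochhammer d
  have hq := two_thirds_lt_quarterPochhammer h
  have hden : 0 < halfPochhammer d * quarterPochhammer h := by
    apply mul_pos <;> linarith
  constructor <;> refine mul_le_mul_of_nonneg_left ?_ (by positivity)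
  · have hexp : Real.exp (-2) ≤ 1 := Real.exp_le_one_iff.2 (by norm_num)
    rw [le_div_iff₀ hden]
    have : halfPochhammer d * quarterPochhammer h ≤ 1 :=
      mul_le_one₀ (halfPochhammer_le_one d) (by linarith) (quarterPochhammer_le_one h)
    nlinarith [Real.exp_pos (-2)]
  · have hexp : (3 / 2 : ℝ) ≤ Real.exp (2 / 3) := by linarith [Real.add_one_le_exp (2 / 3 : ℝ)]
    rw [div_le_iff₀ hden]
    have hle : halfPochhammer (2 * h + d) ≤ halfPochhammer d :=
      halfPochhammer_antitone (Nat.le_add_left _ _)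
    calc halfPochhammer (2 * h + d) ≤ 3 / 2 * (halfPochhammer d * quarterPochhammer h) := by
          nlinarith
      _ ≤ _ := by gcongr
end
end

section
/- Let S_n be the set of n × n symmetric matrices over 𝔽₂ with zero diagonal, let A be uniformly distributed on S_n, let S ⊆ {1,…,n}, and let A[S] denote the principal submatrix of A on the rows and columns indexed by S. Then for every integer t with 0 ≤ t ≤ |S|: P( |S| − rank(A[S]) ≥ t ) ≥ (e^{-2}/4) · 2^{-t²/2 − t/2}. -/
open scoped BigOperators

noncomputable section

/-- The alternating matrices over `𝔽₂` indexed by `ι`. -/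
abbrev AltMatrix (ι : Type*) :=
  {A : Matrix ι ι (ZMod 2) // A.IsSymm ∧ ∀ i, A i i = 0}

namespace AltMatrix

/-- Reindexing alternating matrices along an equivalence. -/
def reindex {α β : Type*} (e : α ≃ β) : AltMatrix α ≃ AltMatrix β :=
  (Matrix.reindex e e).subtypeEquiv fun A => by
    constructor
    · rintro ⟨h, h0⟩
      exact ⟨by simpa using h.submatrix e.symm, fun i => by simpa using h0 _⟩
    · rintro ⟨h, h0⟩
      exact ⟨by simpa using h.submatrix e, fun i => by simpa using h0 (e i)⟩

/-- An alternating matrix on a sum type amounts to its two diagonal blocks and one off-diagonal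
block. -/
def sumEquiv (α β : Type*) :
    AltMatrix (α ⊕ β) ≃ AltMatrix α × AltMatrix β × Matrix α β (ZMod 2) where
  toFun A := (⟨A.1.toBlocks₁₁, A.2.1.submatrix Sum.inl, fun i => A.2.2 (Sum.inl i)⟩,
    ⟨A.1.toBlocks₂₂, A.2.1.submatrix Sum.inr, fun i => A.2.2 (Sum.inr i)⟩, A.1.toBlocks₁₂)
  invFun B := ⟨Matrix.fromBlocks B.1.1 B.2.2 B.2.2.transpose B.2.1.1,
    B.1.2.1.fromBlocks rfl B.2.1.2.1, by
      rintro (i | i)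
      · exact B.1.2.2 i
      · exact B.2.1.2.2 i⟩
  left_inv A := by
    apply Subtype.ext
    have h : A.1.toBlocks₁₂.transpose = A.1.toBlocks₂₁ := by
      ext i j
      exact A.2.1.apply (Sum.inr i) (Sum.inl j)
    simp only [h]
    exact Matrix.fromBlocks_toBlocks A.1
  right_inv B := by simp

variable {α β : Type*}

theorem card_matrix [Finite α] [Finite β] :
    Nat.card (Matrix α β (ZMod 2)) = 2 ^ (Nat.card α * Nat.card β) := by
  unfold Matrix
  simp [Nat.card_fun, ← pow_mul, mul_comm]

theorem card_sum [Finite α] [Finite β] : Nat.card (AltMatrix (α ⊕ β)) =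
    Nat.card (AltMatrix α) * Nat.card (AltMatrix β) * 2 ^ (Nat.card α * Nat.card β) := by
  rw [Nat.card_congr (sumEquiv α β), Nat.card_prod, Nat.card_prod, card_matrix, mul_assoc]

theorem card_pos [Finite α] : 0 < Nat.card (AltMatrix α) :=
  have : Nonempty (AltMatrix α) := ⟨0, Matrix.isSymm_zero, fun _ => rfl⟩
  Nat.card_pos

theorem card_of_subsingleton [Subsingleton α] : Nat.card (AltMatrix α) = 1 := by
  have : Nonempty (AltMatrix α) := ⟨0, Matrix.isSymm_zero, fun _ => rfl⟩
  have : Subsingleton (AltMatrix α) := ⟨fun A B => by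
    apply Subtype.ext
    ext i j
    rw [Subsingleton.elim j i, A.2.2, B.2.2]⟩
  exact Nat.card_unique

theorem card_fin (s : ℕ) : Nat.card (AltMatrix (Fin s)) = 2 ^ s.choose 2 := by
  induction s with
  | zero => simpa using card_of_subsingleton (α := Fin 0)
  | succ s ih =>
    rw [Nat.card_congr (reindex finSumFinEquiv.symm), card_sum, ih, card_of_subsingleton,
      Nat.card_fin, Nat.card_fin, mul_one, mul_one, ← pow_add, Nat.choose_succ_succ' s 1, Nat.choose_one_right, add_comm]

/-- An alternating matrix of odd size is singular: in the Leibniz formula the terms of a permutation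
and of its inverse cancel, and an involution of an odd set has a fixed point. -/
theorem det_eq_zero_of_odd [Fintype α] [DecidableEq α] (h : Odd (Fintype.card α))
    (A : AltMatrix α) : A.1.det = 0 := by
  rw [Matrix.det_apply]
  have hsign : ∀ (σ : Equiv.Perm α) (x : ZMod 2), Equiv.Perm.sign σ • x = x := fun σ x => by
    rcases Int.units_eq_one_or (Equiv.Perm.sign σ) with h | h
    · rw [h, one_smul]
    · rw [h, Units.neg_smul, one_smul, CharTwo.neg_eq]
  simp only [hsign]
  refine Finset.sum_involution (fun σ _ => σ⁻¹) (fun σ _ => ?_) (fun σ _ hσ hinv => hσ ?_)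
    (fun _ _ => Finset.mem_univ _) (fun _ _ => inv_inv _)
  · have : ∏ i, A.1 (σ⁻¹ i) i = ∏ i, A.1 (σ i) i := by
      rw [← Equiv.prod_comp σ]
      refine Finset.prod_congr rfl fun i _ => ?_
      rw [Equiv.Perm.inv_def, Equiv.symm_apply_apply]
      exact A.2.1.apply _ _
    rw [this, CharTwo.add_self_eq_zero]
  · have hσ2 : σ ^ 2 ^ 1 = 1 := by
      rw [pow_one, sq]
      nth_rewrite 1 [← hinv]
      exact inv_mul_cancel σ
    obtain ⟨i, hi⟩ := Equiv.Perm.exists_fixed_point_of_prime (p := 2)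
      (by rwa [← Nat.not_even_iff_odd, even_iff_two_dvd] at h) hσ2
    refine Finset.prod_eq_zero (Finset.mem_univ i) ?_
    rw [hi]
    exact A.2.2 i

theorem zmod_two_eq_one {a : ZMod 2} (h : a ≠ 0) : a = 1 := by
  revert a; decide

open Matrix in
/-- A singular alternating matrix of even size has at least three nonzero kernel vectors. -/
theorem three_le_card_ker [Fintype α] [DecidableEq α] (h : Even (Fintype.card α))
    (A : AltMatrix α) (hA : A.1.det = 0) :
    3 ≤ Nat.card {x : α → ZMod 2 // x ≠ 0 ∧ A.1 *ᵥ x = 0} := by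
  obtain ⟨x, hx, hAx⟩ := Matrix.exists_mulVec_eq_zero_iff.mpr hA
  obtain ⟨i, hi⟩ := Function.ne_iff.mp hx
  have hodd : Odd (Fintype.card {j // j ≠ i}) := by
    have : Nonempty α := ⟨i⟩
    have := Fintype.card_pos (α := α)
    rw [Fintype.card_subtype_compl, Fintype.card_subtype_eq]
    exact Nat.Even.sub_odd this h odd_one
  obtain ⟨y, hy, hAy⟩ := Matrix.exists_mulVec_eq_zero_iff.mpr
    (det_eq_zero_of_odd hodd ⟨A.1.submatrix Subtype.val Subtype.val,
      A.2.1.submatrix _, fun j => A.2.2 j⟩)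
  set z : α → ZMod 2 := fun j => if hj : j ≠ i then y ⟨j, hj⟩ else 0 with hz
  have hzi : z i = 0 := by simp [hz]
  have hzy : ∀ j : {j // j ≠ i}, z j = y j := fun j => by simp [hz, j.2]
  have hz0 : z ≠ 0 := fun h0 => hy <| funext fun j => by rw [← hzy, h0]; rfl
  have hAz : ∀ j, j ≠ i → (A.1 *ᵥ z) j = 0 := fun j hj => by
    have := congrFun hAy ⟨j, hj⟩
    simp only [mulVec, dotProduct, submatrix_apply, Pi.zero_apply] at this ⊢
    rw [Fintype.sum_eq_add_sum_subtype_ne (fun k => A.1 j k * z k) i, hzi, mul_zero, zero_add]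
    refine Eq.trans ?_ this
    exact Finset.sum_congr rfl fun k _ => congrArg (A.1 j k * ·) (hzy k)
  have hAz' : A.1 *ᵥ z = 0 := by
    have hdot : x ⬝ᵥ A.1 *ᵥ z = 0 := by
      rw [dotProduct_mulVec, ← mulVec_transpose, A.2.1.eq, hAx, zero_dotProduct]
    rw [dotProduct, Fintype.sum_eq_single i fun j hj => by rw [hAz j hj, mul_zero]] at hdot
    ext j
    by_cases hj : j = i
    · subst hj; exact (mul_eq_zero.mp hdot).resolve_left hi
    · exact hAz j hj
  have hxz : x ≠ z := fun e => hi (by rw [e, hzi]; rfl)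
  have hzx : x + z ≠ 0 := fun e => hxz <| funext fun j => CharTwo.add_eq_zero.mp (congrFun e j)
  let T : Finset (α → ZMod 2) := {x, z, x + z}
  have hT : T.card = 3 := Finset.card_eq_three.mpr
    ⟨x, z, x + z, hxz, fun e => hz0 (left_eq_add.mp e), fun e => hx (right_eq_add.mp e), rfl⟩
  let f : T → {x : α → ZMod 2 // x ≠ 0 ∧ A.1 *ᵥ x = 0} := fun v => ⟨v.1, by
    obtain ⟨v, hv⟩ := v
    simp only [T, Finset.mem_insert, Finset.mem_singleton] at hv
    rcases hv with rfl | rfl | rfl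
    · exact ⟨hx, hAx⟩
    · exact ⟨hz0, hAz'⟩
    · exact ⟨hzx, by rw [mulVec_add, hAx, hAz', add_zero]⟩⟩
  have hf : Function.Injective f := fun v w h => Subtype.ext (congrArg (·.1) h)
  simpa [hT] using Nat.card_le_card_of_injective f hf

open Matrix in
/-- A fixed nonzero vector lies in the kernel of few alternating matrices. -/
theorem card_mulVec_eq_zero_le [Fintype α] [DecidableEq α] {x : α → ZMod 2} (hx : x ≠ 0) :
    Nat.card {A : AltMatrix α // A.1 *ᵥ x = 0} * 2 ^ Fintype.card α ≤
      2 * Nat.card (AltMatrix α) := by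
  obtain ⟨i, hi⟩ := Function.ne_iff.mp hx
  have hi1 : x i = 1 := zmod_two_eq_one hi
  let M : ({j // j ≠ i} → ZMod 2) → Matrix α α (ZMod 2) := fun w j k =>
    if hj : j ≠ i then if k = i then w ⟨j, hj⟩ else 0
    else if hk : k ≠ i then w ⟨k, hk⟩ else 0
  have hMx : ∀ w (j : {j // j ≠ i}), (M w *ᵥ x) j = w j := fun w j => by
    simp [M, mulVec, dotProduct, j.2, hi1]
  let f : {A : AltMatrix α // A.1 *ᵥ x = 0} × ({j // j ≠ i} → ZMod 2) → AltMatrix α :=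
    fun p => ⟨p.1.1.1 + M p.2, p.1.1.2.1.add (by
      refine IsSymm.ext fun j k => ?_
      by_cases hj : j = i <;> by_cases hk : k = i <;> simp [M, hj, hk]), fun j => by
      rw [Matrix.add_apply, p.1.1.2.2 j]
      by_cases hj : j = i <;> simp [M, hj]⟩
  have hf : Function.Injective f := by
    rintro ⟨⟨A, hA⟩, v⟩ ⟨⟨B, hB⟩, w⟩ hab
    have hab' : A.1 + M v = B.1 + M w := congrArg Subtype.val hab
    have hvw : v = w := by
      have h := congrArg (· *ᵥ x) hab'
      simp only [add_mulVec, hA, hB, zero_add] at h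
      ext j
      rw [← hMx v, h, hMx w]
    subst hvw
    have := add_right_cancel hab'
    simp [Subtype.ext_iff, this]
  have := Nat.card_le_card_of_injective f hf
  have hcard : Fintype.card α = Fintype.card {j // j ≠ i} + 1 := by
    have : Nonempty α := ⟨i⟩
    have := Fintype.card_pos (α := α)
    rw [Fintype.card_subtype_compl, Fintype.card_subtype_eq]
    omega
  rw [Nat.card_prod, Nat.card_fun, Nat.card_zmod, Nat.card_eq_fintype_card (α := {j // j ≠ i})]
    at this
  rw [hcard, pow_succ]
  linarith

open Matrix in
/-- At most two thirds of the alternating matrices of a given even size are singular. -/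
theorem three_mul_card_singular_le [Fintype α] [DecidableEq α] (h : Even (Fintype.card α)) :
    3 * Nat.card {A : AltMatrix α // A.1.det = 0} ≤ 2 * Nat.card (AltMatrix α) := by
  classical
  have : Fintype (AltMatrix α) := Fintype.ofFinite _
  let e : (Σ A : AltMatrix α, {x : α → ZMod 2 // x ≠ 0 ∧ A.1 *ᵥ x = 0}) ≃
      Σ x : {x : α → ZMod 2 // x ≠ 0}, {A : AltMatrix α // A.1 *ᵥ x = 0} :=
    { toFun := fun p => ⟨⟨p.2.1, p.2.2.1⟩, ⟨p.1, p.2.2.2⟩⟩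
      invFun := fun p => ⟨p.2.1, ⟨p.1.1, p.1.2, p.2.2⟩⟩
      left_inv := fun _ => rfl
      right_inv := fun _ => rfl }
  have he := Nat.card_congr e
  rw [Nat.card_sigma, Nat.card_sigma] at he
  have hlow : 3 * Nat.card {A : AltMatrix α // A.1.det = 0} ≤
      ∑ A : AltMatrix α, Nat.card {x : α → ZMod 2 // x ≠ 0 ∧ A.1 *ᵥ x = 0} := by
    rw [Nat.card_eq_fintype_card, Fintype.card_subtype, mul_comm, ← smul_eq_mul,
      ← Finset.sum_const]
    refine (Finset.sum_le_sum fun A hA => ?_).trans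
      (Finset.sum_le_sum_of_subset (Finset.subset_univ _))
    exact three_le_card_ker h A (Finset.mem_filter.mp hA).2
  have hup : (∑ x : {x : α → ZMod 2 // x ≠ 0}, Nat.card {A : AltMatrix α // A.1 *ᵥ x.1 = 0}) *
      2 ^ Fintype.card α ≤ 2 ^ Fintype.card α * (2 * Nat.card (AltMatrix α)) := by
    rw [Finset.sum_mul]
    refine (Finset.sum_le_sum fun x _ => card_mulVec_eq_zero_le x.2).trans ?_
    rw [Finset.sum_const, smul_eq_mul, Finset.card_univ]
    refine Nat.mul_le_mul_right _ ((Fintype.card_subtype_le _).trans ?_)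
    simp
  rw [← he, mul_comm] at hup
  exact hlow.trans (Nat.le_of_mul_le_mul_left hup (by positivity))

open Matrix in
/-- At least a third of the alternating matrices of a given even size are nonsingular. -/
theorem card_le_three_mul_card_nonsingular [Fintype α] [DecidableEq α]
    (h : Even (Fintype.card α)) :
    Nat.card (AltMatrix α) ≤ 3 * Nat.card {A : AltMatrix α // A.1.det ≠ 0} := by
  classical
  have : Fintype (AltMatrix α) := Fintype.ofFinite _
  have h1 := three_mul_card_singular_le h
  have h2 := Fintype.card_subtype_compl (fun A : AltMatrix α => A.1.det = 0)
  simp only [Nat.card_eq_fintype_card] at h1 ⊢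
  have h3 := Fintype.card_subtype_le (fun A : AltMatrix α => A.1.det = 0)
  simp only [ne_eq]
  omega

open Matrix in
theorem dotProduct_mulVec_self [Fintype α] (A : AltMatrix α) (x : α → ZMod 2) :
    x ⬝ᵥ A.1 *ᵥ x = 0 := by
  simp only [dotProduct, mulVec, Finset.mul_sum]
  rw [← Fintype.sum_prod_type']
  refine Finset.sum_involution (fun p _ => p.swap) (fun p _ => ?_) (fun p _ hp hswap => hp ?_)
    (fun _ _ => Finset.mem_univ _) (fun _ _ => rfl)
  · have : A.1 p.2 p.1 = A.1 p.1 p.2 := A.2.1.apply _ _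
    simp only [Prod.fst_swap, Prod.snd_swap, this]
    rw [show x p.2 * (A.1 p.1 p.2 * x p.1) = x p.1 * (A.1 p.1 p.2 * x p.2) by ring,
      CharTwo.add_self_eq_zero]
  · have : p.2 = p.1 := congrArg Prod.fst hswap
    rw [this, A.2.2, zero_mul, mul_zero]

open Matrix in
/-- A nonsingular alternating block `B` and an arbitrary matrix `X` determine the alternating matrix
with blocks `B`, `B X`, `Xᵀ B` and `Xᵀ B X`, whose rank is that of `B`. -/
theorem card_nonsingular_mul_le [Fintype α] [DecidableEq α] [Fintype β] [DecidableEq β] :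
    Nat.card {B : AltMatrix α // B.1.det ≠ 0} * 2 ^ (Fintype.card α * Fintype.card β) ≤
      Nat.card {A : AltMatrix (α ⊕ β) // A.1.rank ≤ Fintype.card α} := by
  let Y : Matrix α β (ZMod 2) → Matrix α (α ⊕ β) (ZMod 2) := fun X => fromCols 1 X
  have hY : ∀ B X, (Y X)ᵀ * B * Y X = fromBlocks B (B * X) (Xᵀ * B) (Xᵀ * B * X) := fun B X => by
    rw [transpose_fromCols, fromRows_mul, fromRows_mul_fromCols]
    simp only [transpose_one, Matrix.one_mul, Matrix.mul_one]
    rfl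
  let f : {B : AltMatrix α // B.1.det ≠ 0} × Matrix α β (ZMod 2) →
      {A : AltMatrix (α ⊕ β) // A.1.rank ≤ Fintype.card α} := fun p =>
    ⟨⟨(Y p.2)ᵀ * p.1.1.1 * Y p.2, by
        rw [IsSymm, transpose_mul, transpose_mul, transpose_transpose, p.1.1.2.1.eq,
          Matrix.mul_assoc], fun i => by
        rw [Matrix.mul_assoc]
        exact dotProduct_mulVec_self p.1.1 fun k => Y p.2 k i⟩,
      (rank_mul_le_right _ _).trans (rank_le_card_height _)⟩
  have hf : Function.Injective f := by
    rintro ⟨⟨B, hB⟩, X⟩ ⟨⟨C, hC⟩, Z⟩ hab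
    have hab' : (Y X)ᵀ * B.1 * Y X = (Y Z)ᵀ * C.1 * Y Z := congrArg (fun A => A.1.1) hab
    rw [hY, hY, fromBlocks_inj] at hab'
    obtain ⟨hBC, hXZ, -⟩ := hab'
    obtain rfl : B = C := Subtype.ext hBC
    have : X = Z := by
      have h := congrArg (B.1⁻¹ * ·) hXZ
      have hu := isUnit_iff_ne_zero.mpr hB
      exact (nonsing_inv_mul_cancel_left _ X hu).symm.trans
        (h.trans (nonsing_inv_mul_cancel_left _ Z hu))
    rw [this]
  have h := Nat.card_le_card_of_injective f hf
  rwa [Nat.card_prod, card_matrix, Nat.card_eq_fintype_card (α := α),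
    Nat.card_eq_fintype_card (α := β)] at h

/-- A lower bound for the proportion of alternating matrices of corank at least `s`. -/
theorem card_le_mul_card_rank_le {γ : Type*} [Fintype γ] {r s : ℕ}
    (hγ : Fintype.card γ = r + s) (hr : Even r) :
    Nat.card (AltMatrix γ) ≤ 3 * 2 ^ s.choose 2 * Nat.card {A : AltMatrix γ // A.1.rank ≤ r} := by
  let e : Fin r ⊕ Fin s ≃ γ := Fintype.equivOfCardEq (by simp [hγ])
  have h1 := card_le_three_mul_card_nonsingular (α := Fin r) (by simpa using hr)
  have h2 := card_nonsingular_mul_le (α := Fin r) (β := Fin s)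
  have h3 : Nat.card {A : AltMatrix (Fin r ⊕ Fin s) // A.1.rank ≤ Fintype.card (Fin r)} =
      Nat.card {A : AltMatrix γ // A.1.rank ≤ r} :=
    Nat.card_congr <| (reindex e).subtypeEquiv fun A => by
      rw [Fintype.card_fin]
      exact (Matrix.rank_reindex e e A.1).symm ▸ Iff.rfl
  rw [← h3, ← Nat.card_congr (reindex e), card_sum, card_fin s]
  simp only [Fintype.card_fin, Nat.card_fin] at h2 ⊢
  calc _ ≤ 3 * Nat.card {A : AltMatrix (Fin r) // A.1.det ≠ 0} * 2 ^ s.choose 2 * 2 ^ (r * s) := by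
        gcongr
    _ = 3 * 2 ^ s.choose 2 * (Nat.card {A : AltMatrix (Fin r) // A.1.det ≠ 0} * 2 ^ (r * s)) := by
        ring
    _ ≤ _ := by gcongr

end AltMatrix

theorem symProb_eq (n : ℕ) (p : Matrix (Fin n) (Fin n) (ZMod 2) → Prop) :
    symProb n p = (Nat.card {A : AltMatrix (Fin n) // p A.1} : ℝ) /
      Nat.card (AltMatrix (Fin n)) := by
  classical
  have h1 : Nat.card (AltMatrix (Fin n)) = (symZeroDiag n).card := by
    rw [Nat.card_eq_fintype_card, Fintype.card_subtype, symZeroDiag]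
  have h2 : Nat.card {A : AltMatrix (Fin n) // p A.1} = ((symZeroDiag n).filter p).card := by
    rw [Nat.card_congr (Equiv.subtypeSubtypeEquivSubtypeInter
      (fun A : Matrix (Fin n) (Fin n) (ZMod 2) => A.IsSymm ∧ ∀ i, A i i = 0) p),
      Nat.card_eq_fintype_card, Fintype.card_subtype, symZeroDiag, Finset.filter_filter]
  rw [h1, h2, symProb]

/-- The principal submatrix of a uniform alternating matrix is a uniform alternating matrix. -/
theorem symProb_principalSub (n : ℕ) (S : Finset (Fin n)) (p : Matrix S S (ZMod 2) → Prop) :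
    symProb n (fun A => p (principalSub A S)) =
      (Nat.card {B : AltMatrix S // p B.1} : ℝ) / Nat.card (AltMatrix S) := by
  let E := (AltMatrix.reindex (Equiv.sumCompl (· ∈ S)).symm).trans (AltMatrix.sumEquiv _ _)
  have hE : ∀ A, (E A).1.1 = principalSub A.1 S := fun A => rfl
  have h1 := Nat.card_congr E
  have h2 : Nat.card {A : AltMatrix (Fin n) // p (principalSub A.1 S)} = _ :=
    Nat.card_congr ((E.subtypeEquiv (q := fun B => p B.1.1 ∧ True) fun A => by
      rw [hE, and_true]).trans (Equiv.subtypeProdEquivProd (p := fun B : AltMatrix S => p B.1)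
        (q := fun _ => True)))
  rw [Nat.card_prod, Nat.card_congr (Equiv.subtypeUnivEquiv fun _ => trivial)] at h2
  rw [Nat.card_prod] at h1
  have hpos : 0 < Nat.card (AltMatrix (Fin n)) := AltMatrix.card_pos
  rw [h1] at hpos
  have hne := (Nat.pos_of_mul_pos_left hpos).ne'
  rw [symProb_eq, h1, h2, Nat.cast_mul, Nat.cast_mul, mul_div_mul_right _ _ (by exact_mod_cast hne)]

/-- for a uniformly random `n × n` symmetric zero-diagonal matrix over
`ZMod 2`, a subset `S` of `Fin n` and `0 ≤ t ≤ S.card`, the probability that the rank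
deficiency `S.card - rank (A[S])` is at least `t` is at least
`(e^(-2)/4) * 2^(-t^2/2 - t/2)`. -/
theorem stmt_14 (n : ℕ) (S : Finset (Fin n)) (t : ℕ) (ht : t ≤ S.card) :
    Real.exp (-2) / 4 * (2 : ℝ) ^ (-(t : ℝ) ^ 2 / 2 - (t : ℝ) / 2) ≤
      symProb n (fun A => (principalSub A S).rank + t ≤ S.card) := by
  rw [symProb_principalSub n S fun B => B.rank + t ≤ S.card]
  obtain ⟨s, hts, hst, hsS, heven⟩ : ∃ s, t ≤ s ∧ s ≤ t + 1 ∧ s ≤ S.card ∧ Even (S.card - s) := by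
    rcases Nat.even_or_odd (S.card - t) with h | h
    · exact ⟨t, le_rfl, t.le_succ, ht, h⟩
    · have := h.pos
      exact ⟨t + 1, t.le_succ, le_rfl, by omega, by
        rw [← Nat.sub_sub]; exact Nat.Odd.sub_odd h odd_one⟩
  have hcard := AltMatrix.card_le_mul_card_rank_le (γ := S) (r := S.card - s) (s := s)
    (by rw [Fintype.card_coe]; omega) heven
  have hmono : Nat.card {A : AltMatrix S // A.1.rank ≤ S.card - s} ≤
      Nat.card {A : AltMatrix S // A.1.rank + t ≤ S.card} :=
    Nat.card_le_card_of_injective (Subtype.map id fun A hA => by dsimp; omega)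
      (Subtype.map_injective _ Function.injective_id)
  have hpow : 2 ^ s.choose 2 ≤ 2 ^ (t + 1).choose 2 :=
    Nat.pow_le_pow_right two_pos (Nat.choose_le_choose 2 hst)
  have hnat : Nat.card (AltMatrix S) ≤ 3 * 2 ^ (t + 1).choose 2 *
      Nat.card {A : AltMatrix S // A.1.rank + t ≤ S.card} :=
    hcard.trans (by gcongr)
  have hreal : (Nat.card (AltMatrix S) : ℝ) ≤ 3 * 2 ^ (t + 1).choose 2 *
      Nat.card {A : AltMatrix S // A.1.rank + t ≤ S.card} := by exact_mod_cast hnat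
  have hexp : (2 : ℝ) ^ (-(t : ℝ) ^ 2 / 2 - (t : ℝ) / 2) = (2 ^ (t + 1).choose 2)⁻¹ := by
    rw [← Real.rpow_natCast 2 ((t + 1).choose 2), ← Real.rpow_neg zero_le_two, Nat.cast_choose_two]
    congr 1
    push_cast
    ring
  have he : Real.exp (-2) / 4 ≤ 1 / 3 := by
    have := Real.exp_le_one_iff.mpr (by norm_num : (-2 : ℝ) ≤ 0)
    linarith
  have hpos : (0 : ℝ) < Nat.card (AltMatrix S) := by exact_mod_cast AltMatrix.card_pos
  rw [hexp, le_div_iff₀ hpos]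
  calc _ ≤ 1 / 3 * (2 ^ (t + 1).choose 2 : ℝ)⁻¹ * (3 * 2 ^ (t + 1).choose 2 *
        Nat.card {A : AltMatrix S // A.1.rank + t ≤ S.card}) := by gcongr
    _ = _ := by field_simp
end
end
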